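/- Let n and m be distinct natural numbers with n ≥ 6 and m < n(n−1)/2. Then for every group homomorphism φ : Out(F_n) → Out(F_m), the image of φ has at most two elements. -/

import Mathlib

noncomputable section

/-- The free group on `n` generators. -/
abbrev FG (n : ℕ) : Type := FreeGroup (Fin n)

/-- The subgroup of inner automorphisms of the free group `F_n`. -/
def InnFG (n : ℕ) : Subgroup (MulAut (FG n)) :=
  (MulAut.conj : FG n →* MulAut (FG n)).range

instance InnFG.normal (n : ℕ) : (InnFG n).Normal := by
  constructor
  rintro x ⟨g, rfl⟩ e
  refine ⟨e g, ?_⟩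
  ext y
  simp [MulAut.conj_apply, map_mul, map_inv]

/-- The outer automorphism group of the free group `F_n`. -/
def OutFG (n : ℕ) : Type := MulAut (FG n) ⧸ InnFG n

instance (n : ℕ) : Group (OutFG n) :=
  inferInstanceAs (Group (MulAut (FG n) ⧸ InnFG n))

/-! ### Elementary automorphisms of a free group -/

section Elementary

variable {n : ℕ}

open FreeGroup

theorem mulAut_ext {f g : MulAut (FG n)} (h : ∀ k, f (of k) = g (of k)) : f = g := by
  have : f.toMonoidHom = g.toMonoidHom := FreeGroup.ext_hom _ _ h
  ext x
  exact DFunLike.congr_fun this x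

/-- The endomorphism `a_i ↦ a_j ^ s * a_i * a_j ^ t`. -/
def twHom (i j : Fin n) (s t : ℤ) : FG n →* FG n :=
  FreeGroup.lift fun k => if k = i then of j ^ s * of k * of j ^ t else of k

theorem twHom_same (i j : Fin n) (s t : ℤ) :
    twHom i j s t (of i) = of j ^ s * of i * of j ^ t := by simp [twHom]

theorem twHom_ne {i k : Fin n} (j : Fin n) (s t : ℤ) (h : k ≠ i) :
    twHom i j s t (of k) = of k := by simp [twHom, h]

theorem twHom_comp {i j : Fin n} (h : i ≠ j) (s t s' t' : ℤ) :
    (twHom i j s t).comp (twHom i j s' t') = twHom i j (s' + s) (t + t') := by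
  refine FreeGroup.ext_hom _ _ fun k => ?_
  by_cases hk : k = i
  · subst hk
    simp [twHom_same, twHom_ne j s t h.symm, zpow_add, mul_assoc]
  · simp [twHom_ne j _ _ hk]

theorem twHom_zero (i j : Fin n) : twHom i j 0 0 = MonoidHom.id _ := by
  refine FreeGroup.ext_hom _ _ fun k => ?_
  by_cases hk : k = i
  · subst hk
    simp [twHom_same]
  · simp [twHom_ne j _ _ hk]

/-- The automorphism `a_i ↦ a_j ^ s * a_i * a_j ^ t`, for `i ≠ j`. -/
def tw (i j : Fin n) (s t : ℤ) : MulAut (FG n) :=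
  if h : i = j then 1 else
    MonoidHom.toMulEquiv (twHom i j s t) (twHom i j (-s) (-t))
      (by rw [twHom_comp h]; simp [twHom_zero])
      (by rw [twHom_comp h]; simp [twHom_zero])

theorem tw_same {i j : Fin n} (h : i ≠ j) (s t : ℤ) :
    tw i j s t (of i) = of j ^ s * of i * of j ^ t := by
  simp [tw, h, twHom_same]

theorem tw_ne {i k : Fin n} (j : Fin n) (s t : ℤ) (h : k ≠ i) :
    tw i j s t (of k) = of k := by
  by_cases hij : i = j <;> simp [tw, hij, twHom_ne j s t h]

/-- The right transvection `a_i ↦ a_i a_j`. -/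
abbrev rho (i j : Fin n) : MulAut (FG n) := tw i j 0 1

/-- The left transvection `a_i ↦ a_j a_i`. -/
abbrev lam (i j : Fin n) : MulAut (FG n) := tw i j 1 0

/-- The partial conjugation `a_i ↦ a_j⁻¹ a_i a_j`. -/
abbrev pc (i j : Fin n) : MulAut (FG n) := tw i j (-1) 1

/-- The permutation of the generators given by `σ`. -/
def pm (σ : Equiv.Perm (Fin n)) : MulAut (FG n) := freeGroupCongr σ

theorem pm_of (σ : Equiv.Perm (Fin n)) (k : Fin n) : pm σ (of k) = of (σ k) := by
  simp [pm]

/-- The endomorphism inverting the generator `a_i`. -/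
def epsHom (i : Fin n) : FG n →* FG n :=
  FreeGroup.lift fun k => if k = i then (of k)⁻¹ else of k

theorem epsHom_comp (i : Fin n) : (epsHom i).comp (epsHom i) = MonoidHom.id _ := by
  refine FreeGroup.ext_hom _ _ fun k => ?_
  by_cases hk : k = i <;> simp [epsHom, hk]

/-- The automorphism inverting the generator `a_i`. -/
def eps (i : Fin n) : MulAut (FG n) :=
  MonoidHom.toMulEquiv (epsHom i) (epsHom i) (epsHom_comp i) (epsHom_comp i)

theorem eps_same (i : Fin n) : eps i (of i) = (of i)⁻¹ := by simp [eps, epsHom]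

theorem eps_ne {i k : Fin n} (h : k ≠ i) : eps i (of k) = of k := by simp [eps, epsHom, h]

theorem tw_mul {i j : Fin n} (h : i ≠ j) (s t s' t' : ℤ) :
    tw i j s t * tw i j s' t' = tw i j (s + s') (t + t') := by
  refine mulAut_ext fun k => ?_
  by_cases hk : k = i
  · subst hk
    rw [add_comm s s']
    simp [tw_same h, tw_ne j s t h.symm, zpow_add, mul_assoc]
  · simp [tw_ne j _ _ hk]

theorem tw_zero {i j : Fin n} : tw i j 0 0 = 1 := by
  refine mulAut_ext fun k => ?_
  by_cases hij : i = j
  · simp [tw, hij]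
  by_cases hk : k = i
  · subst hk; simp [tw_same hij]
  · simp [tw_ne j _ _ hk]

theorem tw_inv {i j : Fin n} (h : i ≠ j) (s t : ℤ) : (tw i j s t)⁻¹ = tw i j (-s) (-t) := by
  rw [inv_eq_iff_mul_eq_one, tw_mul h]; simp [tw_zero]

theorem tw_comm {i j k l : Fin n} (hij : i ≠ j) (hkl : k ≠ l) (hik : i ≠ k) (hil : i ≠ l)
    (hkj : k ≠ j) (s t s' t' : ℤ) :
    tw i j s t * tw k l s' t' = tw k l s' t' * tw i j s t := by
  refine mulAut_ext fun x => ?_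
  simp only [MulAut.mul_apply]
  by_cases hxi : x = i
  · subst hxi
    simp [tw_same hij, tw_ne _ _ _ hik, tw_ne _ _ _ hkj.symm]
  by_cases hxk : x = k
  · subst hxk
    simp [tw_same hkl, tw_ne _ _ _ hik.symm, tw_ne _ _ _ hil.symm]
  · simp [tw_ne _ _ _ hxi, tw_ne _ _ _ hxk]

theorem rho_comm_lam {i j l : Fin n} (hij : i ≠ j) (hil : i ≠ l) (s t : ℤ) :
    tw i j 0 t * tw i l s 0 = tw i l s 0 * tw i j 0 t := by
  refine mulAut_ext fun x => ?_
  simp only [MulAut.mul_apply]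
  by_cases hxi : x = i
  · subst hxi
    simp [tw_same hij, tw_same hil, tw_ne _ _ _ hij.symm, tw_ne _ _ _ hil.symm, mul_assoc]
  · simp [tw_ne _ _ _ hxi]

theorem rho_mul_rho {i j k : Fin n} (hij : i ≠ j) (hjk : j ≠ k) (hik : i ≠ k) :
    rho i j * rho j k = rho j k * rho i j * (rho i k)⁻¹ := by
  rw [tw_inv hik]
  refine mulAut_ext fun x => ?_
  simp only [MulAut.mul_apply]
  by_cases hxi : x = i
  · subst hxi
    simp [tw_same hij, tw_same hik, tw_same hjk, tw_ne _ _ _ hij, tw_ne _ _ _ hik.symm,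
      tw_ne _ _ _ hjk.symm, mul_assoc]
  by_cases hxj : x = j
  · subst hxj
    simp [tw_same hjk, tw_ne _ _ _ hij.symm, tw_ne _ _ _ hik.symm]
  · simp [tw_ne _ _ _ hxi, tw_ne _ _ _ hxj]

theorem eps_mul_self (i : Fin n) : eps i * eps i = 1 := by
  refine mulAut_ext fun x => ?_
  by_cases h : x = i
  · subst h; simp [eps_same]
  · simp [eps_ne h]

theorem eps_comm (i j : Fin n) : eps i * eps j = eps j * eps i := by
  by_cases hij : i = j
  · rw [hij]
  refine mulAut_ext fun x => ?_
  simp only [MulAut.mul_apply]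
  by_cases hi : x = i
  · subst hi; simp [eps_same, eps_ne hij]
  by_cases hj : x = j
  · subst hj; simp [eps_same, eps_ne hi]
  · simp [eps_ne hi, eps_ne hj]

theorem eps_tw_of_ne {i j k : Fin n} (hij : i ≠ j) (hki : k ≠ i) (hkj : k ≠ j) (s t : ℤ) :
    eps k * tw i j s t = tw i j s t * eps k := by
  refine mulAut_ext fun x => ?_
  simp only [MulAut.mul_apply]
  by_cases hi : x = i
  · subst hi; simp [eps_ne hki.symm, tw_same hij, eps_ne hkj.symm]
  by_cases hk : x = k
  · subst hk; simp [eps_same, tw_ne _ _ _ hi]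
  · simp [eps_ne hk, tw_ne _ _ _ hi]

theorem eps_tw_right {i j : Fin n} (hij : i ≠ j) (s t : ℤ) :
    eps j * tw i j s t = tw i j (-s) (-t) * eps j := by
  refine mulAut_ext fun x => ?_
  simp only [MulAut.mul_apply]
  by_cases hi : x = i
  · subst hi; simp [eps_ne hij, tw_same hij, eps_same]
  by_cases hk : x = j
  · subst hk; simp [eps_same, tw_ne _ _ _ hi]
  · simp [eps_ne hk, tw_ne _ _ _ hi]

theorem eps_tw_left {i j : Fin n} (hij : i ≠ j) (s t : ℤ) :
    eps i * tw i j s t = tw i j (-t) (-s) * eps i := by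
  refine mulAut_ext fun x => ?_
  simp only [MulAut.mul_apply]
  by_cases hi : x = i
  · subst hi; simp [eps_ne hij.symm, tw_same hij, eps_same, mul_assoc]
  · simp [eps_ne hi, tw_ne _ _ _ hi]

theorem pm_tw {i j : Fin n} (hij : i ≠ j) (σ : Equiv.Perm (Fin n)) (s t : ℤ) :
    pm σ * tw i j s t = tw (σ i) (σ j) s t * pm σ := by
  have hσ : σ i ≠ σ j := fun h => hij (σ.injective h)
  refine mulAut_ext fun x => ?_
  simp only [MulAut.mul_apply]
  by_cases hi : x = i
  · subst hi; simp [tw_same hij, tw_same hσ, pm_of]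
  · have : σ x ≠ σ i := fun h => hi (σ.injective h)
    simp [tw_ne _ _ _ hi, tw_ne _ _ _ this, pm_of]

theorem pm_eps (i : Fin n) (σ : Equiv.Perm (Fin n)) :
    pm σ * eps i = eps (σ i) * pm σ := by
  refine mulAut_ext fun x => ?_
  simp only [MulAut.mul_apply]
  by_cases hi : x = i
  · subst hi; simp [eps_same, pm_of]
  · have : σ x ≠ σ i := fun h => hi (σ.injective h)
    simp [eps_ne hi, eps_ne this, pm_of]

theorem pm_mul (σ τ : Equiv.Perm (Fin n)) : pm (σ * τ) = pm σ * pm τ :=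
  mulAut_ext fun x => by simp [pm_of]

theorem pm_one : pm (1 : Equiv.Perm (Fin n)) = 1 := mulAut_ext fun x => by simp [pm_of]

theorem mulAut_mul_conj {G : Type*} [Group G] (f : MulAut G) (u : G) :
    f * MulAut.conj u = MulAut.conj (f u) * f := by
  ext x; simp [MulAut.conj_apply]

/-- A product of partial conjugations over a set of indices conjugates those generators. -/
theorem prod_pc_of {j : Fin n} (L : List (Fin n)) (hj : j ∉ L) (hL : L.Nodup) (k : Fin n) :
    (L.map fun i => pc i j).prod (of k) =
      if k ∈ L then (of j)⁻¹ * of k * of j else of k := by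
  induction L with
  | nil => simp
  | cons a L ih =>
    simp only [List.mem_cons, not_or] at hj
    rw [List.nodup_cons] at hL
    simp only [List.map_cons, List.prod_cons, MulAut.mul_apply, ih hj.2 hL.2, List.mem_cons]
    by_cases hka : k = a
    · subst hka
      simp [hL.1, tw_same (Ne.symm hj.1)]
    · by_cases hk : k ∈ L <;> simp [hka, hk, tw_ne _ _ _ hka, tw_ne _ _ _ hj.1]

theorem prod_pc_eq_conj {j : Fin n} (L : List (Fin n)) (hj : j ∉ L) (hL : L.Nodup)
    (hall : ∀ k, k ≠ j → k ∈ L) :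
    (L.map fun i => pc i j).prod = MulAut.conj (of j)⁻¹ := by
  refine mulAut_ext fun k => ?_
  rw [prod_pc_of L hj hL]
  by_cases hk : k = j
  · subst hk; simp [hj]
  · simp [hall k hk]

end Elementary

/-! ### Common initial segments in free groups -/

section CommonInitial

/-- The length of the longest common initial segment of two lists. -/
def lcp {α : Type*} [DecidableEq α] : List α → List α → ℕ
  | a :: l, b :: l' => if a = b then lcp l l' + 1 else 0
  | _, _ => 0

variable {α : Type*} [DecidableEq α]

theorem lcp_comm (l l' : List α) : lcp l l' = lcp l' l := by
  induction l generalizing l' with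
  | nil => cases l' <;> simp [lcp]
  | cons a l ih =>
    cases l' with
    | nil => simp [lcp]
    | cons b l' => simp [lcp, ih, eq_comm (a := a)]

theorem min_lcp_le (l l' l'' : List α) : min (lcp l l') (lcp l' l'') ≤ lcp l l'' := by
  induction l generalizing l' l'' with
  | nil => simp [lcp]
  | cons a l ih =>
    cases l' with
    | nil => simp [lcp]
    | cons b l' =>
      cases l'' with
      | nil => simp [lcp]
      | cons c l'' =>
        by_cases hab : a = b
        · by_cases hbc : b = c
          · have := ih l' l''
            simp [lcp, hab, hbc]; simpa using this
          · simp [lcp, hbc]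
        · simp [lcp, hab]

theorem take_lcp (l l' : List α) : l.take (lcp l l') = l'.take (lcp l l') := by
  induction l generalizing l' with
  | nil => simp [lcp]
  | cons a l ih =>
    cases l' with
    | nil => simp [lcp]
    | cons b l' =>
      by_cases hab : a = b
      · simp [lcp, hab, ih l']
      · simp [lcp, hab]

theorem lcp_le_left (l l' : List α) : lcp l l' ≤ l.length := by
  induction l generalizing l' with
  | nil => simp [lcp]
  | cons a l ih =>
    cases l' with
    | nil => simp [lcp]
    | cons b l' =>
      by_cases hab : a = b
      · simp [lcp, hab, ih l']
      · simp [lcp, hab]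

open FreeGroup

theorem isReduced_invRev {l : List (α × Bool)} (h : IsReduced l) : IsReduced (invRev l) := by
  rw [isReduced_iff_reduce_eq, reduce_invRev, h.reduce_eq]

theorem isReduced_invRev_append {a b : α × Bool} {l l' : List (α × Bool)}
    (h : IsReduced (a :: l)) (h' : IsReduced (b :: l')) (hab : a ≠ b) :
    IsReduced (invRev (a :: l) ++ b :: l') := by
  rw [FreeGroup.IsReduced, List.isChain_append]
  refine ⟨isReduced_invRev h, h', ?_⟩
  intro x hx y hy
  have hx' : x = (a.1, !a.2) := by
    simp [invRev] at hx; exact hx.symm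
  simp only [List.head?_cons, Option.mem_def, Option.some.injEq] at hy
  subst hy
  subst hx'
  intro h1
  obtain ⟨a1, a2⟩ := a
  obtain ⟨b1, b2⟩ := b
  simp only at h1
  subst h1
  cases a2 <;> cases b2 <;> simp_all

theorem reduce_invRev_append (l l' : List (α × Bool)) (h : IsReduced l) (h' : IsReduced l') :
    reduce (invRev l ++ l') =
      invRev (l.drop (lcp l l')) ++ l'.drop (lcp l l') := by
  induction l generalizing l' with
  | nil => simpa [lcp] using h'.reduce_eq
  | cons a l ih =>
    cases l' with
    | nil =>
      have := (isReduced_invRev h).reduce_eq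
      simpa [lcp] using this
    | cons b l' =>
      by_cases hab : a = b
      · subst hab
        have h1 : reduce (invRev (a :: l) ++ a :: l') = reduce (invRev l ++ l') := by
          apply reduce.Step.eq
          have : invRev (a :: l) ++ a :: l' = invRev l ++ (a.1, !a.2) :: (a.1, a.2) :: l' := by
            simp [invRev]
          rw [this]
          exact Red.Step.not_rev
        rw [h1, ih l' h.tail h'.tail]
        simp [lcp]
      · rw [(isReduced_invRev_append h h' hab).reduce_eq]
        simp [lcp, hab]

/-- The length of the common initial segment of two elements of a free group. -/
def cpl (x y : FreeGroup α) : ℕ := lcp x.toWord y.toWord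

theorem cpl_comm (x y : FreeGroup α) : cpl x y = cpl y x := lcp_comm _ _

theorem min_cpl_le (x y z : FreeGroup α) : min (cpl x y) (cpl y z) ≤ cpl x z := min_lcp_le _ _ _

theorem cpl_le_left (x y : FreeGroup α) : cpl x y ≤ x.norm := lcp_le_left _ _

theorem cpl_le_right (x y : FreeGroup α) : cpl x y ≤ y.norm := cpl_comm x y ▸ cpl_le_left y x

theorem toWord_inv_mul (x y : FreeGroup α) :
    (x⁻¹ * y).toWord = invRev (x.toWord.drop (cpl x y)) ++ y.toWord.drop (cpl x y) := by
  rw [toWord_mul, toWord_inv, reduce_invRev_append _ _ isReduced_toWord isReduced_toWord, cpl]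

theorem norm_inv_mul_add (x y : FreeGroup α) : (x⁻¹ * y).norm + 2 * cpl x y = x.norm + y.norm := by
  have h1 := cpl_le_left x y
  have h2 := cpl_le_right x y
  have : (x⁻¹ * y).norm = (x.norm - cpl x y) + (y.norm - cpl x y) := by
    simp [FreeGroup.norm, toWord_inv_mul]
  omega

theorem norm_mul_add (x y : FreeGroup α) : (x * y).norm + 2 * cpl x⁻¹ y = x.norm + y.norm := by
  simpa using norm_inv_mul_add x⁻¹ y

theorem two_mul_cpl_inv_self (x : FreeGroup α) : 2 * cpl x⁻¹ x ≤ x.norm := by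
  by_contra! hlt
  set c := cpl x⁻¹ x with hc
  have hcn : c ≤ x.norm := cpl_le_right _ _
  set l := x.toWord with hl
  have hlen : l.length = x.norm := rfl
  have htake : (invRev l).take c = l.take c := by
    have := take_lcp x⁻¹.toWord x.toWord
    rw [hc, cpl, hl, ← this, toWord_inv]
  have key : ∀ i, (hi : i < c) → l[i] = ((l[l.length - 1 - i]).1, !(l[l.length - 1 - i]).2) := by
    intro i hi
    have h1 : ((invRev l).take c)[i]'(by simp [invRev_length]; omega) =
      (l.take c)[i]'(by simp; omega) := by simp only [htake]
    rw [List.getElem_take, List.getElem_take] at h1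
    rw [← h1]
    simp [invRev]
  have hmod := Nat.even_or_odd' x.norm
  obtain ⟨k, hk | hk⟩ := hmod
  · have hk0 : 0 < k := by omega
    have h1 := key k (by omega)
    have h2 : IsReduced l := isReduced_toWord
    have h3 := List.isChain_iff_getElem.1 h2 (k - 1) (by omega)
    have e1 : l.length - 1 - k = k - 1 := by omega
    have e2 : k - 1 + 1 = k := by omega
    simp only [e1] at h1
    simp only [e2] at h3
    rw [h1] at h3
    simp at h3
  · have h1 := key k (by omega)
    have e1 : l.length - 1 - k = k := by omega
    simp only [e1] at h1
    have := congrArg Prod.snd h1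
    simp at this

end CommonInitial

/-! ### Nielsen generation of the automorphism group of a free group -/

section Nielsen

variable {n : ℕ}

open FreeGroup (of mk toWord)

/-- The subgroup of `Aut(F_n)` generated by transvections, inversions and permutations. -/
def nielsenSubgroup (n : ℕ) : Subgroup (MulAut (FG n)) :=
  Subgroup.closure ({f | ∃ i j s t, i ≠ j ∧ f = tw i j s t} ∪ Set.range eps ∪ Set.range pm)

theorem tw_mem_nielsen {i j : Fin n} (h : i ≠ j) (s t : ℤ) : tw i j s t ∈ nielsenSubgroup n :=
  Subgroup.subset_closure (Or.inl (Or.inl ⟨i, j, s, t, h, rfl⟩))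

theorem eps_mem_nielsen (i : Fin n) : eps i ∈ nielsenSubgroup n :=
  Subgroup.subset_closure (Or.inl (Or.inr ⟨i, rfl⟩))

theorem pm_mem_nielsen (σ : Equiv.Perm (Fin n)) : pm σ ∈ nielsenSubgroup n :=
  Subgroup.subset_closure (Or.inr ⟨σ, rfl⟩)

/-- The digit of a letter. -/
def digit (a : Fin n × Bool) : ℕ := 2 * a.1 + a.2.toNat

theorem digit_lt (a : Fin n × Bool) : digit a < 2 * n := by
  obtain ⟨i, b⟩ := a
  cases b <;> simp [digit] <;> omega

theorem digit_injective : Function.Injective (digit (n := n)) := by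
  rintro ⟨i, b⟩ ⟨j, c⟩ h
  cases b <;> cases c <;> simp [digit] at h ⊢ <;> omega

/-- The value of a word, read as a number in base `2 * n`. -/
def wordCode : List (Fin n × Bool) → ℕ
  | [] => 0
  | a :: l => digit a * (2 * n) ^ l.length + wordCode l

theorem wordCode_lt (l : List (Fin n × Bool)) : wordCode l < (2 * n) ^ l.length := by
  induction l with
  | nil => simp [wordCode]
  | cons a l ih =>
    have := digit_lt a
    simp only [wordCode, List.length_cons, pow_succ]
    nlinarith

theorem wordCode_append (l l' : List (Fin n × Bool)) :
    wordCode (l ++ l') = wordCode l * (2 * n) ^ l'.length + wordCode l' := by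
  induction l with
  | nil => simp [wordCode]
  | cons a l ih => simp [wordCode, ih, pow_add]; ring

theorem wordCode_injective {l l' : List (Fin n × Bool)} (hl : l.length = l'.length)
    (h : wordCode l = wordCode l') : l = l' := by
  induction l generalizing l' with
  | nil => simpa using hl.symm
  | cons a l ih =>
    cases l' with
    | nil => simp at hl
    | cons b l' =>
      have hl' : l.length = l'.length := by simpa using hl
      have h1 := wordCode_lt l
      have h2 := wordCode_lt l'
      simp only [wordCode, hl'] at h h1
      have hd : digit a = digit b := by
        rcases lt_trichotomy (digit a) (digit b) with hlt | heq | hgt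
        · nlinarith [Nat.mul_le_mul_right ((2 * n) ^ l'.length) hlt]
        · exact heq
        · nlinarith [Nat.mul_le_mul_right ((2 * n) ^ l'.length) hgt]
      rw [hd] at h
      rw [digit_injective hd, ih hl' (by omega)]

/-- The first half of a word. -/
def initialHalf (x : FG n) : List (Fin n × Bool) := (toWord x).take ((x.norm + 1) / 2)

/-- The tie-breaking complexity of an element of a free group. -/
def tieCode (x : FG n) : ℕ := wordCode (initialHalf x) + wordCode (initialHalf x⁻¹)

theorem tieCode_inv (x : FG n) : tieCode x⁻¹ = tieCode x := by
  simp [tieCode, add_comm]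

/-- If the tie-breaking complexity does not drop on replacing `x` by `x * y`, then the first half
of `y` precedes the first half of `y⁻¹`. -/
theorem wordCode_le_of_tieCode_le {x y : FG n} {h : ℕ} (hy : y.norm = 2 * h)
    (hc : cpl x⁻¹ y = h) (hx : 2 * h ≤ x.norm) (hle : tieCode x ≤ tieCode (x * y)) :
    wordCode ((toWord y).take h) ≤ wordCode ((toWord y⁻¹).take h) := by
  have hnorm : (x * y).norm = x.norm := by have := norm_mul_add x y; omega
  set P := (toWord y).take h
  set Q := (toWord y⁻¹).take h
  set r := (toWord x⁻¹).drop h with hr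
  have hyw : (toWord y).length = 2 * h := hy
  have hxi : (toWord x⁻¹).length = x.norm := FreeGroup.norm_inv_eq
  have hPl : P.length = h := by simp [P]; omega
  have hQl : Q.length = h := by simp [Q, FreeGroup.toWord_inv, FreeGroup.invRev_length]; omega
  have hx1 : toWord x⁻¹ = P ++ r := by
    rw [hr, ← List.take_append_drop h (toWord x⁻¹)]
    congr 1
    · have := take_lcp (toWord x⁻¹) (toWord y)
      change (toWord x⁻¹).take (cpl x⁻¹ y) = (toWord y).take (cpl x⁻¹ y) at this
      rw [hc] at this
      exact this
    · simp
  have hQ : Q = FreeGroup.invRev ((toWord y).drop h) := by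
    simp only [Q, FreeGroup.toWord_inv, FreeGroup.invRev, List.take_reverse,
      List.length_map, hyw, List.map_drop]
    congr 2; omega
  have hxy : toWord (x * y) = FreeGroup.invRev r ++ FreeGroup.invRev Q := by
    have := toWord_inv_mul x⁻¹ y
    rw [inv_inv, hc] at this
    rw [this, hQ, FreeGroup.invRev_invRev]
  have hxy' : toWord (x * y)⁻¹ = Q ++ r := by
    rw [FreeGroup.toWord_inv, hxy, FreeGroup.invRev_append, FreeGroup.invRev_invRev,
      FreeGroup.invRev_invRev]
  have hxx : toWord x = FreeGroup.invRev r ++ FreeGroup.invRev P := by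
    rw [← inv_inv x, FreeGroup.toWord_inv, hx1, FreeGroup.invRev_append]
  have hrl : r.length = x.norm - h := by
    have := congrArg List.length hx1
    simp only [List.length_append] at this
    omega
  have e1 : initialHalf x = initialHalf (x * y) := by
    rw [initialHalf, initialHalf, hnorm, hxx, hxy, List.take_append_of_le_length,
      List.take_append_of_le_length] <;> rw [FreeGroup.invRev_length] <;> omega
  set k := (x.norm + 1) / 2 - h with hk
  have hkk : (x.norm + 1) / 2 = h + k := by omega
  have e2 : initialHalf x⁻¹ = P ++ r.take k := by
    rw [initialHalf, FreeGroup.norm_inv_eq, hx1, hkk, List.take_append, hPl,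
      List.take_of_length_le (by omega)]
    simp
  have e3 : initialHalf (x * y)⁻¹ = Q ++ r.take k := by
    rw [initialHalf, FreeGroup.norm_inv_eq, hxy', hnorm, hkk, List.take_append, hQl,
      List.take_of_length_le (by omega)]
    simp
  rw [tieCode, tieCode, e1, e2, e3, wordCode_append, wordCode_append] at hle
  have h5 := wordCode_lt (r.take k)
  by_contra! hlt
  have := Nat.mul_le_mul_right ((2 * n) ^ (r.take k).length) hlt
  nlinarith

/-- The inverse letter. -/
def flipLetter (a : Fin n × Bool) : Fin n × Bool := (a.1, !a.2)

theorem mk_flipLetter (a : Fin n × Bool) : mk [flipLetter a] = (mk [a])⁻¹ := by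
  simp [flipLetter, FreeGroup.inv_mk, FreeGroup.invRev]

theorem mk_singleton_eq_or (a : Fin n × Bool) : mk [a] = of a.1 ∨ mk [a] = (of a.1)⁻¹ := by
  obtain ⟨i, b⟩ := a
  cases b
  · right; exact mk_flipLetter (i, true)
  · left; rfl

theorem map_mk_singleton_invariant {β : Type*} {c : FG n → β} (hc : ∀ x, c x⁻¹ = c x)
    (f : MulAut (FG n)) (a : Fin n × Bool) : c (f (mk [a])) = c (f (of a.1)) := by
  rcases mk_singleton_eq_or a with h | h <;> simp [h, hc]

/-- Nielsen moves. -/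
theorem exists_nielsen_move {a b : Fin n × Bool} (hab : a.1 ≠ b.1) :
    ∃ e ∈ nielsenSubgroup n, e (mk [a]) = mk [a] * mk [b] ∧ ∀ k, k ≠ a.1 → e (of k) = of k := by
  obtain ⟨i, s⟩ := a
  obtain ⟨j, t⟩ := b
  have ht : ∃ z : ℤ, mk [(j, t)] = (of j) ^ z := by
    rcases mk_singleton_eq_or (j, t) with h | h
    · exact ⟨1, by simp [h]⟩
    · exact ⟨-1, by simp [h]⟩
  obtain ⟨z, hz⟩ := ht
  cases s
  · refine ⟨tw i j (-z) 0, tw_mem_nielsen hab _ _, ?_, fun k hk => tw_ne _ _ _ hk⟩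
    have : mk [(i, false)] = (of i)⁻¹ := mk_flipLetter (i, true)
    rw [this, hz, map_inv, tw_same hab]
    simp
  · refine ⟨tw i j 0 z, tw_mem_nielsen hab _ _, ?_, fun k hk => tw_ne _ _ _ hk⟩
    have : mk [(i, true)] = of i := rfl
    rw [this, hz, tw_same hab]
    simp

/-- An automorphism is Nielsen minimal if no elementary Nielsen move decreases its complexity. -/
def NielsenMinimal (f : MulAut (FG n)) : Prop :=
  ∀ a b : Fin n × Bool, a.1 ≠ b.1 → (f (mk [a])).norm ≤ (f (mk [a]) * f (mk [b])).norm ∧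
    ((f (mk [a])).norm = (f (mk [a]) * f (mk [b])).norm →
      tieCode (f (mk [a])) ≤ tieCode (f (mk [a]) * f (mk [b])))

theorem exists_nielsenMinimal (f : MulAut (FG n)) :
    ∃ e ∈ nielsenSubgroup n, NielsenMinimal (f * e) := by
  let μ : MulAut (FG n) → ℕ ×ₗ ℕ := fun g =>
    toLex (∑ i, (g (of i)).norm, ∑ i, tieCode (g (of i)))
  obtain ⟨_, ⟨e, he, rfl⟩, hmin⟩ := WellFounded.has_min (wellFounded_lt (α := ℕ ×ₗ ℕ))
    ((fun e => μ (f * e)) '' (nielsenSubgroup n : Set (MulAut (FG n)))) ⟨_, 1, one_mem _, rfl⟩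
  refine ⟨e, he, fun a b hab => ?_⟩
  obtain ⟨e', he', h1, h2⟩ := exists_nielsen_move hab
  have h3 := hmin _ ⟨e * e', mul_mem he he', rfl⟩
  simp only [← mul_assoc] at h3
  set g := f * e with hg
  have hsum : ∀ c : FG n → ℕ, (∀ x, c x⁻¹ = c x) →
      ∑ i, c ((g * e') (of i)) + c (g (mk [a])) =
        ∑ i, c (g (of i)) + c (g (mk [a]) * g (mk [b])) := by
    intro c hc
    rw [← Finset.add_sum_erase _ _ (Finset.mem_univ a.1),
      ← Finset.add_sum_erase _ (fun i => c (g (of i))) (Finset.mem_univ a.1),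
      ← map_mk_singleton_invariant hc g a, ← map_mk_singleton_invariant hc (g * e') a,
      MulAut.mul_apply, h1, map_mul]
    have : ∑ x ∈ Finset.univ.erase a.1, c ((g * e') (of x)) =
        ∑ x ∈ Finset.univ.erase a.1, c (g (of x)) := by
      refine Finset.sum_congr rfl fun k hk => ?_
      rw [MulAut.mul_apply, h2 k (Finset.ne_of_mem_erase hk)]
    rw [this]; ring
  have hs1 := hsum FreeGroup.norm (fun x => FreeGroup.norm_inv_eq)
  have hs2 := hsum tieCode tieCode_inv
  simp only [μ, Prod.Lex.toLex_lt_toLex, not_or, not_and, not_lt] at h3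
  refine ⟨by omega, fun heq => ?_⟩
  have := h3.2 (by omega)
  omega

end Nielsen

section Nielsen

variable {n : ℕ}

open FreeGroup (of mk toWord)

theorem map_mk_ne_one (f : MulAut (FG n)) (a : Fin n × Bool) : f (mk [a]) ≠ 1 := by
  intro h
  rw [map_eq_one_iff f f.injective] at h
  rcases mk_singleton_eq_or a with h' | h' <;> rw [h'] at h
  · exact FreeGroup.of_ne_one _ h
  · exact FreeGroup.of_ne_one _ (inv_eq_one.1 h)

theorem norm_pos_of_ne_one {x : FG n} (h : x ≠ 1) : 0 < x.norm := by
  rw [Nat.pos_iff_ne_zero, Ne, FreeGroup.norm_eq_zero]; exact h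

theorem map_mk_flipLetter (f : MulAut (FG n)) (a : Fin n × Bool) :
    f (mk [flipLetter a]) = (f (mk [a]))⁻¹ := by rw [mk_flipLetter, map_inv]

theorem flipLetter_flipLetter (a : Fin n × Bool) : flipLetter (flipLetter a) = a := by
  simp [flipLetter]

theorem eq_or_eq_flipLetter {a b : Fin n × Bool} (h : a.1 = b.1) : a = b ∨ a = flipLetter b := by
  obtain ⟨i, s⟩ := a
  obtain ⟨j, t⟩ := b
  cases s <;> cases t <;> simp_all [flipLetter]

variable {f : MulAut (FG n)}

theorem NielsenMinimal.two_mul_cpl_le_right (hf : NielsenMinimal f) {a b : Fin n × Bool}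
    (hab : a ≠ flipLetter b) :
    2 * cpl (f (mk [a]))⁻¹ (f (mk [b])) ≤ (f (mk [b])).norm := by
  by_cases h : a.1 = b.1
  · rcases eq_or_eq_flipLetter h with rfl | h'
    · exact two_mul_cpl_inv_self _
    · exact absurd h' hab
  · have h1 := (hf a b h).1
    have h2 := norm_mul_add (f (mk [a])) (f (mk [b]))
    omega

theorem NielsenMinimal.two_mul_cpl_le_left (hf : NielsenMinimal f) {a b : Fin n × Bool}
    (hab : a ≠ flipLetter b) :
    2 * cpl (f (mk [a]))⁻¹ (f (mk [b])) ≤ (f (mk [a])).norm := by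
  have h : flipLetter b ≠ flipLetter (flipLetter a) := by
    rw [flipLetter_flipLetter]; exact hab.symm
  have := hf.two_mul_cpl_le_right h
  rwa [map_mk_flipLetter, map_mk_flipLetter, inv_inv, FreeGroup.norm_inv_eq, cpl_comm] at this

theorem eq_one_of_take_half_eq {y : FG n} {h : ℕ} (hy : y.norm = 2 * h)
    (he : (toWord y).take h = (toWord y⁻¹).take h) : y = 1 := by
  have h1 : (toWord y⁻¹).length = 2 * h := by rw [← hy]; exact FreeGroup.norm_inv_eq
  by_contra hne
  have hpos := norm_pos_of_ne_one hne
  have hlen : (toWord y).length = 2 * h := hy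
  have key : (toWord y)[h - 1]'(by omega) = (toWord y⁻¹)[h - 1]'(by omega) := by
    have e : ((toWord y).take h)[h - 1]'(by simp; omega) =
      ((toWord y⁻¹).take h)[h - 1]'(by simp; omega) := by simp only [he]
    rwa [List.getElem_take, List.getElem_take] at e
  have hred : FreeGroup.IsReduced (toWord y) := FreeGroup.isReduced_toWord
  have h3 := List.isChain_iff_getElem.1 hred (h - 1) (by omega)
  simp only [FreeGroup.toWord_inv, FreeGroup.invRev, List.getElem_reverse, List.getElem_map,
    List.length_map] at key
  have e2 : (toWord y).length - 1 - (h - 1) = h - 1 + 1 := by omega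
  simp only [e2] at key
  rw [key] at h3
  simp at h3

theorem NielsenMinimal.cpl_add_cpl_lt (hf : NielsenMinimal f) {a b c : Fin n × Bool}
    (hab : a ≠ flipLetter b) (hbc : b ≠ flipLetter c) :
    cpl (f (mk [a]))⁻¹ (f (mk [b])) + cpl (f (mk [b]))⁻¹ (f (mk [c])) < (f (mk [b])).norm := by
  have h1 := hf.two_mul_cpl_le_right hab
  have h2 := hf.two_mul_cpl_le_left hbc
  by_contra! hge
  set y := f (mk [b]) with hy
  obtain ⟨h, hh⟩ : ∃ h, h = cpl (f (mk [a]))⁻¹ y := ⟨_, rfl⟩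
  have hyn : y.norm = 2 * h := by omega
  have hcz : cpl y⁻¹ (f (mk [c])) = h := by omega
  refine map_mk_ne_one f b ?_
  have half_le : ∀ a b : Fin n × Bool, a ≠ flipLetter b → (f (mk [b])).norm = 2 * h →
      cpl (f (mk [a]))⁻¹ (f (mk [b])) = h →
      wordCode ((toWord (f (mk [b]))).take h) ≤ wordCode ((toWord (f (mk [b]))⁻¹).take h) := by
    intro a b hab hb hc
    by_cases hi : a.1 = b.1
    · rcases eq_or_eq_flipLetter hi with rfl | h'
      · have := take_lcp (toWord (f (mk [a]))⁻¹) (toWord (f (mk [a])))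
        change (toWord (f (mk [a]))⁻¹).take (cpl (f (mk [a]))⁻¹ (f (mk [a]))) =
          (toWord (f (mk [a]))).take (cpl (f (mk [a]))⁻¹ (f (mk [a]))) at this
        rw [hc] at this
        rw [this]
      · exact absurd h' hab
    · have hx := hf.two_mul_cpl_le_left hab
      refine wordCode_le_of_tieCode_le hb hc (by omega) ((hf a b hi).2 ?_)
      have := norm_mul_add (f (mk [a])) (f (mk [b]))
      omega
  have hle1 := half_le a b hab hyn hh.symm
  have hle2 := half_le (flipLetter c) (flipLetter b)
    (by rw [flipLetter_flipLetter]; exact hbc.symm)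
    (by rw [map_mk_flipLetter, FreeGroup.norm_inv_eq]; exact hyn)
    (by rw [map_mk_flipLetter, map_mk_flipLetter, inv_inv, cpl_comm]; exact hcz)
  rw [map_mk_flipLetter, inv_inv] at hle2
  refine eq_one_of_take_half_eq hyn (wordCode_injective ?_ (le_antisymm hle1 hle2))
  have e1 : (toWord y).length = 2 * h := hyn
  have e2 : (toWord y⁻¹).length = 2 * h := by rw [← hyn]; exact FreeGroup.norm_inv_eq
  rw [List.length_take, List.length_take, e1, e2]

theorem ne_flipLetter_self (a : Fin n × Bool) : a ≠ flipLetter a := by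
  intro h
  have := congrArg Prod.snd h
  simp [flipLetter] at this

theorem ne_flipLetter_of_isReduced {a b : Fin n × Bool} {l : List (Fin n × Bool)}
    (h : FreeGroup.IsReduced (a :: b :: l)) : a ≠ flipLetter b := by
  rintro rfl
  have := (List.isChain_cons_cons.1 h).1 rfl
  simp [flipLetter] at this

theorem mk_cons (a : Fin n × Bool) (l : List (Fin n × Bool)) :
    (mk (a :: l) : FG n) = mk [a] * mk l := by
  rw [FreeGroup.mul_mk]; rfl

theorem NielsenMinimal.norm_map_mk (hf : NielsenMinimal f) (l : List (Fin n × Bool))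
    (b : Fin n × Bool) (hl : FreeGroup.IsReduced (b :: l)) :
    ∃ c : ℕ, cpl (f (mk (b :: l))) (f (mk [b])) + c = (f (mk [b])).norm ∧
      (∀ a, a ≠ flipLetter b → cpl (f (mk [a]))⁻¹ (f (mk [b])) + c < (f (mk [b])).norm) ∧
      (f (mk [b])).norm + l.length ≤ (f (mk (b :: l))).norm + c := by
  induction l generalizing b with
  | nil =>
    refine ⟨0, ?_, fun a ha => ?_, by simp⟩
    · have := norm_inv_mul_add (f (mk [b])) (f (mk [b]))
      simp at this ⊢; omega
    · have h1 := hf.two_mul_cpl_le_right ha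
      have h2 := norm_pos_of_ne_one (map_mk_ne_one f b)
      omega
  | cons d l ih =>
    obtain ⟨c', h1, h2, h3⟩ := ih d hl.tail
    have hbd := ne_flipLetter_of_isReduced hl
    set x := f (mk [b]) with hx
    set y := f (mk [d]) with hy
    set w' := f (mk (d :: l)) with hw'
    have hw : f (mk (b :: d :: l)) = x * w' := by rw [mk_cons b (d :: l), map_mul]
    set c := cpl x⁻¹ y with hc
    have h4 : c + c' < y.norm := h2 b hbd
    have hcw : cpl x⁻¹ w' = c := by
      have e1 := min_cpl_le x⁻¹ y w'
      have e2 := min_cpl_le x⁻¹ w' y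
      rw [cpl_comm y w'] at e1
      omega
    have e3 := norm_mul_add x w'
    refine ⟨c, ?_, fun a ha => hf.cpl_add_cpl_lt ha hbd, ?_⟩
    · have e4 := norm_inv_mul_add (x * w') x
      rw [mul_inv_rev, inv_mul_cancel_right, FreeGroup.norm_inv_eq] at e4
      rw [hw]; omega
    · rw [hw, List.length_cons]; omega

theorem NielsenMinimal.exists_map_eq_of (hf : NielsenMinimal f) (j : Fin n) :
    ∃ a : Fin n × Bool, f (mk [a]) = of j := by
  obtain ⟨x, hx⟩ := f.surjective (of j)
  have hred : FreeGroup.IsReduced (toWord x) := FreeGroup.isReduced_toWord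
  have hmk : mk (toWord x) = x := FreeGroup.mk_toWord
  rcases hw : toWord x with _ | ⟨b, l⟩
  · rw [hw] at hmk
    rw [← hmk] at hx
    have : f (mk []) = 1 := map_one f
    exact absurd (this.symm.trans hx).symm (FreeGroup.of_ne_one j)
  · rw [hw] at hmk hred
    obtain ⟨c, h1, h2, h3⟩ := hf.norm_map_mk l b hred
    have h4 := h2 b (ne_flipLetter_self b)
    rw [hmk, hx, FreeGroup.norm_of] at h3
    have : l = [] := List.length_eq_zero_iff.1 (by omega)
    subst this
    exact ⟨b, by rw [hmk, hx]⟩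

theorem NielsenMinimal.mem_nielsen (hf : NielsenMinimal f) : f ∈ nielsenSubgroup n := by
  choose a ha using hf.exists_map_eq_of
  have hinj : Function.Injective fun j => (a j).1 := by
    intro j k hjk
    have h1 := ha j
    have h2 := ha k
    rcases eq_or_eq_flipLetter hjk with h | h
    · rw [h, h2] at h1
      exact (FreeGroup.of_injective h1).symm
    · rw [h, map_mk_flipLetter, h2] at h1
      have := congrArg (fun x => FreeGroup.lift (fun _ : Fin n => Multiplicative.ofAdd (1 : ℤ)) x) h1
      simp [← ofAdd_neg] at this
  set π : Equiv.Perm (Fin n) := Equiv.ofBijective _ (Finite.injective_iff_bijective.1 hinj) with hπ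
  have hg : ∀ j, (f * pm π) (of j) = of j ∨ (f * pm π) (of j) = (of j)⁻¹ := by
    intro j
    have e : (f * pm π) (of j) = f (of (a j).1) := by simp [pm_of, hπ]
    rw [e]
    rcases mk_singleton_eq_or (a j) with h | h
    · left; rw [← h, ha]
    · right; rw [← ha j, h, map_inv, inv_inv]
  suffices H : ∀ (s : Finset (Fin n)) (g : MulAut (FG n)),
      (∀ j ∈ s, g (of j) = of j ∨ g (of j) = (of j)⁻¹) → (∀ j ∉ s, g (of j) = of j) →
      g ∈ nielsenSubgroup n by
    have := H Finset.univ (f * pm π) (fun j _ => hg j) (by simp)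
    exact (Subgroup.mul_mem_cancel_right _ (pm_mem_nielsen π)).1 this
  intro s
  induction s using Finset.induction_on with
  | empty =>
    intro g _ h
    have : g = 1 := mulAut_ext fun k => by simpa using h k (by simp)
    rw [this]; exact one_mem _
  | insert i s his ih =>
    intro g h1 h2
    rcases h1 i (Finset.mem_insert_self _ _) with h | h
    · refine ih g (fun j hj => h1 j (Finset.mem_insert_of_mem hj)) fun j hj => ?_
      by_cases hji : j = i
      · rw [hji, h]
      · exact h2 j (by simp [hji, hj])
    · refine (Subgroup.mul_mem_cancel_right _ (eps_mem_nielsen i)).1 (ih (g * eps i) ?_ ?_)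
      · intro j hj
        have hji : j ≠ i := by rintro rfl; exact his hj
        simpa [eps_ne hji] using h1 j (Finset.mem_insert_of_mem hj)
      · intro j hj
        by_cases hji : j = i
        · subst hji; simp [eps_same, h]
        · simpa [eps_ne hji] using h2 j (by simp [hji, hj])

/-- Nielsen's theorem: the automorphism group of a free group is generated by transvections,
inversions and permutations of the generators. -/
theorem nielsenSubgroup_eq_top : nielsenSubgroup n = ⊤ := by
  refine (Subgroup.eq_top_iff' _).2 fun f => ?_
  obtain ⟨e, he, hmin⟩ := exists_nielsenMinimal f
  exact (Subgroup.mul_mem_cancel_right _ he).1 hmin.mem_nielsen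

end Nielsen

section MonomialMaps

variable {n : ℕ}

open FreeGroup (of)

/-- The automorphism `a_i ↦ a_j`, `a_j ↦ a_i⁻¹`. -/
def wt (i j : Fin n) : MulAut (FG n) := lam i j * tw j i (-1) 0 * rho i j

theorem wt_left {i j : Fin n} (h : i ≠ j) : wt i j (of i) = of j := by
  simp [wt, tw_same h, tw_same h.symm, tw_ne _ _ _ h, tw_ne _ _ _ h.symm]

theorem wt_right {i j : Fin n} (h : i ≠ j) : wt i j (of j) = (of i)⁻¹ := by
  simp [wt, tw_same h, tw_same h.symm, tw_ne _ _ _ h.symm]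

theorem wt_ne {i j k : Fin n} (hi : k ≠ i) (hj : k ≠ j) : wt i j (of k) = of k := by
  simp [wt, tw_ne _ _ _ hi, tw_ne _ _ _ hj]

theorem wt_mul_eps {i j : Fin n} (h : i ≠ j) : wt i j * eps i = eps j * wt i j := by
  refine mulAut_ext fun k => ?_
  simp only [MulAut.mul_apply]
  by_cases hi : k = i
  · subst hi; simp [eps_same, wt_left h]
  by_cases hj : k = j
  · subst hj; simp [eps_ne hi, eps_ne (Ne.symm hi), wt_right h]
  · simp [eps_ne hi, eps_ne hj, wt_ne hi hj]

theorem pm_swap_eq {i j : Fin n} (h : i ≠ j) : pm (Equiv.swap i j) = eps i * wt i j := by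
  refine mulAut_ext fun k => ?_
  simp only [MulAut.mul_apply, pm_of]
  by_cases hi : k = i
  · subst hi; simp [eps_ne h.symm, wt_left h]
  by_cases hj : k = j
  · subst hj; simp [eps_same, wt_right h]
  · simp [eps_ne hi, wt_ne hi hj, Equiv.swap_apply_of_ne_of_ne hi hj]

theorem tw_eq_lam_zpow_mul_rho_zpow {i j : Fin n} (h : i ≠ j) (s t : ℤ) :
    tw i j s t = lam i j ^ s * rho i j ^ t := by
  have h1 : ∀ s : ℤ, lam i j ^ s = tw i j s 0 := by
    intro s
    induction s using Int.induction_on with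
    | zero => simp [tw_zero]
    | succ k ih => rw [zpow_add_one, ih, tw_mul h, add_zero]
    | pred k ih => rw [zpow_sub_one, ih, tw_inv h, tw_mul h, neg_zero, add_zero]; rfl
  have h2 : ∀ s : ℤ, rho i j ^ s = tw i j 0 s := by
    intro s
    induction s using Int.induction_on with
    | zero => simp [tw_zero]
    | succ k ih => rw [zpow_add_one, ih, tw_mul h, add_zero]
    | pred k ih => rw [zpow_sub_one, ih, tw_inv h, tw_mul h, neg_zero, add_zero]; rfl
  rw [h1, h2, tw_mul h, add_zero, zero_add]

theorem lam_eq_eps_conj {i j : Fin n} (h : i ≠ j) :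
    lam i j = eps i * (rho i j)⁻¹ * eps i := by
  rw [tw_inv h, eps_tw_left h, mul_assoc, eps_mul_self]; simp

/-- A homomorphism from `Aut(F_n)` killing all right transvections has image of order at most
two. -/
theorem map_eq_one_or_of_map_rho {G : Type*} [Group G] (ψ : MulAut (FG n) →* G)
    (h : ∀ i j, i ≠ j → ψ (rho i j) = 1) (i₀ : Fin n) (g : MulAut (FG n)) :
    ψ g = 1 ∨ ψ g = ψ (eps i₀) := by
  have hlam : ∀ i j, i ≠ j → ψ (lam i j) = 1 := by
    intro i j hij
    rw [lam_eq_eps_conj hij]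
    rw [map_mul, map_mul, map_inv, h i j hij, inv_one, mul_one, ← map_mul, eps_mul_self, map_one]
  have htw : ∀ i j, i ≠ j → ∀ s t, ψ (tw i j s t) = 1 := by
    intro i j hij s t
    rw [tw_eq_lam_zpow_mul_rho_zpow hij]
    simp [h i j hij, hlam i j hij]
  have hwt : ∀ i j, i ≠ j → ψ (wt i j) = 1 := by
    intro i j hij
    simp [wt, htw i j hij, htw j i hij.symm]
  have heps : ∀ i, ψ (eps i) = ψ (eps i₀) := by
    intro i
    by_cases hi : i = i₀
    · rw [hi]
    have := congrArg ψ (wt_mul_eps hi)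
    simpa [hwt i i₀ hi] using this
  have hsq : ψ (eps i₀) * ψ (eps i₀) = 1 := by rw [← map_mul, eps_mul_self, map_one]
  have hmul : ∀ x y : MulAut (FG n), (ψ x = 1 ∨ ψ x = ψ (eps i₀)) →
      (ψ y = 1 ∨ ψ y = ψ (eps i₀)) → (ψ (x * y) = 1 ∨ ψ (x * y) = ψ (eps i₀)) := by
    rintro x y (hx | hx) (hy | hy) <;> simp [hx, hy, hsq]
  have hg : g ∈ nielsenSubgroup n := by rw [nielsenSubgroup_eq_top]; trivial
  induction hg using Subgroup.closure_induction with
  | mem x hx =>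
    rcases hx with (⟨i, j, s, t, hij, rfl⟩ | ⟨i, rfl⟩) | ⟨σ, rfl⟩
    · exact Or.inl (htw i j hij s t)
    · exact Or.inr (heps i)
    · induction σ using Equiv.Perm.swap_induction_on with
      | one => left; rw [pm_one, map_one]
      | swap_mul σ i j hij ih =>
        rw [pm_mul]
        refine hmul _ _ ?_ ih
        right
        rw [pm_swap_eq hij, map_mul, hwt i j hij, mul_one, heps]
  | one => left; exact map_one ψ
  | mul x y _ _ hx hy => exact hmul x y hx hy
  | inv x _ hx =>
    rcases hx with hx | hx
    · left; rw [map_inv, hx, inv_one]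
    · right; rw [map_inv, hx, inv_eq_iff_mul_eq_one, hsq]

end MonomialMaps

/-! ### Automorphisms that are inner modulo every term of the lower central series -/

section Detection

open FreeGroup (of)
open Polynomial
open scoped commutatorElement

variable {m : ℕ}

/-- The product of a list of syllables `(i, e)`, each standing for `a_i ^ e`. -/
def sylProd (L : List (Fin m × ℤ)) : FG m := (L.map fun p => of p.1 ^ p.2).prod

theorem sylProd_nil : sylProd ([] : List (Fin m × ℤ)) = 1 := rfl

theorem sylProd_cons (p : Fin m × ℤ) (L : List (Fin m × ℤ)) :
    sylProd (p :: L) = of p.1 ^ p.2 * sylProd L := by simp [sylProd]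

theorem sylProd_append (L M : List (Fin m × ℤ)) :
    sylProd (L ++ M) = sylProd L * sylProd M := by simp [sylProd]

/-- The inverse list of syllables. -/
def sylInv (L : List (Fin m × ℤ)) : List (Fin m × ℤ) := (L.map fun p => (p.1, -p.2)).reverse

theorem sylProd_sylInv (L : List (Fin m × ℤ)) : sylProd (sylInv L) = (sylProd L)⁻¹ := by
  induction L with
  | nil => simp [sylInv, sylProd]
  | cons p L ih =>
    have : sylInv (p :: L) = sylInv L ++ [(p.1, -p.2)] := by simp [sylInv]
    rw [this, sylProd_append, ih, sylProd_cons, sylProd_cons, sylProd_nil]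
    simp

theorem exists_sylProd (x : FG m) : ∃ L, sylProd L = x := by
  induction x using FreeGroup.induction_on with
  | C1 => exact ⟨[], rfl⟩
  | of i => exact ⟨[(i, 1)], by simp [sylProd]⟩
  | inv_of i _ => exact ⟨[(i, -1)], by simp [sylProd]⟩
  | mul x y hx hy =>
    obtain ⟨L, rfl⟩ := hx
    obtain ⟨M, rfl⟩ := hy
    exact ⟨L ++ M, sylProd_append L M⟩

/-- A list of syllables is reduced if exponents are nonzero and adjacent letters differ. -/
def SylReduced (L : List (Fin m × ℤ)) : Prop :=
  (∀ p ∈ L, p.2 ≠ 0) ∧ L.IsChain fun p q => p.1 ≠ q.1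

theorem sylReduced_or_shorter (L : List (Fin m × ℤ)) :
    SylReduced L ∨ ∃ L', L'.length < L.length ∧ sylProd L' = sylProd L := by
  induction L with
  | nil => left; exact ⟨by simp, by simp⟩
  | cons p L ih =>
    rcases ih with ⟨h0, hc⟩ | ⟨L', hl, hL⟩
    · by_cases hp : p.2 = 0
      · right; exact ⟨L, by simp, by simp [sylProd_cons, hp]⟩
      cases L with
      | nil => left; exact ⟨by simpa using hp, by simp⟩
      | cons q M =>
        by_cases hpq : p.1 = q.1
        · right
          refine ⟨(p.1, p.2 + q.2) :: M, by simp, ?_⟩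
          simp [sylProd_cons, hpq, zpow_add, mul_assoc]
        · left
          refine ⟨?_, List.isChain_cons_cons.2 ⟨hpq, hc⟩⟩
          intro r hr
          rcases List.mem_cons.1 hr with rfl | hr
          · exact hp
          · exact h0 r hr
    · right
      exact ⟨p :: L', by simpa using hl, by rw [sylProd_cons, sylProd_cons, hL]⟩

theorem exists_min_length {α : Type*} (P : List α → Prop) (h : ∃ L, P L) :
    ∃ L, P L ∧ ∀ L', P L' → L.length ≤ L'.length := by
  classical
  have hex : ∃ k, ∃ L, P L ∧ L.length = k := by
    obtain ⟨L, hL⟩ := h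
    exact ⟨_, L, hL, rfl⟩
  obtain ⟨L, hL, hlen⟩ := Nat.find_spec hex
  exact ⟨L, hL, fun L' hL' => hlen ▸ Nat.find_min' hex ⟨L', hL', rfl⟩⟩

/-- A cyclically reduced syllable decomposition of a conjugate. -/
theorem exists_cyclic_syl (x : FG m) : ∃ (c : FG m) (L : List (Fin m × ℤ)),
    sylProd L = c * x * c⁻¹ ∧ SylReduced L ∧
      (∀ p q M, L = p :: (M ++ [q]) → p.1 ≠ q.1) := by
  obtain ⟨L₀, hL₀⟩ := exists_sylProd x
  obtain ⟨L, ⟨c, hc⟩, hmin⟩ := exists_min_length (fun L => ∃ c, sylProd L = c * x * c⁻¹)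
    ⟨L₀, 1, by simp [hL₀]⟩
  refine ⟨c, L, hc, ?_, ?_⟩
  · rcases sylReduced_or_shorter L with h | ⟨L', hl, hL⟩
    · exact h
    · exact absurd (hmin L' ⟨c, hL.trans hc⟩) (by omega)
  · rintro ⟨i, e⟩ ⟨j, e'⟩ M rfl hij
    simp only at hij
    subst hij
    have := hmin (M ++ [(i, e' + e)]) ⟨of i ^ (-e) * c, by
      have h : of i ^ (-e) * sylProd ((i, e) :: (M ++ [(i, e')])) * (of i ^ (-e))⁻¹ =
          sylProd (M ++ [(i, e' + e)]) := by
        simp [sylProd_cons, sylProd_append, sylProd_nil, zpow_add, mul_assoc]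
      rw [← h, hc]; simp [mul_assoc]⟩
    simp at this

section Rep

variable {r : ℕ}

/-- The nilpotent matrices attached to a cyclic word `v`. -/
def cycMat [NeZero r] (v : Fin r → Fin m) (i : Fin m) : Matrix (Fin r) (Fin r) ℤ :=
  Matrix.of fun s s' => if s' = s + 1 ∧ v s = i then 1 else 0

theorem cycMat_sq [NeZero r] {v : Fin r → Fin m} (hv : ∀ s, v s ≠ v (s + 1)) (i : Fin m) :
    cycMat v i * cycMat v i = 0 := by
  ext s s'
  rw [Matrix.mul_apply]
  refine Finset.sum_eq_zero fun x _ => ?_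
  simp only [cycMat, Matrix.of_apply]
  by_cases h1 : x = s + 1 ∧ v s = i
  · by_cases h2 : s' = x + 1 ∧ v x = i
    · exact absurd (h1.2.trans (h2.2.symm.trans (by rw [h1.1]))) (hv s)
    · simp [h2]
  · simp [h1]

theorem cycMat_prod_nonneg [NeZero r] (v : Fin r → Fin m) (L : List (Fin m)) (s s' : Fin r) :
    0 ≤ (L.map (cycMat v)).prod s s' := by
  induction L generalizing s with
  | nil => simp only [List.map_nil, List.prod_nil, Matrix.one_apply]; split_ifs <;> simp
  | cons i L ih =>
    rw [List.map_cons, List.prod_cons, Matrix.mul_apply]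
    refine Finset.sum_nonneg fun x _ => mul_nonneg ?_ (ih x)
    simp only [cycMat, Matrix.of_apply]; split_ifs <;> simp

theorem cycMat_prod_pos [NeZero r] (v : Fin r → Fin m) (l a : ℕ) :
    1 ≤ (((List.range' a l).map fun k : ℕ => v (Fin.ofNat r k)).map (cycMat v)).prod
      (Fin.ofNat r a) (Fin.ofNat r (a + l)) := by
  induction l generalizing a with
  | zero => simp
  | succ l ih =>
    rw [List.range'_succ, List.map_cons, List.map_cons, List.prod_cons, Matrix.mul_apply]
    have h := ih (a + 1)
    rw [add_assoc, add_comm 1 l] at h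
    refine h.trans ?_
    have hterm : (cycMat v (v (Fin.ofNat r a))) (Fin.ofNat r a) (Fin.ofNat r (a + 1)) = 1 := by
      have : Fin.ofNat r (a + 1) = Fin.ofNat r a + 1 := by
        ext; simp [Fin.val_add]
      simp only [cycMat, this, Matrix.of_apply, and_self, if_true]
    calc _ = (cycMat v (v (Fin.ofNat r a))) (Fin.ofNat r a) (Fin.ofNat r (a + 1)) *
          (((List.range' (a + 1) l).map fun k : ℕ => v (Fin.ofNat r k)).map (cycMat v)).prod
            (Fin.ofNat r (a + 1)) (Fin.ofNat r (a + (l + 1))) := by rw [hterm, one_mul]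
      _ ≤ _ := Finset.single_le_sum (f := fun x => (cycMat v (v (Fin.ofNat r a)))
            (Fin.ofNat r a) x * (((List.range' (a + 1) l).map
              fun k : ℕ => v (Fin.ofNat r k)).map (cycMat v)).prod x
                (Fin.ofNat r (a + (l + 1))))
          (fun x _ => mul_nonneg (by simpa using cycMat_prod_nonneg v [v (Fin.ofNat r a)] _ _)
            (cycMat_prod_nonneg v _ _ _)) (Finset.mem_univ _)

/-- The unipotent representation over a polynomial ring attached to a cyclic word. -/
def cycRep [NeZero r] (v : Fin r → Fin m) (hv : ∀ s, v s ≠ v (s + 1)) :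
    FG m →* (Matrix (Fin r) (Fin r) ℤ)[X]ˣ :=
  FreeGroup.lift fun i =>
    { val := 1 + C (cycMat v i) * X
      inv := 1 - C (cycMat v i) * X
      val_inv := by
        have : C (cycMat v i) * X * (C (cycMat v i) * X) = 0 := by
          rw [mul_assoc, ← mul_assoc X, X_mul_C, mul_assoc, ← mul_assoc, ← C_mul, cycMat_sq hv]
          simp
        rw [add_mul, mul_sub, mul_sub, this]; simp
      inv_val := by
        have : C (cycMat v i) * X * (C (cycMat v i) * X) = 0 := by
          rw [mul_assoc, ← mul_assoc X, X_mul_C, mul_assoc, ← mul_assoc, ← C_mul, cycMat_sq hv]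
          simp
        rw [sub_mul, mul_add, mul_add, this]; simp }

theorem cycRep_of [NeZero r] (v : Fin r → Fin m) (hv : ∀ s, v s ≠ v (s + 1)) (i : Fin m) :
    (cycRep v hv (of i) : (Matrix (Fin r) (Fin r) ℤ)[X]) = 1 + C (cycMat v i) * X := by
  simp [cycRep]

theorem cycRep_pow [NeZero r] (v : Fin r → Fin m) (hv : ∀ s, v s ≠ v (s + 1)) (i : Fin m) (e : ℤ) :
    (cycRep v hv (of i ^ e) : (Matrix (Fin r) (Fin r) ℤ)[X]) =
      1 + C (e • cycMat v i) * X := by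
  have hsq : ∀ a b : ℤ, C (a • cycMat v i) * X * (C (b • cycMat v i) * X) = 0 := by
    intro a b
    rw [mul_assoc, ← mul_assoc X, X_mul_C, mul_assoc, ← mul_assoc, ← C_mul, smul_mul_smul_comm,
      cycMat_sq hv]
    simp
  have hof : (cycRep v hv (of i) : (Matrix (Fin r) (Fin r) ℤ)[X]) =
      1 + C ((1 : ℤ) • cycMat v i) * X := by simp [cycRep_of]
  have hinv : (((cycRep v hv (of i))⁻¹ : (Matrix (Fin r) (Fin r) ℤ)[X]ˣ) :
      (Matrix (Fin r) (Fin r) ℤ)[X]) = 1 + C ((-1 : ℤ) • cycMat v i) * X := by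
    refine Units.inv_eq_of_mul_eq_one_right ?_
    rw [hof, mul_add, add_mul, add_mul, hsq, mul_one, mul_one, one_mul, add_zero, add_assoc,
      ← add_mul, ← C_add, ← add_smul]
    simp
  induction e using Int.induction_on with
  | zero => simp
  | succ k ih =>
    rw [zpow_add_one, map_mul, Units.val_mul, ih, hof, add_mul, mul_add, mul_add, hsq]
    simp [add_smul, add_mul, add_assoc, add_comm]
  | pred k ih =>
    rw [zpow_sub_one, map_mul, map_inv, Units.val_mul, ih, hinv, add_mul, mul_add, mul_add, hsq]
    simp [add_mul, sub_eq_add_neg, add_assoc, add_comm]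

/-- The trace of the `k`-th coefficient. -/
def coeffTrace (k : ℕ) (p : (Matrix (Fin r) (Fin r) ℤ)[X]) : ℤ := (p.coeff k).trace

theorem coeffTrace_mul_comm (k : ℕ) (p q : (Matrix (Fin r) (Fin r) ℤ)[X]) :
    coeffTrace k (p * q) = coeffTrace k (q * p) := by
  simp only [coeffTrace, coeff_mul, Matrix.trace_sum]
  rw [← Finset.sum_equiv (Equiv.prodComm ℕ ℕ) (s := Finset.HasAntidiagonal.antidiagonal k)
    (t := Finset.HasAntidiagonal.antidiagonal k) (f := fun x => ((p.coeff x.1) * (q.coeff x.2)).trace)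
    (g := fun x => ((q.coeff x.1) * (p.coeff x.2)).trace)]
  · intro x; simp [add_comm]
  · intro x _; exact Matrix.trace_mul_comm _ _

/-- The congruence subgroup of units congruent to `1` modulo `X ^ k`. -/
def congUnits (R : Type*) [Ring R] (k : ℕ) : Subgroup R[X]ˣ where
  carrier := {u | ∃ B, (u : R[X]) = 1 + X ^ k * B}
  one_mem' := ⟨0, by simp⟩
  mul_mem' := by
    rintro u w ⟨B, hB⟩ ⟨D, hD⟩
    exact ⟨B * w + D, by rw [Units.val_mul, hB, hD]; noncomm_ring⟩
  inv_mem' := by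
    rintro u ⟨B, hB⟩
    refine ⟨-(B * ↑u⁻¹), ?_⟩
    have h : (u : R[X]) * ↑u⁻¹ = 1 := u.mul_inv
    rw [hB] at h
    linear_combination (norm := noncomm_ring) h

theorem commutator_mem_congUnits {R : Type*} [Ring R] {k : ℕ} {u w : R[X]ˣ}
    (hu : u ∈ congUnits R k) (hw : w ∈ congUnits R 1) : ⁅u, w⁆ ∈ congUnits R (k + 1) := by
  obtain ⟨B, hB⟩ := hu
  obtain ⟨D, hD⟩ := hw
  refine ⟨(B * D - D * B) * ↑u⁻¹ * ↑w⁻¹, ?_⟩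
  have h1 : (u : R[X]) * (w : R[X]) = (w : R[X]) * (u : R[X]) + X ^ (k + 1) * (B * D - D * B) := by
    have e1 : X ^ k * B * (X ^ 1 * D) = X ^ (k + 1) * (B * D) := by
      rw [mul_assoc, ← mul_assoc B, ← (commute_X_pow B 1).eq, pow_add]; simp only [mul_assoc]
    have e2 : X ^ 1 * D * (X ^ k * B) = X ^ (k + 1) * (D * B) := by
      rw [mul_assoc, ← mul_assoc D, ← (commute_X_pow D k).eq, add_comm, pow_add]
      simp only [mul_assoc]
    rw [hB, hD, mul_sub, ← e1, ← e2]; noncomm_ring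
  rw [commutatorElement_def, Units.val_mul, Units.val_mul, Units.val_mul, h1, add_mul, add_mul]
  simp [mul_assoc]

theorem cycRep_lcs [NeZero r] (v : Fin r → Fin m) (hv : ∀ s, v s ≠ v (s + 1)) (k : ℕ) :
    (⊤ : Subgroup (FG m)).lowerCentralSeries k ≤ (congUnits _ (k + 1)).comap (cycRep v hv) := by
  have hone : ∀ x : FG m, cycRep v hv x ∈ congUnits _ 1 := by
    intro x
    have hof : ∀ i, cycRep v hv (of i) ∈ congUnits _ 1 := fun i =>
      ⟨C (cycMat v i), by rw [cycRep_of, pow_one, X_mul_C]⟩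
    induction x using FreeGroup.induction_on with
    | C1 => rw [map_one]; exact one_mem _
    | of i => exact hof i
    | inv_of i _ => rw [map_inv]; exact inv_mem (hof i)
    | mul x y hx hy => rw [map_mul]; exact mul_mem hx hy
  induction k with
  | zero => exact fun x _ => hone x
  | succ k ih =>
    rw [Subgroup.lowerCentralSeries_succ, Subgroup.commutator_le]
    intro x hx y _
    rw [Subgroup.mem_comap, map_commutatorElement]
    exact commutator_mem_congUnits (ih hx) (hone y)

end Rep

/-- `f` is congruent to an inner automorphism modulo the `k`-th term of the lower central
series. -/
def InnerMod (k : ℕ) (f : MulAut (FG m)) : Prop :=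
  ∃ u : FG m, ∀ x, f x * (u * x * u⁻¹)⁻¹ ∈ (⊤ : Subgroup (FG m)).lowerCentralSeries k

theorem coeffTrace_eq {f : MulAut (FG m)} (hf : ∀ k, InnerMod k f) {r : ℕ} [NeZero r]
    (v : Fin r → Fin m) (hv : ∀ s, v s ≠ v (s + 1)) (k : ℕ) (x c : FG m) :
    coeffTrace k (cycRep v hv (c * f x * c⁻¹) : (Matrix (Fin r) (Fin r) ℤ)[X]) =
      coeffTrace k (cycRep v hv x : (Matrix (Fin r) (Fin r) ℤ)[X]) := by
  have hconj : ∀ c y : FG m,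
      coeffTrace k (cycRep v hv (c * y * c⁻¹) : (Matrix (Fin r) (Fin r) ℤ)[X]) =
        coeffTrace k (cycRep v hv y : (Matrix (Fin r) (Fin r) ℤ)[X]) := by
    intro c y
    rw [map_mul, Units.val_mul, coeffTrace_mul_comm, ← Units.val_mul, ← map_mul]
    congr 3
    group
  rw [hconj]
  obtain ⟨u, hu⟩ := hf k
  obtain ⟨B, hB⟩ := cycRep_lcs v hv k (hu x)
  rw [← hconj u x]
  have : f x = f x * (u * x * u⁻¹)⁻¹ * (u * x * u⁻¹) := by group
  rw [this, map_mul, Units.val_mul, hB, add_mul, one_mul]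
  simp only [coeffTrace, coeff_add, mul_assoc, coeff_X_pow_mul']
  simp

theorem isChain_cyclic_get {L : List (Fin m × ℤ)} [NeZero L.length]
    (hL : L.IsChain fun p q => p.1 ≠ q.1)
    (hcyc : ∀ p q M, L = p :: (M ++ [q]) → p.1 ≠ q.1) (h2 : 2 ≤ L.length) (s : Fin L.length) :
    (L.get s).1 ≠ (L.get (s + 1)).1 := by
  have hval : ((s + 1 : Fin L.length) : ℕ) = (s + 1) % L.length := by
    simp [Fin.val_add]
  by_cases hs : (s : ℕ) + 1 < L.length
  · rw [Nat.mod_eq_of_lt hs] at hval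
    have := List.isChain_iff_getElem.1 hL s hs
    simpa [List.get_eq_getElem, hval] using this
  · have hs' : (s : ℕ) + 1 = L.length := by omega
    rw [hs', Nat.mod_self] at hval
    have hs1 : (s : ℕ) = L.length - 1 := by omega
    simp only [List.get_eq_getElem, hval, hs1]
    have hne : L ≠ [] := by rintro rfl; simp at h2
    obtain ⟨p, L', rfl⟩ := List.exists_cons_of_ne_nil hne
    have hne' : L' ≠ [] := by rintro rfl; simp at h2
    have := hcyc p (L'.getLast hne') L'.dropLast (by rw [List.dropLast_append_getLast])
    simp only [List.getElem_cons_zero]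
    rw [← List.getLast_eq_getElem (by simp), List.getLast_cons hne']
    exact this.symm

/-- The leading trace of a cyclically reduced word does not vanish. -/
theorem coeffTrace_sylProd_ne_zero {L : List (Fin m × ℤ)} [NeZero L.length]
    (h0 : ∀ p ∈ L, p.2 ≠ 0) (hv : ∀ s, (L.get s).1 ≠ (L.get (s + 1)).1) :
    coeffTrace L.length (cycRep (fun s => (L.get s).1) hv (sylProd L) :
      (Matrix (Fin L.length) (Fin L.length) ℤ)[X]) ≠ 0 := by
  set v : Fin L.length → Fin m := fun s => (L.get s).1 with hvdef
  have hrep : ∀ M : List (Fin m × ℤ), (cycRep v hv (sylProd M) :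
      (Matrix (Fin L.length) (Fin L.length) ℤ)[X]) =
      (M.map fun p => 1 + C (p.2 • cycMat v p.1) * X).prod := by
    intro M
    induction M with
    | nil => simp [sylProd]
    | cons p M ih =>
      rw [sylProd_cons, map_mul, Units.val_mul, cycRep_pow, ih, List.map_cons, List.prod_cons]
  have hprod : ∀ M : List (Fin m × ℤ), (M.map fun p => p.2 • cycMat v p.1).prod =
      (M.map Prod.snd).prod • ((M.map Prod.fst).map (cycMat v)).prod := by
    intro M
    induction M with
    | nil => simp
    | cons p M ih =>
      rw [List.map_cons, List.prod_cons, ih, smul_mul_smul_comm]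
      simp
  have hlist : L.map Prod.fst =
      (List.range' 0 L.length).map fun k : ℕ => v (Fin.ofNat L.length k) := by
    refine List.ext_getElem (by simp) fun k h1 h2 => ?_
    have hk : k < L.length := by simpa using h1
    simp [hvdef, Nat.mod_eq_of_lt hk]
  have hcoeff : ((L.map fun p : Fin m × ℤ => (1 : (Matrix (Fin L.length) (Fin L.length) ℤ)[X]) +
      C (p.2 • cycMat v p.1) * X).prod).coeff L.length =
      (L.map Prod.snd).prod • ((L.map Prod.fst).map (cycMat v)).prod := by
    have := coeff_list_prod_of_natDegree_le (L.map fun p : Fin m × ℤ =>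
      1 + C (p.2 • cycMat v p.1) * X) 1 (by
      intro q hq
      obtain ⟨p, _, rfl⟩ := List.mem_map.1 hq
      refine (natDegree_add_le _ _).trans (max_le (by simp) ?_)
      exact natDegree_C_mul_le _ _ |>.trans natDegree_X_le)
    rw [List.length_map, mul_one] at this
    rw [this, ← hprod, List.map_map]
    congr 1
    refine List.map_congr_left fun p _ => ?_
    simp [coeff_one]
  rw [coeffTrace, hrep, hcoeff, Matrix.trace_smul, smul_eq_mul]
  refine mul_ne_zero ?_ (ne_of_gt ?_)
  · refine List.prod_ne_zero fun h => ?_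
    obtain ⟨p, hp, h⟩ := List.mem_map.1 h
    exact h0 p hp h
  · have hpos := cycMat_prod_pos v L.length 0
    rw [← hlist] at hpos
    have h00 : Fin.ofNat L.length (0 + L.length) = Fin.ofNat L.length 0 := by ext; simp
    rw [h00] at hpos
    refine lt_of_lt_of_le zero_lt_one (hpos.trans ?_)
    exact Finset.single_le_sum
      (f := fun i => ((L.map Prod.fst).map (cycMat v)).prod i i)
      (fun i _ => cycMat_prod_nonneg v _ _ _) (Finset.mem_univ _)

/-- The exponent sum of the generator `a_i`. -/
def expSum (i : Fin m) : FG m →* Multiplicative ℤ :=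
  FreeGroup.lift fun k => Multiplicative.ofAdd (if k = i then 1 else 0)

theorem expSum_of (i k : Fin m) :
    expSum i (of k) = Multiplicative.ofAdd (if k = i then 1 else 0) := by
  simp [expSum]

theorem expSum_eq {f : MulAut (FG m)} (hf : InnerMod 1 f) (i : Fin m) (x : FG m) :
    expSum i (f x) = expSum i x := by
  obtain ⟨u, hu⟩ := hf
  have h := Abelianization.commutator_subset_ker (expSum i)
    (by rw [← Subgroup.top_lowerCentralSeries_one]; exact hu x)
  rw [MonoidHom.mem_ker] at h
  simp only [map_mul, map_inv, mul_inv_eq_one] at h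
  rw [h, mul_comm, inv_mul_cancel_left]

theorem exists_conj_of {f : MulAut (FG m)} (hf : ∀ k, InnerMod k f) (i : Fin m) :
    ∃ c, f (of i) = c * of i * c⁻¹ := by
  obtain ⟨c, L, hL, ⟨h0, hch⟩, hcyc⟩ := exists_cyclic_syl (f (of i))
  by_cases h2 : 2 ≤ L.length
  · have : NeZero L.length := ⟨by omega⟩
    have hv := isChain_cyclic_get hch hcyc h2
    refine absurd ?_ (coeffTrace_sylProd_ne_zero h0 hv)
    rw [hL, coeffTrace_eq hf, cycRep_of, coeffTrace, coeff_add, coeff_C_mul_X, coeff_one,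
      if_neg (by omega), if_neg (by omega)]
    simp
  · have hexp : ∀ k, expSum k (sylProd L) = expSum k (of i) := by
      intro k
      rw [hL]
      simp only [map_mul, map_inv]
      rw [mul_comm (expSum k c), mul_inv_cancel_right, expSum_eq (hf 1)]
    match L, h2 with
    | [], _ =>
      have := hexp i
      rw [sylProd_nil, map_one, expSum_of, if_pos rfl] at this
      exact absurd (Multiplicative.ofAdd.injective this) (by simp)
    | [(j, e)], _ =>
      have h1 := hexp i
      rw [sylProd_cons, sylProd_nil, mul_one, map_zpow, expSum_of, expSum_of, if_pos rfl] at h1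
      by_cases hji : j = i
      · subst hji
        have he : e = 1 := by
          rw [if_pos rfl, ← ofAdd_zsmul] at h1
          simpa using h1
        subst he
        refine ⟨c⁻¹, ?_⟩
        rw [sylProd_cons, sylProd_nil] at hL
        simp only [zpow_one, mul_one] at hL
        rw [eq_mul_inv_iff_mul_eq] at hL
        rw [inv_inv, mul_assoc, hL]; group
      · rw [if_neg hji] at h1
        rw [ofAdd_zero, one_zpow] at h1
        exact absurd (Multiplicative.ofAdd.injective h1) (by simp)
    | p :: q :: L', h2 => simp at h2

theorem conj_form_of_fix {f : MulAut (FG m)} (hf : ∀ k, InnerMod k f) {i j : Fin m} (hij : i ≠ j)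
    (hi : f (of i) = of i) {c : FG m} (hc : f (of j) = c * of j * c⁻¹) :
    ∃ a b : ℤ, c = of i ^ a * of j ^ b := by
  obtain ⟨L₀, hL₀⟩ := exists_sylProd c
  obtain ⟨L, ⟨a, b, hL⟩, hmin⟩ := exists_min_length
    (fun L => ∃ a b : ℤ, sylProd L = of i ^ a * c * of j ^ b) ⟨L₀, 0, 0, by simp [hL₀]⟩
  by_cases hnil : L = []
  · subst hnil
    refine ⟨-a, -b, ?_⟩
    have : c = of i ^ (-a) * (of i ^ a * c * of j ^ b) * of j ^ (-b) := by group
    rw [this, ← hL, sylProd_nil]; group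
  exfalso
  have hred : SylReduced L := by
    rcases sylReduced_or_shorter L with h | ⟨L', hl, hL'⟩
    · exact h
    · exact absurd (hmin L' ⟨a, b, hL'.trans hL⟩) (by omega)
  have hhead : ∀ p M, L = p :: M → p.1 ≠ i := by
    rintro ⟨i', e⟩ M rfl h
    obtain rfl : i' = i := h
    have := hmin M ⟨a - e, b, by
      rw [sylProd_cons] at hL
      have h : sylProd M = of i' ^ (-e) * (of i' ^ e * sylProd M) := by group
      rw [h, hL, sub_eq_neg_add, zpow_add]; group⟩
    simp at this
  have hlast : ∀ q M, L = M ++ [q] → q.1 ≠ j := by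
    rintro ⟨j', e⟩ M rfl h
    obtain rfl : j' = j := h
    have := hmin M ⟨a, b - e, by
      rw [sylProd_append, sylProd_cons, sylProd_nil, mul_one] at hL
      have h : sylProd M = (sylProd M * of j' ^ e) * of j' ^ (-e) := by group
      rw [h, hL, sub_eq_add_neg, zpow_add]; group⟩
    simp at this
  obtain ⟨p, M, hpM⟩ := List.exists_cons_of_ne_nil hnil
  obtain ⟨q, M', hqM⟩ : ∃ q M', L = M' ++ [q] :=
    ⟨_, _, (List.dropLast_append_getLast hnil).symm⟩
  have hinv : sylInv L = (q.1, -q.2) :: sylInv M' := by rw [hqM]; simp [sylInv]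
  have hinv' : sylInv L = sylInv M ++ [(p.1, -p.2)] := by rw [hpM]; simp [sylInv]
  set W : List (Fin m × ℤ) := (i, 1) :: (L ++ (j, 1) :: sylInv L) with hW
  have hlen : 2 < W.length := by
    rw [hW, hpM]; simp
  have : NeZero W.length := ⟨by omega⟩
  have h0 : ∀ s ∈ W, s.2 ≠ 0 := by
    intro s hs
    rw [hW] at hs
    simp only [sylInv, List.mem_cons, List.mem_append, List.mem_reverse, List.mem_map] at hs
    rcases hs with rfl | hs | rfl | ⟨t, ht, rfl⟩
    · simp
    · exact hred.1 s hs
    · simp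
    · simpa using hred.1 t ht
  have hch : W.IsChain fun p q => p.1 ≠ q.1 := by
    have hInvChain : (sylInv L).IsChain fun p q => p.1 ≠ q.1 := by
      rw [sylInv, List.isChain_reverse, List.isChain_map]
      exact hred.2.imp fun _ _ h => h.symm
    rw [hW]
    refine List.isChain_cons.2 ⟨?_, ?_⟩
    · intro y hy
      rw [hpM] at hy
      simp only [List.cons_append, List.head?_cons, Option.mem_def, Option.some.injEq] at hy
      subst hy
      exact (hhead p M hpM).symm
    · refine List.isChain_append.2 ⟨hred.2, List.isChain_cons.2 ⟨?_, hInvChain⟩, ?_⟩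
      · intro y hy
        rw [hinv] at hy
        simp only [List.head?_cons, Option.mem_def, Option.some.injEq] at hy
        subst hy
        exact (hlast q M' hqM).symm
      · intro x hx y hy
        rw [hqM] at hx
        simp only [List.getLast?_append, List.getLast?_singleton, Option.mem_def,
          Option.some_or, Option.some.injEq] at hx
        simp only [List.head?_cons, Option.mem_def, Option.some.injEq] at hy
        subst hx hy
        exact hlast q M' hqM
  have hcyc : ∀ p q M, W = p :: (M ++ [q]) → p.1 ≠ q.1 := by
    intro p' q' N hN
    rw [hW, hinv'] at hN
    have h1 : (i, (1 : ℤ)) = p' := (List.cons.inj hN).1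
    have h2 : (L ++ (j, 1) :: sylInv M) ++ [(p.1, -p.2)] = N ++ [q'] := by
      rw [← (List.cons.inj hN).2]; simp
    have h3 : (p.1, -p.2) = q' := by
      simpa using (List.append_inj_right' h2 rfl)
    rw [← h1, ← h3]
    exact (hhead p M hpM).symm
  have hv := isChain_cyclic_get hch hcyc (by omega)
  refine absurd ?_ (coeffTrace_sylProd_ne_zero h0 hv)
  have hprod : sylProd W = of i ^ a * f (of i * of j) * (of i ^ a)⁻¹ := by
    rw [hW, sylProd_cons, sylProd_append, sylProd_cons, sylProd_sylInv, hL, map_mul, hi, hc]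
    group
  rw [hprod, coeffTrace_eq hf, map_mul, Units.val_mul, cycRep_of, cycRep_of, coeffTrace,
    coeff_eq_zero_of_natDegree_lt, Matrix.trace_zero]
  refine lt_of_le_of_lt (natDegree_mul_le) (lt_of_le_of_lt (b := 1 + 1) (add_le_add ?_ ?_) hlen) <;>
  · refine (natDegree_add_le _ _).trans (max_le (by simp) ?_)
    exact natDegree_C_mul_le _ _ |>.trans natDegree_X_le

theorem InnerMod.conj_mul {k : ℕ} {f : MulAut (FG m)} (hf : InnerMod k f) (c : FG m) :
    InnerMod k (MulAut.conj c * f) := by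
  obtain ⟨u, hu⟩ := hf
  refine ⟨c * u, fun x => ?_⟩
  have := Subgroup.Normal.conj_mem inferInstance _ (hu x) c
  convert this using 1
  simp only [MulAut.mul_apply, MulAut.conj_apply]
  group

/-- An automorphism of a free group that is inner modulo each term of the lower central series
is inner. -/
theorem mem_inn_of_innerMod {f : MulAut (FG m)} (hf : ∀ k, InnerMod k f) : f ∈ InnFG m := by
  have hconj : ∀ c : FG m, MulAut.conj c ∈ InnFG m := fun c => ⟨c, rfl⟩
  rcases Nat.eq_zero_or_pos m with hm | hm
  · subst hm
    have : f = 1 := mulAut_ext fun k => k.elim0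
    rw [this]; exact one_mem _
  obtain ⟨c, hc⟩ := exists_conj_of hf ⟨0, hm⟩
  rw [← Subgroup.mul_mem_cancel_left _ (hconj c⁻¹)]
  have hg : ∀ k, InnerMod k (MulAut.conj c⁻¹ * f) := fun k => (hf k).conj_mul _
  have hg0 : (MulAut.conj c⁻¹ * f) (of ⟨0, hm⟩) = of ⟨0, hm⟩ := by
    simp [hc, mul_assoc]
  generalize MulAut.conj c⁻¹ * f = g at hg hg0
  rcases Nat.lt_or_ge 1 m with hm1 | hm1
  swap
  · have : g = 1 := mulAut_ext fun k => by
      obtain rfl : k = ⟨0, hm⟩ := by ext; simp; omega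
      exact hg0
    rw [this]; exact one_mem _
  have h01 : (⟨0, hm⟩ : Fin m) ≠ ⟨1, hm1⟩ := by simp
  obtain ⟨d, hd⟩ := exists_conj_of hg ⟨1, hm1⟩
  obtain ⟨a, b, hab⟩ := conj_form_of_fix hg h01 hg0 hd
  rw [← Subgroup.mul_mem_cancel_left _ (hconj (of ⟨0, hm⟩ ^ (-a)))]
  have hh : ∀ k, InnerMod k (MulAut.conj (of (⟨0, hm⟩ : Fin m) ^ (-a)) * g) := fun k => (hg k).conj_mul _
  have hh0 : (MulAut.conj (of (⟨0, hm⟩ : Fin m) ^ (-a)) * g) (of ⟨0, hm⟩) = of (⟨0, hm⟩ : Fin m) := by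
    simp only [MulAut.mul_apply, hg0, MulAut.conj_apply]; group
  have hh1 : (MulAut.conj (of (⟨0, hm⟩ : Fin m) ^ (-a)) * g) (of ⟨1, hm1⟩) = of ⟨1, hm1⟩ := by
    simp only [MulAut.mul_apply, hd, MulAut.conj_apply, hab]; group
  generalize MulAut.conj (of (⟨0, hm⟩ : Fin m) ^ (-a)) * g = h at hh hh0 hh1
  have : h = 1 := mulAut_ext fun k => by
    by_cases hk0 : k = ⟨0, hm⟩
    · rw [hk0, hh0]; rfl
    by_cases hk1 : k = ⟨1, hm1⟩
    · rw [hk1, hh1]; rfl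
    obtain ⟨e, he⟩ := exists_conj_of hh k
    obtain ⟨a, b, hab⟩ := conj_form_of_fix hh (Ne.symm hk0) hh0 he
    obtain ⟨a', b', hab'⟩ := conj_form_of_fix hh (Ne.symm hk1) hh1 he
    have ha : a = 0 := by
      have := congrArg (expSum ⟨0, hm⟩) (hab.symm.trans hab')
      rw [map_mul, map_mul, map_zpow, map_zpow, map_zpow, map_zpow, expSum_of, expSum_of,
        expSum_of, if_pos rfl, if_neg hk0, if_neg h01.symm, ofAdd_zero, one_zpow, one_zpow,
        one_zpow, mul_one, mul_one, ← ofAdd_zsmul] at this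
      simpa using this
    rw [he, hab, ha]
    simp only [MulAut.one_apply]; group
  rw [this]; exact one_mem _

end Detection

section TrivialHomology

open FreeGroup (of)
open scoped commutatorElement

/-- The quotient map from automorphisms to outer automorphisms. -/
def toOut (n : ℕ) : MulAut (FG n) →* OutFG n := QuotientGroup.mk' (InnFG n)

theorem toOut_surjective (n : ℕ) : Function.Surjective (toOut n) :=
  QuotientGroup.mk'_surjective _

theorem toOut_eq_one_iff {n : ℕ} (f : MulAut (FG n)) : toOut n f = 1 ↔ f ∈ InnFG n :=
  QuotientGroup.eq_one_iff f

theorem toOut_eq_iff {n : ℕ} (f g : MulAut (FG n)) :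
    toOut n f = toOut n g ↔ ∃ u, f = MulAut.conj u * g := by
  rw [← mul_inv_eq_one, ← map_inv, ← map_mul, toOut_eq_one_iff]
  constructor
  · rintro ⟨u, hu⟩; exact ⟨u, by rw [hu]; simp⟩
  · rintro ⟨u, rfl⟩; exact ⟨u, by simp⟩

theorem toOut_conj {n : ℕ} (u : FG n) : toOut n (MulAut.conj u) = 1 :=
  (toOut_eq_one_iff _).2 ⟨u, rfl⟩

variable {m : ℕ}

/-- Automorphisms acting trivially modulo the `k`-th term of the lower central series. -/
def lcsKer (m k : ℕ) : Subgroup (MulAut (FG m)) where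
  carrier := {f | ∀ x, f x * x⁻¹ ∈ (⊤ : Subgroup (FG m)).lowerCentralSeries k}
  one_mem' := fun x => by simp
  mul_mem' := by
    intro f g hf hg x
    have : (f * g) x * x⁻¹ = f (g x) * (g x)⁻¹ * (g x * x⁻¹) := by simp [mul_assoc]
    rw [this]
    exact mul_mem (hf _) (hg _)
  inv_mem' := by
    intro f hf x
    have := inv_mem (hf (f⁻¹ x))
    simpa using this

theorem innerMod_iff {k : ℕ} {f : MulAut (FG m)} :
    InnerMod k f ↔ ∃ u, ∃ g ∈ lcsKer m k, f = MulAut.conj u * g := by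
  constructor
  · rintro ⟨u, hu⟩
    refine ⟨u, MulAut.conj u⁻¹ * f, fun x => ?_, by simp⟩
    have := Subgroup.Normal.conj_mem inferInstance _ (hu x) u⁻¹
    convert this using 1
    simp only [MulAut.mul_apply, MulAut.conj_apply]
    group
  · rintro ⟨u, g, hg, rfl⟩
    have hg' : InnerMod k g := ⟨1, fun x => by simpa using hg x⟩
    exact hg'.conj_mul u

theorem commutator_central_mul {Q : Type*} [Group Q] {z w : Q} (hz : ∀ x, z * x = x * z)
    (hw : ∀ x, w * x = x * w) (a b : Q) : ⁅z * a, w * b⁆ = ⁅a, b⁆ := by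
  rw [commutatorElement_def, commutatorElement_def, mul_inv_rev, mul_inv_rev]
  calc z * a * (w * b) * (a⁻¹ * z⁻¹) * (b⁻¹ * w⁻¹)
      = z * (a * (w * b) * a⁻¹) * z⁻¹ * (b⁻¹ * w⁻¹) := by group
    _ = a * (w * b) * a⁻¹ * (b⁻¹ * w⁻¹) := by rw [hz]; group
    _ = w * (a * b * a⁻¹ * b⁻¹) * w⁻¹ := by rw [← mul_assoc a w, ← hw a]; group
    _ = a * b * a⁻¹ * b⁻¹ := by rw [hw]; group

theorem lcsKer_apply_eq {k : ℕ} {f : MulAut (FG m)} (hf : f ∈ lcsKer m k) {y : FG m}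
    (hy : y ∈ (⊤ : Subgroup (FG m)).lowerCentralSeries 1) :
    (QuotientGroup.mk (f y) : FG m ⧸ (⊤ : Subgroup (FG m)).lowerCentralSeries (k + 1)) =
      QuotientGroup.mk y := by
  have hle : (⊤ : Subgroup (FG m)).lowerCentralSeries 1 ≤
      MonoidHom.eqLocus
        ((QuotientGroup.mk' ((⊤ : Subgroup (FG m)).lowerCentralSeries (k + 1))).comp
          f.toMonoidHom)
        (QuotientGroup.mk' ((⊤ : Subgroup (FG m)).lowerCentralSeries (k + 1))) := by
    rw [Subgroup.lowerCentralSeries_succ, Subgroup.commutator_le]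
    intro a _ b _
    have hcen : ∀ x : FG m, ∃ z : FG m ⧸ (⊤ : Subgroup (FG m)).lowerCentralSeries (k + 1),
        (∀ w, z * w = w * z) ∧ (QuotientGroup.mk' _ (f x)) = z * QuotientGroup.mk' _ x := by
      intro x
      refine ⟨QuotientGroup.mk' _ (f x * x⁻¹), fun w => ?_,
        by rw [← map_mul, inv_mul_cancel_right]⟩
      obtain ⟨w, rfl⟩ := QuotientGroup.mk'_surjective _ w
      rw [← commutatorElement_eq_one_iff_mul_comm, ← map_commutatorElement,
        QuotientGroup.mk'_apply, QuotientGroup.eq_one_iff]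
      exact Subgroup.commutator_mem_commutator (hf x) trivial
    obtain ⟨z, hz, ha⟩ := hcen a
    obtain ⟨w, hw, hb⟩ := hcen b
    change (QuotientGroup.mk' _) (f ⁅a, b⁆) = _
    rw [map_commutatorElement, map_commutatorElement, map_commutatorElement, ha, hb,
      commutator_central_mul hz hw]
  exact hle hy

theorem lcsKer_commutator {k : ℕ} (hk : 1 ≤ k) {f g : MulAut (FG m)} (hf : f ∈ lcsKer m k)
    (hg : g ∈ lcsKer m k) : ⁅f, g⁆ ∈ lcsKer m (k + 1) := by
  intro x
  obtain ⟨x, rfl⟩ := (g * f).surjective x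
  have h1 : ⁅f, g⁆ ((g * f) x) = f (g x) := by
    rw [commutatorElement_def, ← MulAut.mul_apply]
    simp [mul_assoc]
  rw [h1, ← QuotientGroup.eq_one_iff, QuotientGroup.mk_mul, QuotientGroup.mk_inv,
    mul_inv_eq_one, MulAut.mul_apply]
  have hle := (⊤ : Subgroup (FG m)).lowerCentralSeries_antitone hk
  have hfy := lcsKer_apply_eq hf (hle (hg x))
  have hgz := lcsKer_apply_eq hg (hle (hf x))
  have hcen : ∀ y ∈ (⊤ : Subgroup (FG m)).lowerCentralSeries k, ∀ w : FG m,
      (QuotientGroup.mk y : FG m ⧸ (⊤ : Subgroup (FG m)).lowerCentralSeries (k + 1)) *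
        QuotientGroup.mk w = QuotientGroup.mk w * QuotientGroup.mk y := by
    intro y hy w
    rw [← commutatorElement_eq_one_iff_mul_comm, ← QuotientGroup.mk'_apply,
      ← QuotientGroup.mk'_apply, ← map_commutatorElement,
      QuotientGroup.mk'_apply, QuotientGroup.eq_one_iff]
    exact Subgroup.commutator_mem_commutator hy trivial
  have e1 : f (g x) = f (g x * x⁻¹) * (f x * x⁻¹) * x := by simp
  have e2 : g (f x) = g (f x * x⁻¹) * (g x * x⁻¹) * x := by simp
  rw [e1, e2, QuotientGroup.mk_mul, QuotientGroup.mk_mul, QuotientGroup.mk_mul _ _ x,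
    QuotientGroup.mk_mul _ _ (g x * x⁻¹), hfy, hgz, hcen _ (hg x)]

theorem InnerMod.mul_conj {k : ℕ} {f : MulAut (FG m)} (hf : InnerMod k f) (c : FG m) :
    InnerMod k (f * MulAut.conj c) := by
  rw [mulAut_mul_conj]; exact hf.conj_mul _

theorem InnerMod.inv {k : ℕ} {f : MulAut (FG m)} (hf : InnerMod k f) : InnerMod k f⁻¹ := by
  obtain ⟨u, g, hg, rfl⟩ := innerMod_iff.1 hf
  rw [mul_inv_rev, ← map_inv]
  exact InnerMod.mul_conj (innerMod_iff.2 ⟨1, g⁻¹, inv_mem hg, by simp⟩) _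

theorem InnerMod.commutator {k : ℕ} (hk : 1 ≤ k) {f g : MulAut (FG m)} (hf : InnerMod k f)
    (hg : InnerMod k g) : InnerMod (k + 1) ⁅f, g⁆ := by
  obtain ⟨u, f, hf₀, rfl⟩ := innerMod_iff.1 hf
  obtain ⟨v, g, hg₀, rfl⟩ := innerMod_iff.1 hg
  have h : InnerMod (k + 1) ⁅f, g⁆ := innerMod_iff.2 ⟨1, _, lcsKer_commutator hk hf₀ hg₀, by simp⟩
  have e : ⁅MulAut.conj u * f, MulAut.conj v * g⁆ =
      MulAut.conj (u * f v) * (⁅f, g⁆ * MulAut.conj (v * g u)⁻¹) := by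
    have e1 : MulAut.conj u * f * (MulAut.conj v * g) = MulAut.conj (u * f v) * (f * g) := by
      rw [mul_assoc, ← mul_assoc f, mulAut_mul_conj, map_mul]; simp only [mul_assoc]
    have e2 : MulAut.conj v * g * (MulAut.conj u * f) = MulAut.conj (v * g u) * (g * f) := by
      rw [mul_assoc, ← mul_assoc g, mulAut_mul_conj, map_mul]; simp only [mul_assoc]
    have e3 : ∀ a b : MulAut (FG m), ⁅a, b⁆ = a * b * (b * a)⁻¹ := fun a b => by
      rw [commutatorElement_def]; group
    rw [e3, e3, e1, e2, mul_inv_rev (MulAut.conj (v * g u)), map_inv]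
    simp only [mul_assoc]
  rw [e]
  exact (h.mul_conj _).conj_mul _

/-- If all transvections map to outer automorphisms acting trivially on homology, then they map
to the identity. -/
theorem map_rho_eq_one {n : ℕ} (hn : 3 ≤ n) (ψ : MulAut (FG n) →* OutFG m)
    (h : ∀ i j : Fin n, i ≠ j → ∃ f, toOut m f = ψ (rho i j) ∧ f ∈ lcsKer m 1) {i k : Fin n}
    (hik : i ≠ k) : ψ (rho i k) = 1 := by
  have key : ∀ t : ℕ, ∀ i k : Fin n, i ≠ k →
      ∃ f, toOut m f = ψ (rho i k) ∧ InnerMod (t + 1) f := by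
    intro t
    induction t with
    | zero =>
      intro i k hik
      obtain ⟨f, hf, hf'⟩ := h i k hik
      exact ⟨f, hf, innerMod_iff.2 ⟨1, f, hf', by simp⟩⟩
    | succ t ih =>
      intro i k hik
      obtain ⟨j, hj⟩ : ∃ j : Fin n, j ∉ ({i, k} : Finset (Fin n)) := by
        by_contra! hcon
        have h1 : (Finset.univ : Finset (Fin n)).card ≤ ({i, k} : Finset (Fin n)).card :=
          Finset.card_le_card fun x _ => hcon x
        have := h1.trans Finset.card_le_two
        simp at this
        omega
      simp only [Finset.mem_insert, Finset.mem_singleton, not_or] at hj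
      obtain ⟨f, hf, hf'⟩ := ih i j (Ne.symm hj.1)
      obtain ⟨g, hg, hg'⟩ := ih j k hj.2
      refine ⟨⁅g⁻¹, f⁻¹⁆, ?_, (hg'.inv).commutator (by omega) hf'.inv⟩
      rw [map_commutatorElement, map_inv, map_inv, hf, hg, ← map_inv, ← map_inv,
        ← map_commutatorElement]
      congr 1
      have := rho_mul_rho (Ne.symm hj.1) hj.2 hik
      rw [eq_mul_inv_iff_mul_eq] at this
      rw [commutatorElement_def, inv_inv, inv_inv, mul_assoc, ← this]
      group
  obtain ⟨f, hf⟩ := toOut_surjective m (ψ (rho i k))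
  rw [← hf, toOut_eq_one_iff]
  refine mem_inn_of_innerMod fun t => ?_
  obtain ⟨g, hg, hg'⟩ := key t i k hik
  obtain ⟨u, rfl⟩ := (toOut_eq_iff f g).1 (hf.trans hg.symm)
  obtain ⟨v, hv⟩ := hg'.conj_mul u
  exact ⟨v, fun x => Subgroup.lowerCentralSeries_antitone _ (Nat.le_succ t) (hv x)⟩

end TrivialHomology

/-! ### Joint eigenvectors of commuting involutions -/

section Weights

variable {V ι : Type*} [AddCommGroup V] [Module ℚ V]

/-- Vectors which are joint eigenvectors for distinct characters are linearly independent. -/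
theorem linearIndependent_of_distinct_characters {X : Type*} (T : ι → V →ₗ[ℚ] V) (J : Set ι)
    (v : X → V) (χ : X → ι → ℚ) (hv : ∀ x, v x ≠ 0) (hT : ∀ x, ∀ i ∈ J, T i (v x) = χ x i • v x)
    (hχ : ∀ x y, (∀ i ∈ J, χ x i = χ y i) → x = y) : LinearIndependent ℚ v := by
  classical
  rw [linearIndependent_iff']
  intro s
  induction s using Finset.induction_on with
  | empty => simp
  | insert a s ha ih =>
    intro c hc
    have hs : ∀ x ∈ s, c x = 0 := by
      intro x hx
      have hxa : x ≠ a := by rintro rfl; exact ha hx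
      obtain ⟨i, hi, hne⟩ : ∃ i ∈ J, χ x i ≠ χ a i := by
        by_contra! h
        exact hxa (hχ x a h)
      have h1 : ∑ y ∈ s, (c y * (χ y i - χ a i)) • v y = 0 := by
        have h2 := congrArg (fun w => T i w - χ a i • w) hc
        simp only [map_sum, map_smul, map_zero, smul_zero, sub_zero, Finset.smul_sum,
          ← Finset.sum_sub_distrib] at h2
        rw [Finset.sum_insert ha] at h2
        rw [hT a i hi, smul_comm, sub_self, zero_add] at h2
        rw [← h2]
        refine Finset.sum_congr rfl fun y _ => ?_
        rw [hT y i hi]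
        module
      have := ih _ h1 x hx
      exact (mul_eq_zero.1 this).resolve_right (sub_ne_zero.2 hne)
    intro x hx
    rcases Finset.mem_insert.1 hx with rfl | hx
    · rw [Finset.sum_insert ha, Finset.sum_eq_zero (fun y hy => by rw [hs y hy, zero_smul]),
        add_zero] at hc
      exact (smul_eq_zero.1 hc).resolve_right (hv x)
    · exact hs x hx

/-- Commuting involutions of a nonzero space have a joint eigenvector. -/
theorem exists_joint_eigenvector (T : ι → V →ₗ[ℚ] V) (W : Submodule ℚ V) (J : Finset ι)
    (hW : ∀ i ∈ J, ∀ x ∈ W, T i x ∈ W)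
    (hcomm : ∀ i ∈ J, ∀ j ∈ J, ∀ x ∈ W, T i (T j x) = T j (T i x))
    (hsq : ∀ i ∈ J, ∀ x ∈ W, T i (T i x) = x) (x : V) (hx : x ∈ W) (hx0 : x ≠ 0) :
    ∃ y ∈ W, y ≠ 0 ∧ ∀ i ∈ J, T i y = y ∨ T i y = -y := by
  classical
  induction J using Finset.induction_on with
  | empty => exact ⟨x, hx, hx0, by simp⟩
  | insert a J ha ih =>
    obtain ⟨y, hy, hy0, hyJ⟩ := ih (fun i hi => hW i (Finset.mem_insert_of_mem hi))
      (fun i hi j hj => hcomm i (Finset.mem_insert_of_mem hi) j (Finset.mem_insert_of_mem hj))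
      (fun i hi => hsq i (Finset.mem_insert_of_mem hi))
    have haJ := Finset.mem_insert_self a J
    have hTy := hW a haJ y hy
    by_cases h : y + T a y = 0
    · refine ⟨y, hy, hy0, fun i hi => ?_⟩
      rcases Finset.mem_insert.1 hi with rfl | hi
      · right; exact (neg_eq_of_add_eq_zero_right h).symm
      · exact hyJ i hi
    · refine ⟨y + T a y, W.add_mem hy hTy, h, fun i hi => ?_⟩
      rcases Finset.mem_insert.1 hi with rfl | hi
      · left; rw [map_add, hsq i haJ y hy, add_comm]
      · rw [map_add, hcomm i (Finset.mem_insert_of_mem hi) a haJ y hy]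
        rcases hyJ i hi with h' | h' <;> rw [h']
        · left; rfl
        · right; rw [map_neg]; abel

/-- A family split by orthogonal projections is independent if each slice is. -/
theorem linearIndependent_of_projections {K X : Type*} (p : K → V →ₗ[ℚ] V) (v : K × X → V)
    (h1 : ∀ k x, p k (v (k, x)) = v (k, x)) (h2 : ∀ k k' x, k ≠ k' → p k (v (k', x)) = 0)
    (hv : ∀ k, LinearIndependent ℚ fun x => v (k, x)) : LinearIndependent ℚ v := by
  classical
  rw [linearIndependent_iff]
  intro c hc
  ext ⟨k, x⟩
  have h3 := congrArg (p k) hc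
  rw [Finsupp.linearCombination_apply, Finsupp.sum, map_sum, map_zero] at h3
  have h4 : ∑ y ∈ c.support, p k (c y • v y) =
      ∑ y ∈ c.support.filter (fun y => y.1 = k), c y • v y := by
    rw [Finset.sum_filter]
    refine Finset.sum_congr rfl fun y _ => ?_
    obtain ⟨k', y⟩ := y
    by_cases hk : k' = k
    · subst hk; simp [h1]
    · simp [hk, h2 k k' y (Ne.symm hk)]
  rw [h4] at h3
  have h5 := (linearIndependent_iff'.1 (hv k)) ((c.support.filter fun y => y.1 = k).image Prod.snd)
    (fun y => c (k, y)) (by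
      rw [← h3, Finset.sum_image]
      · refine Finset.sum_congr rfl fun y hy => ?_
        obtain ⟨k', y⟩ := y
        rw [(Finset.mem_filter.1 hy).2.symm]
      · rintro ⟨a, b⟩ ha ⟨a', b'⟩ ha' hab
        simp only [Finset.coe_filter, Set.mem_ofPred_eq] at ha ha' hab
        rw [ha.2, ha'.2, hab])
  by_contra hne
  refine hne (h5 x ?_)
  simp only [Finset.mem_image, Finset.mem_filter, Finsupp.mem_support_iff]
  exact ⟨(k, x), ⟨hne, rfl⟩, rfl⟩

theorem choose_two_le_choose {n k : ℕ} (h2 : 2 ≤ k) (hk : k + 2 ≤ n) :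
    n.choose 2 ≤ n.choose k := by
  induction n generalizing k with
  | zero => omega
  | succ n ih =>
    rcases Nat.eq_or_lt_of_le h2 with rfl | h2
    · exact le_rfl
    rcases Nat.eq_or_lt_of_le hk with h | hk
    · rw [← Nat.choose_symm (show k ≤ n + 1 by omega)]
      rw [show n + 1 - k = 2 by omega]
    obtain ⟨k, rfl⟩ : ∃ k', k = k' + 1 := ⟨k - 1, by omega⟩
    rw [Nat.choose_succ_succ, Nat.choose_succ_succ]
    have e1 := ih (k := k) (by omega) (by omega)
    have e2 := ih (k := k + 1) (by omega) (by omega)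
    have e3 : n ≤ n.choose 2 := by
      rw [Nat.choose_two_right, Nat.le_div_iff_mul_le (by norm_num)]
      exact Nat.mul_le_mul_left n (by omega)
    simp only [Nat.choose_one_right, Nat.succ_eq_add_one, Nat.reduceAdd] at *
    omega

theorem le_choose {n k : ℕ} (h2 : 1 ≤ k) (hk : k + 1 ≤ n) : n ≤ n.choose k := by
  induction n generalizing k with
  | zero => omega
  | succ n ih =>
    rcases Nat.eq_or_lt_of_le hk with h | hk
    · rw [← Nat.choose_symm (show k ≤ n + 1 by omega)]
      rw [show n + 1 - k = 1 by omega]; simp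
    obtain ⟨k, rfl⟩ : ∃ k', k = k' + 1 := ⟨k - 1, by omega⟩
    rw [Nat.choose_succ_succ]
    have e1 : 0 < n.choose k := Nat.choose_pos (by omega)
    have e2 := ih (k := k + 1) (by omega) (by omega)
    simp only [Nat.succ_eq_add_one] at *
    omega

/-- The weights of a permutation-equivariant family of involutions are closed under
permutations. -/
theorem exists_linearIndependent_of_weight {n : ℕ} (T : Fin n → V →ₗ[ℚ] V)
    (P : Equiv.Perm (Fin n) → V →ₗ[ℚ] V) (W : Submodule ℚ V) (J S : Finset (Fin n)) (hS : S ⊆ J)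
    (hP : ∀ σ : Equiv.Perm (Fin n), (∀ k ∉ J, σ k = k) → ∀ x ∈ W, P σ x ∈ W)
    (hP0 : ∀ σ : Equiv.Perm (Fin n), (∀ k ∉ J, σ k = k) → ∀ x ∈ W, P σ x = 0 → x = 0)
    (hPT : ∀ σ : Equiv.Perm (Fin n), (∀ k ∉ J, σ k = k) → ∀ j ∈ J, ∀ x ∈ W,
      T (σ j) (P σ x) = P σ (T j x))
    (y : V) (hy : y ∈ W) (hy0 : y ≠ 0) (h1 : ∀ j ∈ J, j ∉ S → T j y = y)
    (h2 : ∀ j ∈ S, T j y = -y) :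
    ∃ v : {A // A ∈ J.powersetCard S.card} → V, LinearIndependent ℚ v ∧ ∀ A, v A ∈ W := by
  classical
  have key : ∀ A : {A // A ∈ J.powersetCard S.card},
      ∃ σ : Equiv.Perm (Fin n), (∀ k ∉ J, σ k = k) ∧ S.map σ.toEmbedding = A.1 := by
    rintro ⟨A, hA⟩
    obtain ⟨hAJ, hAc⟩ := Finset.mem_powersetCard.1 hA
    have hc : (S \ A).card = (A \ S).card := by
      have e1 := Finset.card_sdiff_add_card_inter S A
      have e2 := Finset.card_sdiff_add_card_inter A S
      rw [Finset.inter_comm] at e2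
      omega
    let τ : {x // x ∈ S \ A} ≃ {x // x ∈ A \ S} := Finset.equivOfCardEq hc
    let g : Fin n → Fin n := fun k =>
      if h : k ∈ S \ A then τ ⟨k, h⟩ else if h : k ∈ A \ S then τ.symm ⟨k, h⟩ else k
    have hg1 : ∀ k (h : k ∈ S \ A), g k = τ ⟨k, h⟩ := fun k h => dif_pos h
    have hg2 : ∀ k (h : k ∈ A \ S), g k = τ.symm ⟨k, h⟩ := fun k h => by
      have h' : k ∉ S \ A := by simp at h ⊢; tauto
      exact (dif_neg h').trans (dif_pos h)
    have hg3 : ∀ k, k ∉ S \ A → k ∉ A \ S → g k = k := fun k h h' =>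
      (dif_neg h).trans (dif_neg h')
    have hgg : Function.Involutive g := by
      intro k
      by_cases h : k ∈ S \ A
      · rw [hg1 k h, hg2 _ (τ ⟨k, h⟩).2]; simp
      · by_cases h' : k ∈ A \ S
        · rw [hg2 k h', hg1 _ (τ.symm ⟨k, h'⟩).2]; simp
        · rw [hg3 k h h', hg3 k h h']
    refine ⟨hgg.toPerm g, fun k hk => ?_, ?_⟩
    · refine hg3 k ?_ ?_
      · simp only [Finset.mem_sdiff]; exact fun h => hk (hS h.1)
      · simp only [Finset.mem_sdiff]; exact fun h => hk (hAJ h.1)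
    · refine Finset.eq_of_subset_of_card_le ?_ (by simp [hAc])
      intro x hx
      obtain ⟨k, hk, rfl⟩ := Finset.mem_map.1 hx
      change g k ∈ A
      by_cases h : k ∈ A
      · rw [hg3 k (by simp [h]) (by simp [hk])]; exact h
      · have hkS : k ∈ S \ A := by simp [hk, h]
        rw [hg1 k hkS]
        exact (Finset.mem_sdiff.1 (τ ⟨k, hkS⟩).2).1
  choose σ hσ hσS using key
  refine ⟨fun A => P (σ A) y, ?_, fun A => hP _ (hσ A) y hy⟩
  refine linearIndependent_of_distinct_characters T (J : Set (Fin n)) _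
    (fun A i => if i ∈ A.1 then -1 else 1) (fun A h => hy0 (hP0 _ (hσ A) y hy h)) ?_ ?_
  · intro A i hi
    obtain ⟨j, rfl⟩ := (σ A).surjective i
    have hj : j ∈ J := by
      by_contra hj
      have hjj := hσ A j hj
      rw [hjj] at hi
      exact hj hi
    rw [hPT _ (hσ A) j hj y hy]
    have hmem : σ A j ∈ A.1 ↔ j ∈ S := by
      rw [← hσS A]; simp
    by_cases hjS : j ∈ S
    · simp [hmem, hjS, h2 j hjS]
    · simp [hmem, hjS, h1 j hj hjS]
  · intro A B hAB
    ext i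
    by_cases hi : i ∈ J
    · have := hAB i hi
      by_cases hA : i ∈ A.1 <;> by_cases hB : i ∈ B.1 <;> simp [hA, hB] at this ⊢ <;>
        norm_num at this
    · have hA := (Finset.mem_powersetCard.1 A.2).1
      have hB := (Finset.mem_powersetCard.1 B.2).1
      exact ⟨fun h => absurd (hA h) hi, fun h => absurd (hB h) hi⟩

end Weights

/-! ### Weight projections -/

section Projections

variable {n : ℕ}

theorem exists_two_ne (hn : 5 ≤ n) (i j k : Fin n) :
    ∃ l l' : Fin n, l ≠ l' ∧ l ≠ i ∧ l ≠ j ∧ l ≠ k ∧ l' ≠ i ∧ l' ≠ j ∧ l' ≠ k := by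
  have h : 1 < (Finset.univ \ {i, j, k} : Finset (Fin n)).card := by
    have h1 := Finset.le_card_sdiff ({i, j, k} : Finset (Fin n)) Finset.univ
    have h2 : ({i, j, k} : Finset (Fin n)).card ≤ 3 := Finset.card_le_three
    rw [Finset.card_univ, Fintype.card_fin] at h1
    omega
  obtain ⟨l, hl, l', hl', hne⟩ := Finset.one_lt_card.1 h
  simp only [Finset.mem_sdiff, Finset.mem_univ, Finset.mem_insert, Finset.mem_singleton,
    not_or, true_and] at hl hl'
  exact ⟨l, l', hne, hl.1, hl.2.1, hl.2.2, hl'.1, hl'.2.1, hl'.2.2⟩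

/-- The properties of the weight projections attached to commuting involutions `e i`. -/
structure IsWeightProjection {R : Type*} [Ring R] (e p : Fin n → R) : Prop where
  four : ∀ i j k, j ≠ i → k ≠ i → j ≠ k → 4 * p i = (1 - e i * e j) * (1 - e i * e k)
  comm : ∀ i j, e i * p j = p j * e i
  neg : ∀ i l, l ≠ i → e i * e l * p i = -p i
  fix : ∀ i k l, k ≠ i → l ≠ i → e k * e l * p i = p i
  idem : ∀ i, p i * p i = p i
  orth : ∀ i j, i ≠ j → p i * p j = 0
  zero : ∀ k l, k ≠ l → e k * e l * (1 - ∑ i, p i) = 1 - ∑ i, p i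

theorem exists_isWeightProjection_of_comm {A : Type*} [CommRing A] [Algebra ℚ A] (hn : 5 ≤ n)
    (e : Fin n → A) (he : ∀ i, e i * e i = 1)
    (key : ∀ i j k l, i ≠ j → i ≠ k → i ≠ l → j ≠ k → j ≠ l → k ≠ l →
      (1 - e i) * (1 - e j) * (1 + e k) * (1 + e l) = 0) :
    ∃ p : Fin n → A, IsWeightProjection e p := by
  have can : ∀ (z : A), 4 * z = 0 → z = 0 := by
    intro z hz
    have : (1 / 4 : ℚ) • (4 * z) = z := by
      rw [Algebra.smul_def, ← mul_assoc]
      have : (algebraMap ℚ A (1 / 4)) * 4 = 1 := by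
        rw [← map_ofNat (algebraMap ℚ A) 4, ← map_mul]; norm_num
      rw [this, one_mul]
    rw [← this, hz, smul_zero]
  have four_inj : ∀ x y : A, 4 * x = 4 * y → x = y := by
    intro x y h
    exact sub_eq_zero.1 (can _ (by rw [mul_sub, h, sub_self]))
  have key2 : ∀ i j k l, i ≠ j → i ≠ k → i ≠ l → j ≠ k → j ≠ l → k ≠ l →
      (1 - e i * e j) * (1 - e k * e l) = 0 := by
    intro i j k l h1 h2 h3 h4 h5 h6
    apply can
    linear_combination key i k j l h2 h1 h3 h4.symm h6 h5 + key i l j k h3 h1 h2 h5.symm h6.symm h4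
      + key j k i l h4 h1.symm h5 h2.symm h6 h3 + key j l i k h5 h1.symm h4 h3.symm h6.symm h2
  have dep1 : ∀ i j k l, i ≠ j → i ≠ k → i ≠ l → j ≠ k → j ≠ l → k ≠ l →
      (1 - e i * e j) * (1 - e i * e k) = (1 - e i * e j) * (1 - e i * e l) := by
    intro i j k l h1 h2 h3 h4 h5 h6
    have t1 := key2 i j k l h1 h2 h3 h4 h5 h6
    linear_combination (-e i * e k) * t1 - ((1 - e i * e j) * e i * e l) * he k
  have ch : ∀ i : Fin n, ∃ jk : Fin n × Fin n, jk.1 ≠ i ∧ jk.2 ≠ i ∧ jk.1 ≠ jk.2 := by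
    intro i
    obtain ⟨l, l', h1, h2, -, -, h3, -⟩ := exists_two_ne hn i i i
    exact ⟨(l, l'), h2, h3, h1⟩
  choose jk hj hk hjk using ch
  let p : Fin n → A := fun i =>
    (1 / 4 : ℚ) • ((1 - e i * e (jk i).1) * (1 - e i * e (jk i).2))
  have hp0 : ∀ i, 4 * p i = (1 - e i * e (jk i).1) * (1 - e i * e (jk i).2) := by
    intro i
    rw [show (4 : A) = algebraMap ℚ A 4 from (map_ofNat _ 4).symm, ← Algebra.smul_def, smul_smul]
    norm_num
  have dep2 : ∀ i j k l, i ≠ j → i ≠ k → i ≠ l → j ≠ k → j ≠ l →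
      (1 - e i * e j) * (1 - e i * e k) = (1 - e i * e j) * (1 - e i * e l) := by
    intro i j k l h1 h2 h3 h4 h5
    by_cases h6 : k = l
    · rw [h6]
    · exact dep1 i j k l h1 h2 h3 h4 h5 h6
  have hp : ∀ i j k, j ≠ i → k ≠ i → j ≠ k → 4 * p i = (1 - e i * e j) * (1 - e i * e k) := by
    intro i j k h1 h2 h3
    rw [hp0]
    obtain ⟨l, -, -, h4, h5, h6, -⟩ := exists_two_ne hn i j (jk i).1
    rw [dep2 i (jk i).1 (jk i).2 l (hj i).symm (hk i).symm h4.symm (hjk i) h6.symm, mul_comm,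
      dep2 i l (jk i).1 j h4.symm (hj i).symm h1.symm h6 h5, mul_comm,
      dep2 i j l k h1.symm h4.symm h2.symm h5.symm h3]
  have hneg : ∀ i l, l ≠ i → e i * e l * p i = -p i := by
    intro i l hl
    obtain ⟨k, -, -, h4, h5, -⟩ := exists_two_ne hn i l l
    have := hp i l k hl h4 h5.symm
    apply four_inj
    linear_combination (e i * e l + 1) * this - (1 - e i * e k) * ((e l * e l) * he i + he l)
  have hfix : ∀ i k l, k ≠ i → l ≠ i → e k * e l * p i = p i := by
    intro i k l hk hl
    have h1 := hneg i k hk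
    have h2 := hneg i l hl
    linear_combination (-e k * e l * p i) * he i + (e i * e k) * h2 - h1
  have hidem : ∀ i, p i * p i = p i := by
    intro i
    obtain ⟨j, k, h3, h1, -, -, h2, -⟩ := exists_two_ne hn i i i
    have e1 := hneg i j h1
    have e2 := hneg i k h2
    apply four_inj
    have := hp i j k h1 h2 h3
    linear_combination p i * this - e1 - e2 + e i * e j * e2 - e1
  have horth : ∀ i j, i ≠ j → p i * p j = 0 := by
    intro i j hij
    obtain ⟨k, -, -, h1, h2, -⟩ := exists_two_ne hn i j j
    have e1 := hneg i k h1
    have e2 := hfix j i k hij h2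
    apply can
    linear_combination (2 * p j) * e1 - (2 * p i) * e2
  refine ⟨p, hp, fun i j => mul_comm _ _, hneg, hfix, hidem, horth, ?_⟩
  intro k l hkl
  obtain ⟨j, -, -, h1, h2, -⟩ := exists_two_ne hn k l l
  have s1 : (1 - e k * e l) * ∑ i, p i = 2 * p k + 2 * p l := by
    rw [Finset.mul_sum]
    rw [← Finset.add_sum_erase _ _ (Finset.mem_univ k),
      ← Finset.add_sum_erase _ _ (Finset.mem_erase.2 ⟨hkl.symm, Finset.mem_univ l⟩),
      Finset.sum_eq_zero]
    · have e1 := hneg k l hkl.symm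
      have e2 := hneg l k hkl
      linear_combination -e1 - e2
    · intro i hi
      simp only [Finset.mem_erase, Finset.mem_univ, and_true] at hi
      rw [sub_mul, one_mul, hfix i k l hi.2.symm hi.1.symm, sub_self]
  have s2 : 2 * p k + 2 * p l = 1 - e k * e l := by
    have e1 := hp k l j hkl.symm h1 h2.symm
    have e2 := hp l k j hkl h2 h1.symm
    apply four_inj
    linear_combination 2 * e1 + 2 * e2 + 2 * (e l * e j) * he k + 2 * (e k * e j) * he l
  linear_combination s1 + s2

theorem exists_isWeightProjection {R : Type*} [Ring R] [Algebra ℚ R] (hn : 5 ≤ n)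
    (e : Fin n → R) (he : ∀ i, e i * e i = 1) (hcomm : ∀ i j, e i * e j = e j * e i)
    (key : ∀ i j k l, i ≠ j → i ≠ k → i ≠ l → j ≠ k → j ≠ l → k ≠ l →
      (1 - e i) * (1 - e j) * (1 + e k) * (1 + e l) = 0) :
    ∃ p : Fin n → R, IsWeightProjection e p := by
  have hc : ∀ a ∈ Set.range e, ∀ b ∈ Set.range e, a * b = b * a := by
    rintro _ ⟨i, rfl⟩ _ ⟨j, rfl⟩; exact hcomm i j
  have hmc := Algebra.isMulCommutative_adjoin ℚ hc
  let : CommRing (Algebra.adjoin ℚ (Set.range e)) :=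
    { (inferInstance : Ring (Algebra.adjoin ℚ (Set.range e))) with mul_comm := hmc.is_comm.comm }
  let e' : Fin n → Algebra.adjoin ℚ (Set.range e) := fun i =>
    ⟨e i, Algebra.subset_adjoin ⟨i, rfl⟩⟩
  obtain ⟨p, hp⟩ := exists_isWeightProjection_of_comm (A := Algebra.adjoin ℚ (Set.range e)) hn e'
    (fun i => Subtype.ext (he i))
    (fun i j k l h1 h2 h3 h4 h5 h6 => Subtype.ext (key i j k l h1 h2 h3 h4 h5 h6))
  refine ⟨fun i => p i, ?_, ?_, ?_, ?_, ?_, ?_, ?_⟩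
  · intro i j k h1 h2 h3
    exact congrArg Subtype.val (hp.four i j k h1 h2 h3)
  · intro i j
    simpa using congrArg Subtype.val (hp.comm i j)
  · intro i j h
    simpa using congrArg Subtype.val (hp.neg i j h)
  · intro i j k h h'
    simpa using congrArg Subtype.val (hp.fix i j k h h')
  · intro i
    simpa using congrArg Subtype.val (hp.idem i)
  · intro i j h
    simpa using congrArg Subtype.val (hp.orth i j h)
  · intro i j h
    simpa using congrArg Subtype.val (hp.zero i j h)

end Projections

/-! ### Small representations of the automorphism group of a free group -/

section SmallReps

variable {n : ℕ}

theorem eq_of_four_mul_eq {R : Type*} [Ring R] [Algebra ℚ R] {x y : R} (h : 4 * x = 4 * y) :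
    x = y := by
  have h4 : algebraMap ℚ R (1 / 4) * 4 = 1 := by
    rw [← map_ofNat (algebraMap ℚ R) 4, ← map_mul]; norm_num
  have := congrArg (fun z => algebraMap ℚ R (1 / 4) * z) h
  simpa only [← mul_assoc, h4, one_mul] using this

section Ring

variable {R : Type*} [Ring R] [Algebra ℚ R] {Ψ : MulAut (FG n) →* R} {p : Fin n → R}

theorem IsWeightProjection.pm_mul (hn : 5 ≤ n) (hp : IsWeightProjection (fun i => Ψ (eps i)) p)
    (σ : Equiv.Perm (Fin n)) (i : Fin n) : Ψ (pm σ) * p i = p (σ i) * Ψ (pm σ) := by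
  obtain ⟨j, k, h3, h1, -, -, h2, -⟩ := exists_two_ne hn i i i
  have e1 := hp.four i j k h1 h2 h3
  have e2 := hp.four (σ i) (σ j) (σ k) (by simpa using h1) (by simpa using h2) (by simpa using h3)
  have hcomm : ∀ i, Ψ (pm σ) * Ψ (eps i) = Ψ (eps (σ i)) * Ψ (pm σ) := fun i => by
    rw [← map_mul, pm_eps, map_mul]
  have h : ∀ i j, Ψ (pm σ) * (1 - Ψ (eps i) * Ψ (eps j)) =
      (1 - Ψ (eps (σ i)) * Ψ (eps (σ j))) * Ψ (pm σ) := fun i j => by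
    rw [mul_sub, sub_mul, mul_one, one_mul, ← mul_assoc, hcomm, mul_assoc, hcomm, mul_assoc]
  apply eq_of_four_mul_eq
  calc 4 * (Ψ (pm σ) * p i) = Ψ (pm σ) * (4 * p i) := by
        rw [← mul_assoc, ← mul_assoc]; congr 1; exact (Nat.cast_commute 4 _)
    _ = 4 * p (σ i) * Ψ (pm σ) := by rw [e1, e2, ← mul_assoc, h, mul_assoc, h, mul_assoc]
    _ = _ := mul_assoc _ _ _

theorem IsWeightProjection.tw_comm (hn : 5 ≤ n) (hp : IsWeightProjection (fun i => Ψ (eps i)) p)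
    {i j k : Fin n} (hij : i ≠ j) (hik : k ≠ i) (hjk : k ≠ j) (s t : ℤ) :
    Ψ (tw i j s t) * p k = p k * Ψ (tw i j s t) := by
  obtain ⟨l, l', h3, hl1, hl2, hl3, hl1', hl2', hl3'⟩ := exists_two_ne hn i j k
  have e1 := hp.four k l l' hl3 hl3' h3
  have hcomm : ∀ a, a ≠ i → a ≠ j → Ψ (tw i j s t) * Ψ (eps a) = Ψ (eps a) * Ψ (tw i j s t) :=
    fun a h1 h2 => by rw [← map_mul, ← eps_tw_of_ne hij h1 h2, map_mul]
  have h : ∀ a b, a ≠ i → a ≠ j → b ≠ i → b ≠ j →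
      Ψ (tw i j s t) * (1 - Ψ (eps a) * Ψ (eps b)) =
      (1 - Ψ (eps a) * Ψ (eps b)) * Ψ (tw i j s t) := fun a b h1 h2 h3 h4 => by
    rw [mul_sub, sub_mul, mul_one, one_mul, ← mul_assoc, hcomm a h1 h2, mul_assoc, hcomm b h3 h4,
      mul_assoc]
  apply eq_of_four_mul_eq
  calc 4 * (Ψ (tw i j s t) * p k) = Ψ (tw i j s t) * (4 * p k) := by
        rw [← mul_assoc, ← mul_assoc]; congr 1; exact (Nat.cast_commute 4 _)
    _ = 4 * p k * Ψ (tw i j s t) := by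
        rw [e1, ← mul_assoc, h k l hik hjk hl1 hl2, mul_assoc, h k l' hik hjk hl1' hl2', mul_assoc]
    _ = _ := mul_assoc _ _ _

/-- `eps i * eps j` conjugates a right transvection to a left transvection. -/
theorem eps_eps_rho {i j : Fin n} (hij : i ≠ j) :
    eps i * eps j * rho i j = lam i j * (eps i * eps j) := by
  rw [mul_assoc, eps_tw_right hij, ← mul_assoc, eps_tw_left hij, mul_assoc]; simp

theorem eps_eps_rho_right {i j l : Fin n} (hij : i ≠ j) (hli : l ≠ i) (hlj : l ≠ j) :
    eps j * eps l * rho i j = (rho i j)⁻¹ * (eps j * eps l) := by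
  rw [mul_assoc, eps_tw_of_ne hij hli hlj, ← mul_assoc, eps_tw_right hij, mul_assoc, tw_inv hij]

theorem IsWeightProjection.lam_mul (hn : 5 ≤ n) (hp : IsWeightProjection (fun i => Ψ (eps i)) p)
    {i j k : Fin n} (hij : i ≠ j) (hik : k ≠ i) (hjk : k ≠ j) :
    Ψ (lam i j) * p k = Ψ (rho i j) * p k := by
  have h1 := congrArg (fun g => Ψ g * p k) (eps_eps_rho hij)
  simp only [map_mul, mul_assoc] at h1
  have h2 := hp.fix k i j hik.symm hjk.symm
  simp only [mul_assoc] at h2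
  rw [h2, hp.tw_comm hn hij hik hjk, ← mul_assoc (Ψ (eps j)), ← mul_assoc, ← mul_assoc] at h1
  rw [← h1, mul_assoc (Ψ (eps i)), ← mul_assoc (Ψ (eps i)), hp.fix k i j hik.symm hjk.symm,
    hp.tw_comm hn hij hik hjk]

theorem IsWeightProjection.rho_inv_mul (hn : 5 ≤ n)
    (hp : IsWeightProjection (fun i => Ψ (eps i)) p)
    {i j k : Fin n} (hij : i ≠ j) (hik : k ≠ i) (hjk : k ≠ j) :
    Ψ (rho i j)⁻¹ * p k = Ψ (rho i j) * p k := by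
  obtain ⟨l, -, -, hl1, hl2, hl3, -⟩ := exists_two_ne hn i j k
  have h1 := congrArg (fun g => Ψ g * p k) (eps_eps_rho_right hij hl1 hl2)
  simp only [map_mul, mul_assoc] at h1
  have h2 := hp.fix k j l hjk.symm hl3
  simp only [mul_assoc] at h2
  rw [h2, hp.tw_comm hn hij hik hjk, ← mul_assoc (Ψ (eps l)), ← mul_assoc, ← mul_assoc] at h1
  rw [← h1, mul_assoc (Ψ (eps j)), ← mul_assoc (Ψ (eps j)), hp.fix k j l hjk.symm hl3,
    hp.tw_comm hn hij hik hjk]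

theorem IsWeightProjection.rho_sq_mul (hn : 5 ≤ n)
    (hp : IsWeightProjection (fun i => Ψ (eps i)) p)
    {i j k : Fin n} (hij : i ≠ j) (hik : k ≠ i) (hjk : k ≠ j) :
    Ψ (rho i j) * (Ψ (rho i j) * p k) = p k := by
  rw [← hp.rho_inv_mul hn hij hik hjk, ← mul_assoc, ← map_mul, mul_inv_cancel, map_one, one_mul]

theorem IsWeightProjection.rho_rho_comm (hn : 5 ≤ n)
    (hp : IsWeightProjection (fun i => Ψ (eps i)) p)
    {i j l k : Fin n} (hij : i ≠ j) (hil : i ≠ l) (hik : k ≠ i) (hjk : k ≠ j) (hlk : k ≠ l) :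
    Ψ (rho i j) * (Ψ (rho i l) * p k) = Ψ (rho i l) * (Ψ (rho i j) * p k) := by
  rw [← hp.lam_mul hn hil hik hlk, ← mul_assoc, ← map_mul, rho_comm_lam hij hil, map_mul,
    mul_assoc, hp.tw_comm hn hij hik hjk, ← mul_assoc, hp.lam_mul hn hil hik hlk, mul_assoc]

end Ring

end SmallReps

section Small

open Matrix

variable {n m : ℕ}

/-- A rational matrix representation of `Out(F_n)` of dimension less than `n.choose 2`, together
with its weight projections. -/
structure IsSmallRep (Φ : MulAut (FG n) →* Matrix (Fin m) (Fin m) ℚ)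
    (p : Fin n → Matrix (Fin m) (Fin m) ℚ) : Prop where
  six_le : 6 ≤ n
  dim_lt : m < n.choose 2
  inner : ∀ u : FG n, Φ (MulAut.conj u) = 1
  weight : IsWeightProjection (fun i => Φ (eps i)) p

/-- The contragredient representation. -/
def dualRep (Φ : MulAut (FG n) →* Matrix (Fin m) (Fin m) ℚ) :
    MulAut (FG n) →* Matrix (Fin m) (Fin m) ℚ where
  toFun g := (Φ g⁻¹)ᵀ
  map_one' := by simp
  map_mul' g h := by rw [_root_.mul_inv_rev, map_mul, transpose_mul]

theorem dualRep_apply (Φ : MulAut (FG n) →* Matrix (Fin m) (Fin m) ℚ) (g : MulAut (FG n)) :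
    dualRep Φ g = (Φ g⁻¹)ᵀ := rfl

theorem eps_inv (i : Fin n) : (eps i)⁻¹ = eps i := inv_eq_of_mul_eq_one_left (eps_mul_self i)

theorem IsSmallRep.dual {Φ : MulAut (FG n) →* Matrix (Fin m) (Fin m) ℚ}
    {p : Fin n → Matrix (Fin m) (Fin m) ℚ} (h : IsSmallRep Φ p) :
    IsSmallRep (dualRep Φ) (fun i => (p i)ᵀ) := by
  have hee : ∀ i j, Φ (eps i) * Φ (eps j) = Φ (eps j) * Φ (eps i) := fun i j => by
    rw [← map_mul, eps_comm, map_mul]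
  have hc := h.weight.comm
  have hc2 : ∀ i j k, p i * (Φ (eps j) * Φ (eps k)) = Φ (eps j) * Φ (eps k) * p i := fun i j k => by
    rw [← mul_assoc, ← hc, mul_assoc, ← hc, mul_assoc]
  refine ⟨h.six_le, h.dim_lt, fun u => ?_, ⟨?_, ?_, ?_, ?_, ?_, ?_, ?_⟩⟩
  · rw [dualRep_apply, ← map_inv, h.inner, transpose_one]
  · intro i j k h1 h2 h3
    simp only [dualRep_apply, eps_inv]
    have h4 : (4 : Matrix (Fin m) (Fin m) ℚ)ᵀ = 4 := by
      rw [show (4 : Matrix (Fin m) (Fin m) ℚ) = (4 : ℕ) from rfl, transpose_natCast]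
    have := congrArg transpose (h.weight.four i k j h2 h1 h3.symm)
    rw [hee i k, hee i j] at this
    simp only [transpose_mul, transpose_sub, transpose_one, h4] at this
    rw [show (4 : Matrix (Fin m) (Fin m) ℚ) * (p i)ᵀ = (p i)ᵀ * 4 from Nat.cast_commute 4 _, this]
  · intro i j
    simp only [dualRep_apply, eps_inv]
    rw [← transpose_mul, ← transpose_mul, hc]
  · intro i l hl
    simp only [dualRep_apply, eps_inv]
    rw [← transpose_mul, ← transpose_mul, hee l i, hc2, h.weight.neg i l hl, transpose_neg]
  · intro i k l hk hl
    simp only [dualRep_apply, eps_inv]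
    rw [← transpose_mul, ← transpose_mul, hee l k, hc2, h.weight.fix i k l hk hl]
  · intro i
    rw [← transpose_mul, h.weight.idem]
  · intro i j hij
    rw [← transpose_mul, h.weight.orth j i hij.symm, transpose_zero]
  · intro k l hkl
    simp only [dualRep_apply, eps_inv]
    have : (1 : Matrix (Fin m) (Fin m) ℚ) - ∑ i, (p i)ᵀ = (1 - ∑ i, p i)ᵀ := by
      rw [transpose_sub, transpose_one, transpose_sum]
    rw [this, ← transpose_mul, ← transpose_mul, hee l k]
    have h2 : (1 - ∑ i, p i) * (Φ (eps k) * Φ (eps l)) = Φ (eps k) * Φ (eps l) * (1 - ∑ i, p i) := by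
      rw [sub_mul, mul_sub, one_mul, mul_one, Finset.mul_sum, Finset.sum_mul]
      simp only [hc2]
    rw [h2, h.weight.zero k l hkl]

theorem matrix_ext_mulVec {A B : Matrix (Fin m) (Fin m) ℚ} (h : ∀ x, A *ᵥ x = B *ᵥ x) : A = B :=
  Matrix.toLin'.injective (LinearMap.ext fun x => by simpa using h x)

theorem card_le_of_linearIndependent {X : Type*} [Fintype X] (v : X → Fin m → ℚ)
    (hv : LinearIndependent ℚ v) : Fintype.card X ≤ m := by
  simpa using hv.fintype_card_le_finrank

theorem exists_isSmallRep (hn : 6 ≤ n) (hm : m < n.choose 2)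
    (Φ : MulAut (FG n) →* Matrix (Fin m) (Fin m) ℚ) (hΦ : ∀ u, Φ (MulAut.conj u) = 1) :
    ∃ p, IsSmallRep Φ p := by
  classical
  have hee : ∀ i j, Φ (eps i) * Φ (eps j) = Φ (eps j) * Φ (eps i) := fun i j => by
    rw [← map_mul, eps_comm, map_mul]
  have hsq : ∀ i, Φ (eps i) * Φ (eps i) = 1 := fun i => by
    rw [← map_mul, eps_mul_self, map_one]
  suffices key : ∀ i j k l, i ≠ j → i ≠ k → i ≠ l → j ≠ k → j ≠ l → k ≠ l →
      (1 - Φ (eps i)) * (1 - Φ (eps j)) * (1 + Φ (eps k)) * (1 + Φ (eps l)) = 0 by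
    obtain ⟨p, hp⟩ := exists_isWeightProjection (by omega) (fun i => Φ (eps i)) hsq hee key
    exact ⟨p, hn, hm, hΦ, hp⟩
  intro i j k l hij hik hil hjk hjl hkl
  apply matrix_ext_mulVec
  intro x
  rw [zero_mulVec]
  by_contra hx0
  set z := ((1 - Φ (eps i)) * (1 - Φ (eps j)) * (1 + Φ (eps k)) * (1 + Φ (eps l))) *ᵥ x with hz
  let T : Fin n → (Fin m → ℚ) →ₗ[ℚ] (Fin m → ℚ) := fun i => (Φ (eps i)).mulVecLin
  let W : Submodule ℚ (Fin m → ℚ) :=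
    LinearMap.ker (T i + LinearMap.id) ⊓ LinearMap.ker (T j + LinearMap.id) ⊓
      (LinearMap.ker (T k - LinearMap.id) ⊓ LinearMap.ker (T l - LinearMap.id))
  have hW : ∀ x, x ∈ W ↔ (Φ (eps i) *ᵥ x = -x ∧ Φ (eps j) *ᵥ x = -x) ∧
      (Φ (eps k) *ᵥ x = x ∧ Φ (eps l) *ᵥ x = x) := by
    intro x
    simp [W, T, Submodule.mem_inf, LinearMap.mem_ker, sub_eq_zero, add_eq_zero_iff_eq_neg]
  have neg1 : ∀ (a : Fin n) (B : Matrix (Fin m) (Fin m) ℚ),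
      Φ (eps a) * ((1 - Φ (eps a)) * B) = -((1 - Φ (eps a)) * B) := fun a B => by
    rw [← mul_assoc, mul_sub, mul_one, hsq, ← neg_mul, neg_sub]
  have pos1 : ∀ (a : Fin n) (B : Matrix (Fin m) (Fin m) ℚ),
      Φ (eps a) * ((1 + Φ (eps a)) * B) = (1 + Φ (eps a)) * B := fun a B => by
    rw [← mul_assoc, mul_add, mul_one, hsq, add_comm]
  have cm : ∀ (a b : Fin n) (B : Matrix (Fin m) (Fin m) ℚ),
      Φ (eps a) * ((1 - Φ (eps b)) * B) = (1 - Φ (eps b)) * (Φ (eps a) * B) := fun a b B => by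
    rw [← mul_assoc, ← mul_assoc, mul_sub, sub_mul 1, hee, mul_one, one_mul]
  have cp : ∀ (a b : Fin n) (B : Matrix (Fin m) (Fin m) ℚ),
      Φ (eps a) * ((1 + Φ (eps b)) * B) = (1 + Φ (eps b)) * (Φ (eps a) * B) := fun a b B => by
    rw [← mul_assoc, ← mul_assoc, mul_add, add_mul 1, hee, mul_one, one_mul]
  have hzW : z ∈ W := by
    rw [hW, hz]
    simp only [mulVec_mulVec, ← neg_mulVec]
    refine ⟨⟨?_, ?_⟩, ?_, ?_⟩ <;> congr 1 <;> simp only [mul_assoc]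
    · exact neg1 _ _
    · rw [cm, neg1, mul_neg]
    · rw [cm, cm, pos1]
    · rw [cm, cm, cp]
      congr 3
      rw [mul_add, hsq, mul_one, add_comm]
  obtain ⟨y, hyW, hy0, hy⟩ := exists_joint_eigenvector T W Finset.univ
    (by
      intro a _ x hx
      rw [hW] at hx ⊢
      obtain ⟨⟨h1, h2⟩, h3, h4⟩ := hx
      simp only [T, mulVecLin_apply, mulVec_mulVec]
      simp only [hee _ a, ← mulVec_mulVec, h1, h2, h3, h4, mulVec_neg, and_self])
    (by intro a _ b _ x _; simp only [T, mulVecLin_apply, mulVec_mulVec, hee])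
    (by intro a _ x _; simp only [T, mulVecLin_apply, mulVec_mulVec, hsq, one_mulVec])
    z hzW hx0
  obtain ⟨⟨h1, h2⟩, h3, h4⟩ := (hW y).1 hyW
  have hne : ∀ a, Φ (eps a) *ᵥ y = -y → Φ (eps a) *ᵥ y = y → False := fun a e1 e2 =>
    hy0 (self_eq_neg.1 (e2.symm.trans e1))
  let S : Finset (Fin n) := Finset.univ.filter fun a => Φ (eps a) *ᵥ y = -y
  obtain ⟨v, hv, -⟩ := exists_linearIndependent_of_weight T (fun σ => (Φ (pm σ)).mulVecLin) ⊤
    Finset.univ S (Finset.subset_univ _) (fun _ _ _ _ => Submodule.mem_top)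
    (fun σ _ x _ h => by
      have := congrArg (fun w => Φ (pm σ⁻¹) *ᵥ w) h
      simpa only [mulVecLin_apply, mulVec_mulVec, ← map_mul, ← pm_mul, inv_mul_cancel, pm_one,
        map_one, one_mulVec, mulVec_zero] using this)
    (fun σ _ a _ x _ => by
      simp only [T, mulVecLin_apply, mulVec_mulVec]
      rw [← map_mul, ← pm_eps, map_mul])
    y Submodule.mem_top hy0
    (fun a _ ha => (hy a (Finset.mem_univ a)).resolve_right fun h =>
      ha (Finset.mem_filter.2 ⟨Finset.mem_univ a, h⟩))
    (fun a ha => by simpa [S, T] using ha)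
  have h5 := card_le_of_linearIndependent v hv
  rw [Fintype.card_coe, Finset.card_powersetCard, Finset.card_univ, Fintype.card_fin] at h5
  have h6 : 2 ≤ S.card := by
    have : ({i, j} : Finset (Fin n)) ⊆ S := by
      intro a ha
      rcases Finset.mem_insert.1 ha with rfl | ha
      · simpa [S] using h1
      · rw [Finset.mem_singleton.1 ha]; simpa [S] using h2
    simpa [Finset.card_pair hij] using Finset.card_le_card this
  have h7 : S.card + 2 ≤ n := by
    have : S ⊆ Finset.univ \ {k, l} := by
      intro a ha
      have ha : Φ (eps a) *ᵥ y = -y := by simpa [S] using ha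
      simp only [Finset.mem_sdiff, Finset.mem_univ, Finset.mem_insert, Finset.mem_singleton,
        true_and, not_or]
      exact ⟨fun h => hne a ha (h ▸ h3), fun h => hne a ha (h ▸ h4)⟩
    have := Finset.card_le_card this
    rw [Finset.card_sdiff_of_subset (Finset.subset_univ _), Finset.card_pair hkl, Finset.card_univ,
      Fintype.card_fin] at this
    omega
  have := choose_two_le_choose h6 h7
  omega

namespace IsSmallRep

variable {Φ : MulAut (FG n) →* Matrix (Fin m) (Fin m) ℚ} {p : Fin n → Matrix (Fin m) (Fin m) ℚ}

theorem five_le (h : IsSmallRep Φ p) : 5 ≤ n := by have := h.six_le; omega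

theorem rho_mul_eq_rho_mul (h : IsSmallRep Φ p) {i j l k : Fin n} (hij : i ≠ j) (hil : i ≠ l)
    (hki : k ≠ i) (hkj : k ≠ j) (hkl : k ≠ l) : Φ (rho i j) * p k = Φ (rho i l) * p k := by
  classical
  have h5 := h.five_le
  have hp := h.weight
  by_contra hne
  have hx : ∃ x, Φ (rho i j) *ᵥ (p k *ᵥ x) ≠ Φ (rho i l) *ᵥ (p k *ᵥ x) := by
    by_contra! hcon
    exact hne (matrix_ext_mulVec fun x => by simpa only [mulVec_mulVec] using hcon x)
  obtain ⟨x, hx⟩ := hx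
  let J : Finset (Fin n) := Finset.univ \ {i, k}
  have hJ : ∀ a, a ∈ J ↔ a ≠ i ∧ a ≠ k := by simp [J]
  have hjJ : j ∈ J := (hJ j).2 ⟨hij.symm, hkj.symm⟩
  have hlJ : l ∈ J := (hJ l).2 ⟨hil.symm, hkl.symm⟩
  let T : Fin n → (Fin m → ℚ) →ₗ[ℚ] (Fin m → ℚ) := fun a => (Φ (rho i a)).mulVecLin
  have hT : ∀ a x, T a x = Φ (rho i a) *ᵥ x := fun a x => rfl
  let E : Submodule ℚ (Fin m → ℚ) := LinearMap.ker ((p k).mulVecLin - LinearMap.id)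
  have hE : ∀ x, x ∈ E ↔ p k *ᵥ x = x := by
    intro x; simp [E, sub_eq_zero]
  have cE : ∀ a ∈ J, ∀ x ∈ E, p k *ᵥ (T a x) = T a x := fun a ha x hx => by
    have ha := (hJ a).1 ha
    rw [hE] at hx
    rw [hT, mulVec_mulVec, ← hp.tw_comm h5 ha.1.symm hki ha.2.symm, ← mulVec_mulVec, hx]
  have comm : ∀ a ∈ J, ∀ b ∈ J, ∀ x ∈ E, T a (T b x) = T b (T a x) := fun a ha b hb x hx => by
    have ha := (hJ a).1 ha
    have hb := (hJ b).1 hb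
    rw [hE] at hx
    have := congrArg (fun M => M *ᵥ x)
      (hp.rho_rho_comm h5 ha.1.symm hb.1.symm hki ha.2.symm hb.2.symm)
    simp only [← mulVec_mulVec, hx] at this
    exact this
  have sq : ∀ a ∈ J, ∀ x ∈ E, T a (T a x) = x := fun a ha x hx => by
    have ha := (hJ a).1 ha
    rw [hE] at hx
    have := congrArg (fun M => M *ᵥ x) (hp.rho_sq_mul h5 ha.1.symm hki ha.2.symm)
    simp only [← mulVec_mulVec, hx] at this
    exact this
  let W : Submodule ℚ (Fin m → ℚ) := E ⊓ LinearMap.ker (T j + T l)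
  have hW : ∀ x, x ∈ W ↔ x ∈ E ∧ T j x = -T l x := by
    intro x; simp [W, Submodule.mem_inf, add_eq_zero_iff_eq_neg]
  set x' := p k *ᵥ x with hx'
  have hx'E : x' ∈ E := by rw [hE, hx', mulVec_mulVec, hp.idem]
  let z := T j x' - T l x'
  have hzE : z ∈ E := E.sub_mem ((hE _).2 (cE j hjJ x' hx'E)) ((hE _).2 (cE l hlJ x' hx'E))
  have hz0 : z ≠ 0 := sub_ne_zero.2 hx
  have hzW : z ∈ W := by
    rw [hW]
    refine ⟨hzE, ?_⟩
    simp only [z, map_sub]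
    rw [sq j hjJ x' hx'E, sq l hlJ x' hx'E, comm j hjJ l hlJ x' hx'E]
    abel
  obtain ⟨y, hyW, hy0, hy⟩ := exists_joint_eigenvector T W J
    (by
      intro a ha x hx
      rw [hW] at hx ⊢
      refine ⟨(hE _).2 (cE a ha x hx.1), ?_⟩
      rw [comm j hjJ a ha x hx.1, comm l hlJ a ha x hx.1, hx.2, map_neg])
    (fun a ha b hb x hx => comm a ha b hb x ((hW x).1 hx).1)
    (fun a ha x hx => sq a ha x ((hW x).1 hx).1) z hzW hz0
  obtain ⟨hyE, hyjl⟩ := (hW y).1 hyW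
  let S : Finset (Fin n) := J.filter fun a => T a y = -y
  have hpmE : ∀ σ : Equiv.Perm (Fin n), ∀ k : Fin n, ∀ x, p k *ᵥ x = x →
      p (σ k) *ᵥ (Φ (pm σ) *ᵥ x) = Φ (pm σ) *ᵥ x := fun σ k x hx => by
    rw [mulVec_mulVec, ← hp.pm_mul h5, ← mulVec_mulVec, hx]
  have hpm0 : ∀ σ : Equiv.Perm (Fin n), ∀ x, Φ (pm σ) *ᵥ x = 0 → x = 0 := fun σ x hx => by
    have := congrArg (fun w => Φ (pm σ⁻¹) *ᵥ w) hx
    simpa only [mulVec_mulVec, ← map_mul, ← pm_mul, inv_mul_cancel, pm_one,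
      map_one, one_mulVec, mulVec_zero] using this
  have hiJ : i ∉ J := by simp [J]
  have hkJ : k ∉ J := by simp [J]
  obtain ⟨v, hv, hvE⟩ := exists_linearIndependent_of_weight T (fun σ => (Φ (pm σ)).mulVecLin) E
    J S (Finset.filter_subset _ _)
    (fun σ hσ x hx => by
      rw [hE] at hx ⊢
      have := hpmE σ k x hx
      rwa [hσ k hkJ] at this)
    (fun σ _ x _ => hpm0 σ x)
    (fun σ hσ a ha x _ => by
      simp only [T, mulVecLin_apply, mulVec_mulVec]
      have := pm_tw ((hJ a).1 ha).1.symm σ 0 1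
      rw [← map_mul, ← map_mul, this, hσ i hiJ])
    y hyE hy0
    (fun a ha haS => (hy a ha).resolve_right fun h => haS (by simp [S, ha, h]))
    (fun a ha => (Finset.mem_filter.1 ha).2)
  have hJc : J.card = n - 2 := by
    rw [Finset.card_sdiff_of_subset (Finset.subset_univ _), Finset.card_pair hki.symm,
      Finset.card_univ, Fintype.card_fin]
  have hSJ : S ⊂ J := by
    refine Finset.filter_ssubset.2 ?_
    by_contra! hcon
    have e1 := hcon j hjJ
    have e2 := hcon l hlJ
    rw [e1, e2, neg_neg] at hyjl
    exact hy0 (self_eq_neg.1 hyjl.symm)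
  have hS0 : S.Nonempty := by
    rcases hy j hjJ with e | e
    · refine ⟨l, Finset.mem_filter.2 ⟨hlJ, ?_⟩⟩
      rw [← neg_eq_iff_eq_neg, ← hyjl, e]
    · exact ⟨j, by simp only [S, Finset.mem_filter]; exact ⟨hjJ, e⟩⟩
  have hcard : n - 2 ≤ Fintype.card {A // A ∈ J.powersetCard S.card} := by
    rw [Fintype.card_coe, Finset.card_powersetCard, hJc]
    have := Finset.card_lt_card hSJ
    have := hS0.card_pos
    exact le_choose (by omega) (by omega)
  let w : Fin n × {A // A ∈ J.powersetCard S.card} → Fin m → ℚ := fun q =>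
    Φ (pm (Equiv.swap k q.1)) *ᵥ v q.2
  have hw1 : ∀ k' A, p k' *ᵥ (w (k', A)) = w (k', A) := fun k' A => by
    have := hpmE (Equiv.swap k k') k _ ((hE _).1 (hvE A))
    rwa [Equiv.swap_apply_left] at this
  have hw : LinearIndependent ℚ w := by
    refine linearIndependent_of_projections (fun k => (p k).mulVecLin) w hw1 ?_ ?_
    · intro k1 k2 A hk
      rw [mulVecLin_apply, ← hw1 k2 A, mulVec_mulVec, hp.orth k1 k2 hk, zero_mulVec]
    · intro k'
      exact hv.map' (Φ (pm (Equiv.swap k k'))).mulVecLin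
        (LinearMap.ker_eq_bot'.2 fun x hx => hpm0 _ x hx)
  have h8 := card_le_of_linearIndependent w hw
  rw [Fintype.card_prod, Fintype.card_fin] at h8
  have h9 := h.dim_lt
  have h10 := h.six_le
  rw [Nat.choose_two_right] at h9
  have h11 : n * (n - 2) ≤ m := (Nat.mul_le_mul_left n hcard).trans h8
  have h12 : n * (n - 1) ≤ n * (2 * (n - 2)) := Nat.mul_le_mul_left n (by omega)
  have h13 : n * (2 * (n - 2)) = 2 * (n * (n - 2)) := by ring
  omega

theorem rho_mul_of_ne (h : IsSmallRep Φ p) {i j k : Fin n} (hij : i ≠ j) (hki : k ≠ i)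
    (hkj : k ≠ j) : Φ (rho i j) * p k = p k := by
  have h5 := h.five_le
  have hp := h.weight
  obtain ⟨l, -, -, hli, hlj, hlk, -⟩ := exists_two_ne h5 i j k
  have e := congrArg (fun g => Φ g * p k) (rho_mul_rho hij hlj.symm hli.symm)
  simp only [map_mul, mul_assoc] at e
  rw [hp.rho_inv_mul h5 hli.symm hki hlk.symm, ← h.rho_mul_eq_rho_mul hij hli.symm hki hkj hlk.symm,
    hp.rho_sq_mul h5 hij hki hkj, hp.tw_comm h5 hlj.symm hkj hlk.symm, ← mul_assoc] at e
  have e2 := congrArg (fun M => M * Φ (rho j l)⁻¹) e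
  simpa only [mul_assoc, ← map_mul, mul_inv_cancel, map_one, mul_one] using e2

end IsSmallRep
end Small

section Blocks

open Matrix

variable {n m : ℕ}

/-- The group elements fixing the columns of a matrix. -/
def fixer (Φ : MulAut (FG n) →* Matrix (Fin m) (Fin m) ℚ) (X : Matrix (Fin m) (Fin m) ℚ) :
    Subgroup (MulAut (FG n)) where
  carrier := {g | Φ g * X = X}
  one_mem' := by simp
  mul_mem' {g h} hg hh := by
    simp only [Set.mem_ofPred_eq] at *
    rw [map_mul, mul_assoc, hh, hg]
  inv_mem' {g} hg := by
    simp only [Set.mem_ofPred_eq] at *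
    nth_rw 1 [← hg]
    rw [← mul_assoc, ← map_mul, inv_mul_cancel, map_one, one_mul]

theorem mem_fixer {Φ : MulAut (FG n) →* Matrix (Fin m) (Fin m) ℚ}
    {X : Matrix (Fin m) (Fin m) ℚ} {g : MulAut (FG n)} : g ∈ fixer Φ X ↔ Φ g * X = X := Iff.rfl

/-- The projection onto the trivial weight. -/
def zeroProj (p : Fin n → Matrix (Fin m) (Fin m) ℚ) : Matrix (Fin m) (Fin m) ℚ := 1 - ∑ i, p i

/-- The block of a transvection from weight `i` to weight `j`. -/
def upBlock (Φ : MulAut (FG n) →* Matrix (Fin m) (Fin m) ℚ)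
    (p : Fin n → Matrix (Fin m) (Fin m) ℚ) (i j : Fin n) : Matrix (Fin m) (Fin m) ℚ :=
  p j * Φ (rho i j) * p i

/-- The block of a transvection from weight `j` to weight `i`. -/
def downBlock (Φ : MulAut (FG n) →* Matrix (Fin m) (Fin m) ℚ)
    (p : Fin n → Matrix (Fin m) (Fin m) ℚ) (i j : Fin n) : Matrix (Fin m) (Fin m) ℚ :=
  p i * Φ (rho i j) * p j

theorem matrix_eq_zero_of_eq_neg {X : Matrix (Fin m) (Fin m) ℚ} (h : X = -X) : X = 0 := by
  ext i j
  have := congrArg (fun M : Matrix (Fin m) (Fin m) ℚ => M i j) h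
  simp only [Matrix.neg_apply, Matrix.zero_apply] at this ⊢
  linarith

namespace IsSmallRep

variable {Φ : MulAut (FG n) →* Matrix (Fin m) (Fin m) ℚ} {p : Fin n → Matrix (Fin m) (Fin m) ℚ}

theorem inv_mul_cancel_left (Φ : MulAut (FG n) →* Matrix (Fin m) (Fin m) ℚ) (g : MulAut (FG n))
    (X : Matrix (Fin m) (Fin m) ℚ) : Φ g⁻¹ * (Φ g * X) = X := by
  rw [← mul_assoc, ← map_mul, inv_mul_cancel, map_one, one_mul]

theorem mul_inv_cancel_left (Φ : MulAut (FG n) →* Matrix (Fin m) (Fin m) ℚ) (g : MulAut (FG n))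
    (X : Matrix (Fin m) (Fin m) ℚ) : Φ g * (Φ g⁻¹ * X) = X := by
  rw [← mul_assoc, ← map_mul, mul_inv_cancel, map_one, one_mul]

theorem zeroProj_mul (h : IsSmallRep Φ p) (i : Fin n) : zeroProj p * p i = 0 := by
  classical
  rw [zeroProj, sub_mul, one_mul, Finset.sum_mul, Finset.sum_eq_single i]
  · rw [h.weight.idem, sub_self]
  · intro j _ hj; exact h.weight.orth j i hj
  · simp

theorem mul_zeroProj (h : IsSmallRep Φ p) (i : Fin n) : p i * zeroProj p = 0 := by
  classical
  rw [zeroProj, mul_sub, mul_one, Finset.mul_sum, Finset.sum_eq_single i]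
  · rw [h.weight.idem, sub_self]
  · intro j _ hj; exact h.weight.orth i j hj.symm
  · simp

theorem zeroProj_idem (h : IsSmallRep Φ p) : zeroProj p * zeroProj p = zeroProj p := by
  nth_rw 2 [zeroProj]
  rw [mul_sub, mul_one, Finset.mul_sum, Finset.sum_eq_zero fun i _ => h.zeroProj_mul i, sub_zero]

theorem orth_mul (h : IsSmallRep Φ p) {i j : Fin n} (hij : i ≠ j) (X) : p i * (p j * X) = 0 := by
  rw [← mul_assoc, h.weight.orth i j hij, zero_mul]

theorem idem_mul (h : IsSmallRep Φ p) (i : Fin n) (X) : p i * (p i * X) = p i * X := by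
  rw [← mul_assoc, h.weight.idem]

theorem zeroProj_mul_mul (h : IsSmallRep Φ p) (i : Fin n) (X) : zeroProj p * (p i * X) = 0 := by
  rw [← mul_assoc, h.zeroProj_mul, zero_mul]

theorem zeroProj_idem_mul (h : IsSmallRep Φ p) (X) :
    zeroProj p * (zeroProj p * X) = zeroProj p * X := by
  rw [← mul_assoc, h.zeroProj_idem]

theorem eq_sum_blocks {i j : Fin n} (hij : i ≠ j)
    {X : Matrix (Fin m) (Fin m) ℚ} (hX : ∀ k, k ≠ i → k ≠ j → p k * X = 0) :
    X = p i * X + p j * X + zeroProj p * X := by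
  classical
  have h1 : (∑ k, p k) * X = p i * X + p j * X := by
    rw [Finset.sum_mul, ← Finset.add_sum_erase _ _ (Finset.mem_univ i),
      ← Finset.add_sum_erase _ _ (Finset.mem_erase.2 ⟨hij.symm, Finset.mem_univ j⟩),
      Finset.sum_eq_zero, add_zero]
    intro k hk
    simp only [Finset.mem_erase, Finset.mem_univ, and_true] at hk
    exact hX k hk.2 hk.1
  rw [zeroProj, sub_mul, h1, one_mul]; abel

theorem tw_mem_fixer_of_mem {i j : Fin n} (hij : i ≠ j) {X : Matrix (Fin m) (Fin m) ℚ}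
    (h1 : rho i j ∈ fixer Φ X) (h2 : lam i j ∈ fixer Φ X) (s t : ℤ) : tw i j s t ∈ fixer Φ X := by
  rw [tw_eq_lam_zpow_mul_rho_zpow hij]
  exact mul_mem (zpow_mem h2 s) (zpow_mem h1 t)

theorem tw_mul_of_ne (h : IsSmallRep Φ p) {i j k : Fin n} (hij : i ≠ j) (hki : k ≠ i)
    (hkj : k ≠ j) {X : Matrix (Fin m) (Fin m) ℚ} (hX : p k * X = X) (s t : ℤ) :
    Φ (tw i j s t) * X = X := by
  have h1 : Φ (tw i j s t) * p k = p k := tw_mem_fixer_of_mem hij (h.rho_mul_of_ne hij hki hkj)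
    ((h.weight.lam_mul h.five_le hij hki hkj).trans (h.rho_mul_of_ne hij hki hkj)) s t
  rw [← hX, ← mul_assoc, h1]

theorem transpose_dual (g : MulAut (FG n)) : (dualRep Φ g)ᵀ = Φ g⁻¹ := by
  rw [dualRep_apply, transpose_transpose]

theorem mul_tw_of_ne (h : IsSmallRep Φ p) {i j k : Fin n} (hij : i ≠ j) (hki : k ≠ i)
    (hkj : k ≠ j) (s t : ℤ) : p k * Φ (tw i j s t) = p k := by
  rw [← h.weight.tw_comm h.five_le hij hki hkj]
  exact h.tw_mul_of_ne hij hki hkj (h.weight.idem k) s t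

theorem mul_tw_mul_of_ne (h : IsSmallRep Φ p) {i j k : Fin n} (hij : i ≠ j) (hki : k ≠ i)
    (hkj : k ≠ j) (s t : ℤ) (X) : p k * (Φ (tw i j s t) * X) = p k * X := by
  rw [← mul_assoc, h.mul_tw_of_ne hij hki hkj]

theorem pc_mul_left (h : IsSmallRep Φ p) {i j : Fin n} (hij : i ≠ j) :
    Φ (pc i j) * p i = p i := by
  classical
  let L := (Finset.univ \ {i, j} : Finset (Fin n)).toList
  have hL : ∀ k, k ∈ L ↔ k ≠ i ∧ k ≠ j := by simp [L]
  have h1 := prod_pc_eq_conj (j := j) (L ++ [i]) (by simp [hL, hij.symm])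
    (List.nodup_append.2 ⟨Finset.nodup_toList _, by simp, by
      intro a ha b hb; rw [List.mem_singleton.1 hb]; exact ((hL a).1 ha).1⟩)
    (fun k hk => by by_cases hki : k = i <;> simp [hL, hki, hk])
  rw [List.map_append, List.prod_append, List.map_singleton, List.prod_singleton] at h1
  have h2 : (L.map fun k => pc k j).prod ∈ fixer Φ (p i) := by
    refine Subgroup.list_prod_mem _ fun g hg => ?_
    obtain ⟨k, hk, rfl⟩ := List.mem_map.1 hg
    have hk := (hL k).1 hk
    exact h.tw_mul_of_ne hk.2 hk.1.symm hij (h.weight.idem i) _ _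
  have h3 : pc i j = (L.map fun k => pc k j).prod⁻¹ * MulAut.conj (FreeGroup.of j)⁻¹ := by
    rw [← h1]; group
  have h4 : pc i j ∈ fixer Φ (p i) := by
    rw [h3]
    refine mul_mem (inv_mem h2) ?_
    rw [mem_fixer, h.inner, one_mul]
  exact h4

theorem lam_mul_left (h : IsSmallRep Φ p) {i j : Fin n} (hij : i ≠ j) :
    Φ (lam i j) * p i = Φ (rho i j) * p i := by
  have h1 : rho i j = lam i j * pc i j := by rw [tw_mul hij]; norm_num
  rw [h1, map_mul, mul_assoc, h.pc_mul_left hij]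

theorem eps_mul_zeroProj (h : IsSmallRep Φ p) {i j : Fin n} (hij : i ≠ j) :
    Φ (eps i) * (Φ (eps j) * zeroProj p) = zeroProj p := by
  rw [← mul_assoc]; exact h.weight.zero i j hij

theorem zeroProj_mul_eps (h : IsSmallRep Φ p) {i j : Fin n} (hij : i ≠ j) (X) :
    zeroProj p * (Φ (eps i) * (Φ (eps j) * X)) = zeroProj p * X := by
  have hc : ∀ i, zeroProj p * Φ (eps i) = Φ (eps i) * zeroProj p := fun i => by
    rw [zeroProj, sub_mul, mul_sub, Finset.sum_mul, Finset.mul_sum, one_mul, mul_one]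
    simp only [h.weight.comm]
  rw [← mul_assoc, hc, mul_assoc, ← mul_assoc (zeroProj p), hc, mul_assoc, ← mul_assoc,
    ← mul_assoc, mul_assoc (Φ (eps i)), h.eps_mul_zeroProj hij]

theorem eps_mul_fix (h : IsSmallRep Φ p) {i j k : Fin n} (hi : i ≠ k) (hj : j ≠ k) :
    Φ (eps i) * (Φ (eps j) * p k) = p k := by
  rw [← mul_assoc]; exact h.weight.fix k i j hi hj

theorem eps_mul_neg_left (h : IsSmallRep Φ p) {i j : Fin n} (hij : i ≠ j) :
    Φ (eps i) * (Φ (eps j) * p i) = -p i := by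
  rw [← mul_assoc]; exact h.weight.neg i j hij.symm

theorem eps_mul_neg_right (h : IsSmallRep Φ p) {i j : Fin n} (hij : i ≠ j) :
    Φ (eps i) * (Φ (eps j) * p j) = -p j := by
  rw [← h.eps_mul_neg_left hij.symm, ← mul_assoc, ← mul_assoc, ← map_mul, ← map_mul, eps_comm]

theorem mul_eps (h : IsSmallRep Φ p) (i j k : Fin n) (X) :
    p k * (Φ (eps i) * (Φ (eps j) * X)) = Φ (eps i) * (Φ (eps j) * p k) * X := by
  have hc := h.weight.comm
  rw [← mul_assoc, ← hc, mul_assoc, ← mul_assoc (p k), ← hc]; simp only [mul_assoc]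

theorem zeroProj_rho_mul_left (h : IsSmallRep Φ p) {i j : Fin n} (hij : i ≠ j) :
    zeroProj p * (Φ (rho i j) * p i) = 0 := by
  have h1 := congrArg (fun g => zeroProj p * (Φ g * p i)) (eps_eps_rho hij)
  simp only [map_mul, mul_assoc] at h1
  rw [h.zeroProj_mul_eps hij, h.eps_mul_neg_left hij, mul_neg, h.lam_mul_left hij, mul_neg] at h1
  exact matrix_eq_zero_of_eq_neg h1

theorem rho_mul_left_aux (h : IsSmallRep Φ p) {i j : Fin n} (hij : i ≠ j) :
    Φ (rho i j) * p i = p i * (Φ (rho i j) * p i) + upBlock Φ p i j := by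
  have h1 := eq_sum_blocks (p := p) hij (X := Φ (rho i j) * p i) fun k hki hkj => by
    rw [h.mul_tw_mul_of_ne hij hki hkj, h.weight.orth k i hki]
  rw [h.zeroProj_rho_mul_left hij, add_zero] at h1
  rw [upBlock, mul_assoc]; exact h1

theorem rho_inv_eq (Φ : MulAut (FG n) →* Matrix (Fin m) (Fin m) ℚ) {i j l : Fin n} (hij : i ≠ j)
    (hli : l ≠ i) (hlj : l ≠ j) (X) : Φ (rho i j)⁻¹ * X =
      Φ (eps j) * (Φ (eps l) * (Φ (rho i j) * (Φ (eps l) * (Φ (eps j) * X)))) := by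
  have h1 : (rho i j)⁻¹ = eps j * (eps l * (rho i j * (eps l * eps j))) := by
    have := eps_eps_rho_right hij hli hlj
    calc (rho i j)⁻¹ = (rho i j)⁻¹ * (eps j * eps l) * (eps l * eps j) := by
          simp only [mul_assoc, ← mul_assoc (eps l) (eps l), eps_mul_self, one_mul, mul_one]
      _ = _ := by rw [← this]; simp only [mul_assoc]
  rw [h1]; simp only [map_mul, mul_assoc]

theorem rho_inv_mul_left_aux (h : IsSmallRep Φ p) {i j : Fin n} (hij : i ≠ j) :
    Φ (rho i j)⁻¹ * p i = p i * (Φ (rho i j) * p i) - upBlock Φ p i j := by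
  obtain ⟨l, -, -, hli, hlj, -⟩ := exists_two_ne h.five_le i j j
  rw [rho_inv_eq Φ hij hli hlj, h.eps_mul_fix hli hij.symm]
  conv_lhs => rw [h.rho_mul_left_aux hij]
  rw [mul_add, mul_add, upBlock, mul_assoc, sub_eq_add_neg]
  congr 1
  · have h2 : Φ (eps j) * (Φ (eps l) * p i) * (Φ (rho i j) * p i) = p i * (Φ (rho i j) * p i) := by
      rw [h.eps_mul_fix hij.symm hli]
    simpa only [mul_assoc] using h2
  · have h2 : Φ (eps j) * (Φ (eps l) * p j) * (Φ (rho i j) * p i) =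
        -(p j * (Φ (rho i j) * p i)) := by
      rw [h.eps_mul_neg_left hlj.symm, neg_mul]
    simpa only [mul_assoc] using h2

theorem mul_upBlock (h : IsSmallRep Φ p) (i j : Fin n) :
    p j * upBlock Φ p i j = upBlock Φ p i j := by
  rw [upBlock, ← mul_assoc, ← mul_assoc, h.weight.idem]

theorem upBlock_mul (h : IsSmallRep Φ p) (i j : Fin n) :
    upBlock Φ p i j * p i = upBlock Φ p i j := by
  rw [upBlock, mul_assoc, h.weight.idem]

theorem mul_upBlock_of_ne (h : IsSmallRep Φ p) {i j k : Fin n} (hkj : k ≠ j) (X) :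
    p k * (upBlock Φ p i j * X) = 0 := by
  rw [← h.mul_upBlock, mul_assoc, h.orth_mul hkj]

theorem mul_upBlock_mul (h : IsSmallRep Φ p) {i j : Fin n} (X) :
    p j * (upBlock Φ p i j * X) = upBlock Φ p i j * X := by
  rw [← mul_assoc, h.mul_upBlock]

/-- A transvection with the same target acts trivially on the image of an upper block. -/
theorem tw_mul_upBlock_of_ne (h : IsSmallRep Φ p) {i j k : Fin n} (hij : i ≠ j) (hkj : k ≠ j)
    (hki : k ≠ i) (s t : ℤ) : Φ (tw k j s t) * upBlock Φ p i j = upBlock Φ p i j := by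
  have h1 := congrArg (fun g => Φ g * p i) (_root_.tw_comm hkj hij hki hkj hij s t 0 1)
  simp only [map_mul, mul_assoc] at h1
  rw [h.tw_mul_of_ne hkj hki.symm hij (h.weight.idem i), h.rho_mul_left_aux hij, mul_add,
    h.tw_mul_of_ne hkj hki.symm hij (h.idem_mul i _)] at h1
  exact add_left_cancel h1

theorem rho_relation_left (h : IsSmallRep Φ p) {i j k : Fin n} (hij : i ≠ j) (hjk : j ≠ k)
    (hik : i ≠ k) : p i * (Φ (rho i j) * p i) = p i * (Φ (rho i j) * (p i * (Φ (rho i k) * p i))) ∧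
      upBlock Φ p j k * (upBlock Φ p i j * (p i * (Φ (rho i k) * p i))) = upBlock Φ p i k := by
  have h1 := congrArg (fun g => Φ g * p i) (rho_mul_rho hij hjk hik)
  simp only [map_mul, mul_assoc] at h1
  set P := p i * (Φ (rho i k) * p i) with hP
  have hPi : p i * P = P := h.idem_mul i _
  have h2 : Φ (rho i j) * P = p i * (Φ (rho i j) * P) + upBlock Φ p i j * P := by
    have := congrArg (fun M => M * P) (h.rho_mul_left_aux hij)
    simpa only [add_mul, mul_assoc, hPi] using this
  have h3 : ∀ X, Φ (rho j k) * (upBlock Φ p i j * X) =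
      p j * (Φ (rho j k) * (upBlock Φ p i j * X)) + upBlock Φ p j k * (upBlock Φ p i j * X) := by
    intro X
    have := congrArg (fun M => M * (upBlock Φ p i j * X)) (h.rho_mul_left_aux hjk)
    simpa only [add_mul, mul_assoc, h.mul_upBlock_mul] using this
  rw [h.tw_mul_of_ne hjk hij hik (h.weight.idem i), h.rho_inv_mul_left_aux hik, ← hP, mul_sub,
    h.tw_mul_of_ne hij hik.symm hjk.symm (h.mul_upBlock i k), mul_sub,
    h.tw_mul_upBlock_of_ne hik hjk hij.symm, h.rho_mul_left_aux hij, h2, mul_add,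
    h.tw_mul_of_ne hjk hij hik (h.idem_mul i _), h3] at h1
  constructor
  · have h4 := congrArg (fun M => p i * M) h1
    simp only [mul_add, mul_sub, h.idem_mul, h.orth_mul hij, h.mul_upBlock_of_ne hik] at h4
    rw [← mul_one (upBlock Φ p i j), h.mul_upBlock_of_ne hij, ← mul_one (upBlock Φ p i k),
      h.mul_upBlock_of_ne hik] at h4
    simpa using h4
  · have h4 := congrArg (fun M => p k * M) h1
    simp only [mul_add, mul_sub, h.orth_mul hik.symm, h.orth_mul hjk.symm, h.mul_upBlock_mul,
      h.mul_upBlock] at h4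
    rw [← mul_one (upBlock Φ p i j), h.mul_upBlock_of_ne hjk.symm] at h4
    simp only [mul_one] at h4
    rw [zero_add, zero_add, zero_add, eq_comm, sub_eq_zero] at h4
    exact h4

theorem rho_mul_upBlock_self (h : IsSmallRep Φ p) {i j : Fin n} (hij : i ≠ j) (s t : ℤ) :
    Φ (tw i j s t) * upBlock Φ p i j = upBlock Φ p i j := by
  obtain ⟨k, -, -, hki, hkj, -⟩ := exists_two_ne h.five_le i j j
  rw [← (h.rho_relation_left hki.symm hkj hij).2, ← mul_assoc,
    h.tw_mul_upBlock_of_ne hkj hij hki.symm]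

theorem tw_mul_upBlock (h : IsSmallRep Φ p) {i j k : Fin n} (hij : i ≠ j) (hkj : k ≠ j)
    (s t : ℤ) (X) : Φ (tw k j s t) * (upBlock Φ p i j * X) = upBlock Φ p i j * X := by
  rw [← mul_assoc]
  by_cases hki : k = i
  · subst hki; rw [h.rho_mul_upBlock_self hij]
  · rw [h.tw_mul_upBlock_of_ne hij hkj hki]

theorem mul_rho_mul_left (h : IsSmallRep Φ p) {i j : Fin n} (hij : i ≠ j) :
    p i * (Φ (rho i j) * p i) = p i := by
  have sq : ∀ k, i ≠ k → p i * (Φ (rho i k) * (p i * (Φ (rho i k) * p i))) = p i := by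
    intro j hij
    have h1 := mul_inv_cancel_left Φ (rho i j) (p i)
    rw [h.rho_inv_mul_left_aux hij, mul_sub, ← mul_one (upBlock Φ p i j),
      h.tw_mul_upBlock hij hij] at h1
    have := congrArg (fun M => p i * M) h1
    simpa only [mul_sub, h.mul_upBlock_of_ne hij, sub_zero, h.weight.idem] using this
  obtain ⟨k, -, -, hki, hkj, -⟩ := exists_two_ne h.five_le i j j
  have h1 := (h.rho_relation_left hki.symm hkj hij).1
  have h2 := congrArg (fun M => p i * (Φ (rho i k) * M)) h1
  simp only [sq k hki.symm] at h2
  have h3 := congrArg (fun M => M * (Φ (rho i j) * p i)) (sq k hki.symm)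
  simp only [mul_assoc] at h3
  rw [← h3, ← h2]

theorem rho_mul_left (h : IsSmallRep Φ p) {i j : Fin n} (hij : i ≠ j) :
    Φ (rho i j) * p i = p i + upBlock Φ p i j := by
  rw [h.rho_mul_left_aux hij, h.mul_rho_mul_left hij]

theorem upBlock_mul_upBlock (h : IsSmallRep Φ p) {i j k : Fin n} (hij : i ≠ j) (hjk : j ≠ k)
    (hik : i ≠ k) : upBlock Φ p j k * upBlock Φ p i j = upBlock Φ p i k := by
  have := (h.rho_relation_left hij hjk hik).2
  rwa [h.mul_rho_mul_left hik, h.upBlock_mul] at this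

end IsSmallRep
end Blocks

section Blocks

open Matrix

variable {n m : ℕ}

namespace IsSmallRep

variable {Φ : MulAut (FG n) →* Matrix (Fin m) (Fin m) ℚ} {p : Fin n → Matrix (Fin m) (Fin m) ℚ}

theorem mul_rho_inv_mul (h : IsSmallRep Φ p) {i j : Fin n} (hij : i ≠ j) :
    p i * (Φ (rho i j)⁻¹ * p j) = -downBlock Φ p i j := by
  obtain ⟨l, -, -, hli, hlj, -⟩ := exists_two_ne h.five_le i j j
  rw [rho_inv_eq Φ hij hli hlj, h.eps_mul_neg_right hlj, h.mul_eps, h.eps_mul_fix hij.symm hli,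
    mul_neg, mul_neg, downBlock, mul_assoc]

theorem upBlock_dual (h : IsSmallRep Φ p) {i j : Fin n} (hij : i ≠ j) :
    upBlock (dualRep Φ) (fun i => (p i)ᵀ) i j = -(downBlock Φ p i j)ᵀ := by
  rw [upBlock, dualRep_apply, ← transpose_mul, ← transpose_mul, h.mul_rho_inv_mul hij,
    transpose_neg]

theorem zeroProj_dual : zeroProj (fun i => (p i)ᵀ) = (zeroProj p)ᵀ := by
  rw [zeroProj, zeroProj, transpose_sub, transpose_one, transpose_sum]

theorem downBlock_mul_tw (h : IsSmallRep Φ p) {i j k : Fin n} (hij : i ≠ j) (hkj : k ≠ j)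
    (s t : ℤ) (X) : downBlock Φ p i j * (Φ (tw k j s t) * X) = downBlock Φ p i j * X := by
  have h1 := congrArg transpose (h.dual.tw_mul_upBlock hij hkj (-s) (-t) 1)
  rw [mul_one, transpose_mul, transpose_dual, h.upBlock_dual hij, transpose_neg,
    transpose_transpose, tw_inv hkj, neg_neg, neg_neg, neg_mul, neg_inj] at h1
  rw [← mul_assoc, h1]

theorem downBlock_mul_downBlock (h : IsSmallRep Φ p) {i j k : Fin n} (hij : i ≠ j) (hjk : j ≠ k)
    (hik : i ≠ k) : downBlock Φ p i j * downBlock Φ p j k = -downBlock Φ p i k := by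
  have h1 := congrArg transpose (h.dual.upBlock_mul_upBlock hij hjk hik)
  rw [transpose_mul, h.upBlock_dual hij, h.upBlock_dual hjk, h.upBlock_dual hik] at h1
  simpa only [transpose_neg, transpose_transpose, neg_mul_neg] using h1

theorem mul_downBlock (h : IsSmallRep Φ p) (i j : Fin n) :
    p i * downBlock Φ p i j = downBlock Φ p i j := by
  rw [downBlock, ← mul_assoc, ← mul_assoc, h.weight.idem]

theorem downBlock_mul (h : IsSmallRep Φ p) (i j : Fin n) :
    downBlock Φ p i j * p j = downBlock Φ p i j := by
  rw [downBlock, mul_assoc, h.weight.idem]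

theorem downBlock_mul_of_ne (h : IsSmallRep Φ p) {i j k : Fin n} (hkj : k ≠ j)
    {X : Matrix (Fin m) (Fin m) ℚ} (hX : p k * X = X) : downBlock Φ p i j * X = 0 := by
  rw [← hX, ← h.downBlock_mul, mul_assoc, h.orth_mul hkj.symm, mul_zero]

theorem mul_rho (h : IsSmallRep Φ p) {i j : Fin n} (hij : i ≠ j) (X) :
    p i * (Φ (rho i j) * X) = p i * X + downBlock Φ p i j * X := by
  have h1 := congrArg transpose (h.dual.rho_mul_left hij)
  rw [transpose_mul, transpose_dual, h.upBlock_dual hij, transpose_add, transpose_neg,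
    transpose_transpose, transpose_transpose] at h1
  have h2 := congrArg (fun M => M * (Φ (rho i j) * X)) h1
  simp only [mul_assoc, inv_mul_cancel_left, add_mul, neg_mul, h.downBlock_mul_tw hij hij] at h2
  rw [h2]; abel

theorem mul_rho_inv (h : IsSmallRep Φ p) {i j : Fin n} (hij : i ≠ j) (X) :
    p i * (Φ (rho i j)⁻¹ * X) = p i * X - downBlock Φ p i j * X := by
  have h1 := h.mul_rho hij (Φ (rho i j)⁻¹ * X)
  rw [mul_inv_cancel_left] at h1
  have h2 := h.downBlock_mul_tw hij hij 0 1 (Φ (rho i j)⁻¹ * X)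
  rw [mul_inv_cancel_left] at h2
  rw [h1, h2]; abel

theorem lam_inv_mul_eq (h : IsSmallRep Φ p) {i j l : Fin n} (hij : i ≠ j) (hli : l ≠ i)
    (hlj : l ≠ j) (X) : Φ (lam i j)⁻¹ * X =
      Φ (eps i) * (Φ (eps l) * (Φ (rho i j) * (Φ (eps l) * (Φ (eps i) * X)))) := by
  have h1 : (lam i j)⁻¹ = eps i * (eps l * (rho i j * (eps l * eps i))) := by
    rw [← mul_assoc (rho i j), ← eps_tw_of_ne hij hli hlj, mul_assoc, ← mul_assoc (eps l),
      eps_mul_self, one_mul, ← mul_assoc, eps_tw_left hij, mul_assoc, eps_mul_self, mul_one,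
      tw_inv hij]
  rw [h1]; simp only [map_mul, mul_assoc]

theorem lam_inv_mul_left (h : IsSmallRep Φ p) {i j : Fin n} (hij : i ≠ j) :
    Φ (lam i j)⁻¹ * p i = p i - upBlock Φ p i j := by
  have h1 := inv_mul_cancel_left Φ (lam i j) (p i)
  have h2 : Φ (lam i j)⁻¹ * upBlock Φ p i j = upBlock Φ p i j := by
    have := h.tw_mul_upBlock hij hij (-1) 0 1
    rw [tw_inv hij]; simpa using this
  rw [h.lam_mul_left hij, h.rho_mul_left hij, mul_add, h2] at h1
  rw [← h1]; abel_nf; rw [h1]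

theorem mul_lam_inv (h : IsSmallRep Φ p) {i j : Fin n} (hij : i ≠ j) (X) :
    p i * (Φ (lam i j)⁻¹ * X) = p i * X - downBlock Φ p i j * X := by
  have h1 := congrArg transpose (h.dual.lam_mul_left hij)
  rw [transpose_mul, transpose_mul, transpose_dual, transpose_dual, transpose_transpose] at h1
  rw [← mul_assoc, h1, mul_assoc, h.mul_rho_inv hij]

theorem wt_mul_left (h : IsSmallRep Φ p) {i k : Fin n} (hik : i ≠ k) (j : Fin n) :
    p (Equiv.swap k i j) * Φ (wt k i) = Φ (wt k i) * p j := by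
  have h1 : wt k i = eps k * pm (Equiv.swap k i) := by
    rw [pm_swap_eq hik.symm, ← mul_assoc, eps_mul_self, one_mul]
  rw [h1, map_mul, mul_assoc, h.weight.pm_mul h.five_le, ← mul_assoc, ← h.weight.comm, mul_assoc]

theorem rho_mul_wt {i k : Fin n} (hik : i ≠ k) : rho k i * wt k i = wt k i * (lam i k)⁻¹ := by
  rw [tw_inv hik]
  refine mulAut_ext fun x => ?_
  simp only [MulAut.mul_apply]
  by_cases hxk : x = k
  · subst hxk; simp [wt_left hik.symm, tw_ne _ _ _ hik, tw_ne _ _ _ hik.symm]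
  · by_cases hxi : x = i
    · subst hxi
      simp [wt_right hik.symm, wt_left hik.symm, tw_same hik, tw_same hik.symm]
    · simp [wt_ne hxk hxi, tw_ne _ _ _ hxk, tw_ne _ _ _ hxi]

/-- The diagonal block on vectors killed by the lower blocks. -/
theorem mul_rho_of_downBlock_eq_zero (h : IsSmallRep Φ p) {i k : Fin n} (hik : i ≠ k)
    {X : Matrix (Fin m) (Fin m) ℚ} (hX : p k * X = X) (hR : downBlock Φ p i k * X = 0) :
    p k * (Φ (rho i k) * X) = upBlock Φ p i k * (upBlock Φ p k i * X) := by
  obtain ⟨l, -, -, hli, hlk, -⟩ := exists_two_ne h.five_le i k k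
  have hiX : p i * X = 0 := by rw [← hX, h.orth_mul hik]
  have e1 : p k * (Φ (lam i k)⁻¹ * X) = p k * (Φ (rho i k) * X) := by
    rw [h.lam_inv_mul_eq hik hli hlk, h.mul_eps, h.eps_mul_fix hik hlk]
    nth_rw 1 [← hX]
    have := congrArg (fun M => M * X) (h.eps_mul_fix hlk hik)
    simp only [mul_assoc] at this
    rw [this, hX]
  have e2 : Φ (lam i k)⁻¹ * (Φ (rho k i) * X) =
      Φ (lam i k)⁻¹ * X + (upBlock Φ p k i * X - upBlock Φ p i k * (upBlock Φ p k i * X)) := by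
    have a1 := congrArg (fun M => M * X) (h.rho_mul_left hik.symm)
    simp only [mul_assoc, add_mul, hX] at a1
    have a2 := congrArg (fun M => M * (upBlock Φ p k i * X)) (h.lam_inv_mul_left hik)
    simp only [mul_assoc, sub_mul, h.mul_upBlock_mul] at a2
    rw [a1, mul_add, a2]
  have e3 : Φ (lam i k)⁻¹ * (Φ (rho k i) * X) = Φ (lam k i)⁻¹ * (Φ (wt k i) * X) := by
    rw [wt, map_mul, map_mul, mul_assoc, mul_assoc, inv_mul_cancel_left, tw_inv hik]; simp
  have e4 : p k * (Φ (lam k i)⁻¹ * (Φ (wt k i) * X)) = 0 := by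
    have a1 : p k * (Φ (wt k i) * X) = 0 := by
      have := congrArg (fun M => M * X) (h.wt_mul_left hik i)
      simp only [mul_assoc, Equiv.swap_apply_right, hiX, mul_zero] at this
      exact this
    have a2 := h.mul_rho hik.symm (Φ (wt k i) * X)
    rw [← mul_assoc (Φ (rho k i)), ← map_mul, rho_mul_wt hik, a1, zero_add, map_mul, mul_assoc,
      ← mul_assoc (p k)] at a2
    have a3 := h.wt_mul_left hik i
    rw [Equiv.swap_apply_right] at a3
    rw [a3, mul_assoc, h.mul_lam_inv hik, hiX, hR, sub_zero, mul_zero] at a2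
    rw [h.mul_lam_inv hik.symm, a1, ← a2, sub_zero]
  rw [← e3, e2, mul_add, mul_sub, e1, h.mul_upBlock_mul, h.mul_upBlock_of_ne hik.symm] at e4
  rw [zero_sub, add_neg_eq_zero] at e4
  exact e4

theorem matrix_two_cancel {X Y : Matrix (Fin m) (Fin m) ℚ} (h : X + X = Y + Y) : X = Y := by
  ext i j
  have := congrArg (fun M : Matrix (Fin m) (Fin m) ℚ => M i j) h
  simp only [Matrix.add_apply] at this
  linarith

theorem rho_add_rho_inv (h : IsSmallRep Φ p) {i k : Fin n} (hik : i ≠ k)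
    {X : Matrix (Fin m) (Fin m) ℚ} (hX : p k * X = X) (hR : downBlock Φ p i k * X = 0) :
    Φ (rho i k) * X =
        upBlock Φ p i k * (upBlock Φ p k i * X) + zeroProj p * (Φ (rho i k) * X) ∧
      Φ (rho i k)⁻¹ * X =
        upBlock Φ p i k * (upBlock Φ p k i * X) - zeroProj p * (Φ (rho i k) * X) := by
  obtain ⟨l, -, -, hli, hlk, -⟩ := exists_two_ne h.five_le i k k
  have hiX : p i * X = 0 := by rw [← hX, h.orth_mul hik]
  have e1 : Φ (rho i k) * X = upBlock Φ p i k * (upBlock Φ p k i * X) +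
      zeroProj p * (Φ (rho i k) * X) := by
    have := eq_sum_blocks (p := p) hik (X := Φ (rho i k) * X) fun a hai hak => by
      rw [h.mul_tw_mul_of_ne hik hai hak, ← hX, h.orth_mul hak]
    rwa [h.mul_rho_of_downBlock_eq_zero hik hX hR, h.mul_rho hik, hiX, hR, zero_add, zero_add]
      at this
  refine ⟨e1, ?_⟩
  have e2 : ∀ Y, p k * Y = Y → Φ (eps k) * (Φ (eps l) * Y) = -Y := fun Y hY => by
    have := congrArg (fun M => M * Y) (h.eps_mul_neg_left hlk.symm)
    simpa only [mul_assoc, hY, neg_mul] using this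
  have e3 : Φ (eps l) * (Φ (eps k) * X) = -X := by
    have := congrArg (fun M => M * X) (h.eps_mul_neg_right hlk)
    simpa only [mul_assoc, hX, neg_mul] using this
  have e4 : ∀ Y, Φ (eps k) * (Φ (eps l) * (zeroProj p * Y)) = zeroProj p * Y := fun Y => by
    have := congrArg (fun M => M * Y) (h.eps_mul_zeroProj hlk.symm)
    simpa only [mul_assoc] using this
  rw [rho_inv_eq Φ hik hli hlk, e3, mul_neg, mul_neg, mul_neg]
  conv_lhs => rw [e1]
  rw [mul_add, mul_add, e4, e2 _ (h.mul_upBlock_mul _)]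
  abel

/-- Vectors of weight `k` killed by all lower blocks are fixed by the transvections with
target `k`. -/
theorem tw_mul_of_downBlock_eq_zero (h : IsSmallRep Φ p) {k : Fin n}
    {X : Matrix (Fin m) (Fin m) ℚ} (hX : p k * X = X)
    (hR : ∀ i, i ≠ k → downBlock Φ p i k * X = 0) {i : Fin n} (hik : i ≠ k) :
    (∀ s t, Φ (tw i k s t) * X = X) ∧ upBlock Φ p i k * (upBlock Φ p k i * X) = X := by
  have sq : ∀ i, i ≠ k → Φ (rho i k) * (Φ (rho i k) * X) =
      upBlock Φ p i k * (upBlock Φ p k i * X) + upBlock Φ p i k * (upBlock Φ p k i * X) - X := by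
    intro i hik
    obtain ⟨e1, e2⟩ := h.rho_add_rho_inv hik hX (hR i hik)
    have e3 : Φ (rho i k) * X = upBlock Φ p i k * (upBlock Φ p k i * X) +
        upBlock Φ p i k * (upBlock Φ p k i * X) - Φ (rho i k)⁻¹ * X := by
      rw [e2]; conv_lhs => rw [e1]
      abel
    conv_lhs => rw [e3]
    rw [mul_sub, mul_add, h.tw_mul_upBlock hik hik, mul_inv_cancel_left]
  have rel : ∀ i j, i ≠ k → j ≠ k → i ≠ j →
      upBlock Φ p j k * (upBlock Φ p k j * X) + upBlock Φ p j k * (upBlock Φ p k j * X) - X =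
      upBlock Φ p i k * (upBlock Φ p k i * X) + upBlock Φ p i k * (upBlock Φ p k i * X) -
      (upBlock Φ p j k * (upBlock Φ p k j * X) + upBlock Φ p j k * (upBlock Φ p k j * X) - X) := by
    intro i j hik hjk hij
    have r1 : rho j k * rho i j = rho i j * rho j k * rho i k := by
      rw [rho_mul_rho hij hjk hik]; group
    have r2 : rho j k * rho j k * rho i j = rho i j * (rho j k * (rho j k * (rho i k * rho i k))) := by
      rw [mul_assoc, r1, ← mul_assoc, ← mul_assoc, r1]
      simp only [mul_assoc]
      rw [← mul_assoc (rho i k) (rho j k), _root_.tw_comm hik hjk hij hik hjk]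
      simp only [mul_assoc]
    have r3 := congrArg (fun g => Φ g * X) r2
    simp only [map_mul, mul_assoc] at r3
    rw [h.tw_mul_of_ne hij hik.symm hjk.symm hX, sq i hik, mul_sub, mul_add,
      h.tw_mul_upBlock hik hjk, mul_sub (Φ (rho j k)), mul_add, h.tw_mul_upBlock hik hjk, sq j hjk,
      h.tw_mul_of_ne hij hik.symm hjk.symm] at r3
    · exact r3
    · simp only [mul_sub, mul_add, h.mul_upBlock_mul, hX]
  have one : ∀ i, i ≠ k → upBlock Φ p i k * (upBlock Φ p k i * X) = X := by
    intro i hik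
    obtain ⟨j, -, -, hji, hjk, -⟩ := exists_two_ne h.five_le i k k
    have a1 := rel i j hik hjk hji.symm
    have a2 := rel j i hjk hik hji
    generalize upBlock Φ p i k * (upBlock Φ p k i * X) = Yi at a1 a2 ⊢
    generalize upBlock Φ p j k * (upBlock Φ p k j * X) = Yj at a1 a2
    ext a b
    have b1 := congrArg (fun M : Matrix (Fin m) (Fin m) ℚ => M a b) a1
    have b2 := congrArg (fun M : Matrix (Fin m) (Fin m) ℚ => M a b) a2
    simp only [Matrix.add_apply, Matrix.sub_apply] at b1 b2
    linarith
  refine ⟨?_, one i hik⟩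
  obtain ⟨e1, e2⟩ := h.rho_add_rho_inv hik hX (hR i hik)
  have e3 := sq i hik
  rw [one i hik] at e1 e2 e3
  have e4 := congrArg (fun M => Φ (rho i k)⁻¹ * M) e3
  simp only [inv_mul_cancel_left, mul_sub, mul_add] at e4
  have e5 : Φ (rho i k) * X = X := by
    refine matrix_two_cancel ?_
    have : Φ (rho i k) * X = Φ (rho i k)⁻¹ * X := by rw [e4]; abel
    calc Φ (rho i k) * X + Φ (rho i k) * X = Φ (rho i k) * X + Φ (rho i k)⁻¹ * X := by rw [← this]
      _ = X + X := by rw [e2]; conv_lhs => { lhs; rw [e1] }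
                      abel
  have e6 : Φ (lam i k)⁻¹ * X = X := by
    obtain ⟨l, -, -, hli, hlk, -⟩ := exists_two_ne h.five_le i k k
    have a1 := congrArg (fun M => M * X) (h.eps_mul_fix hlk hik)
    have a2 := congrArg (fun M => M * X) (h.eps_mul_fix hik hlk)
    simp only [mul_assoc, hX] at a1 a2
    rw [h.lam_inv_mul_eq hik hli hlk, a1, e5, a2]
  intro s t
  exact tw_mem_fixer_of_mem hik e5 (by have := inv_mem (mem_fixer.2 e6); rwa [inv_inv] at this) s t

end IsSmallRep
end Blocks

section ZeroBlocks

open Matrix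

variable {n m : ℕ}

/-- The block of a transvection from the trivial weight to weight `j`. -/
def cBlock (Φ : MulAut (FG n) →* Matrix (Fin m) (Fin m) ℚ)
    (p : Fin n → Matrix (Fin m) (Fin m) ℚ) (i j : Fin n) : Matrix (Fin m) (Fin m) ℚ :=
  p j * (Φ (rho i j) * zeroProj p)

/-- The block of a transvection on the trivial weight. -/
def aBlock (Φ : MulAut (FG n) →* Matrix (Fin m) (Fin m) ℚ)
    (p : Fin n → Matrix (Fin m) (Fin m) ℚ) (i j : Fin n) : Matrix (Fin m) (Fin m) ℚ :=
  zeroProj p * (Φ (rho i j) * zeroProj p)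

namespace IsSmallRep

variable {Φ : MulAut (FG n) →* Matrix (Fin m) (Fin m) ℚ} {p : Fin n → Matrix (Fin m) (Fin m) ℚ}

theorem mul_cBlock (h : IsSmallRep Φ p) (i j : Fin n) : p j * cBlock Φ p i j = cBlock Φ p i j :=
  h.idem_mul _ _

theorem zeroProj_mul_cBlock (h : IsSmallRep Φ p) (i j : Fin n) (X) :
    zeroProj p * (cBlock Φ p i j * X) = 0 := by
  rw [← h.mul_cBlock, mul_assoc, h.zeroProj_mul_mul]

theorem zeroProj_mul_aBlock (h : IsSmallRep Φ p) (i j : Fin n) :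
    zeroProj p * aBlock Φ p i j = aBlock Φ p i j := h.zeroProj_idem_mul _

theorem aBlock_mul_zeroProj (h : IsSmallRep Φ p) (i j : Fin n) :
    aBlock Φ p i j * zeroProj p = aBlock Φ p i j := by
  rw [aBlock, mul_assoc, mul_assoc, h.zeroProj_idem]

theorem rho_mul_zeroProj (h : IsSmallRep Φ p) {i j : Fin n} (hij : i ≠ j) :
    Φ (rho i j) * zeroProj p = cBlock Φ p i j + aBlock Φ p i j := by
  have h1 : p i * (Φ (rho i j) * zeroProj p) = 0 := by
    rw [h.mul_rho hij, h.mul_zeroProj, ← h.downBlock_mul, mul_assoc, h.mul_zeroProj, mul_zero,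
      add_zero]
  have h2 := eq_sum_blocks (p := p) hij (X := Φ (rho i j) * zeroProj p) (fun k hki hkj => by
    rw [h.mul_tw_mul_of_ne hij hki hkj, h.mul_zeroProj])
  rw [h1, zero_add] at h2
  exact h2

theorem rho_mul_aBlock (h : IsSmallRep Φ p) {i j : Fin n} (hij : i ≠ j) (k l : Fin n) :
    Φ (rho i j) * aBlock Φ p k l =
      cBlock Φ p i j * aBlock Φ p k l + aBlock Φ p i j * aBlock Φ p k l := by
  conv_lhs => rw [← h.zeroProj_mul_aBlock]
  rw [← mul_assoc, h.rho_mul_zeroProj hij, add_mul]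

theorem eps_mul_aBlock (h : IsSmallRep Φ p) {i j : Fin n} (hij : i ≠ j) (k l : Fin n) :
    Φ (eps i) * (Φ (eps j) * aBlock Φ p k l) = aBlock Φ p k l := by
  rw [← h.zeroProj_mul_aBlock, ← mul_assoc, ← mul_assoc, mul_assoc (Φ (eps i)),
    h.eps_mul_zeroProj hij]

theorem rho_inv_mul_zeroProj (h : IsSmallRep Φ p) {i j : Fin n} (hij : i ≠ j) :
    Φ (rho i j)⁻¹ * zeroProj p = -cBlock Φ p i j + aBlock Φ p i j := by
  obtain ⟨l, -, -, hli, hlj, -⟩ := exists_two_ne h.five_le i j j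
  rw [rho_inv_eq Φ hij hli hlj, h.eps_mul_zeroProj hlj, h.rho_mul_zeroProj hij, mul_add, mul_add,
    h.eps_mul_aBlock hlj.symm, ← h.mul_cBlock, ← mul_assoc, ← mul_assoc, mul_assoc (Φ (eps j)),
    h.eps_mul_neg_left hlj.symm, neg_mul]

theorem lam_mul_zeroProj (h : IsSmallRep Φ p) {i j : Fin n} (hij : i ≠ j) :
    Φ (lam i j) * zeroProj p = -cBlock Φ p i j + aBlock Φ p i j := by
  have h1 := congrArg (fun g => Φ g * zeroProj p) (eps_eps_rho hij)
  simp only [map_mul, mul_assoc] at h1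
  rw [h.eps_mul_zeroProj hij] at h1
  rw [← h1, h.rho_mul_zeroProj hij, mul_add, mul_add, h.eps_mul_aBlock hij, ← h.mul_cBlock,
    ← mul_assoc, ← mul_assoc, mul_assoc (Φ (eps i)), h.eps_mul_neg_right hij, neg_mul]

theorem downBlock_mul_cBlock (h : IsSmallRep Φ p) {i j k : Fin n} (hij : i ≠ j) (hkj : k ≠ j) :
    downBlock Φ p k j * cBlock Φ p i j = 0 := by
  rw [cBlock, ← mul_assoc, h.downBlock_mul, h.downBlock_mul_tw hkj hij, ← h.downBlock_mul,
    mul_assoc, h.mul_zeroProj, mul_zero]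

theorem tw_mul_cBlock (h : IsSmallRep Φ p) {i j k : Fin n} (hij : i ≠ j) (hkj : k ≠ j) (s t : ℤ) :
    Φ (tw k j s t) * cBlock Φ p i j = cBlock Φ p i j :=
  (h.tw_mul_of_downBlock_eq_zero (h.mul_cBlock i j)
    (fun _ hi => h.downBlock_mul_cBlock hij hi) hkj).1 s t

theorem zeroProj_rho_mul_cBlock (h : IsSmallRep Φ p) {i j k l : Fin n} (hij : i ≠ j)
    (hkl : k ≠ l) : zeroProj p * (Φ (rho i j) * cBlock Φ p k l) = 0 := by
  by_cases hli : l = i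
  · subst hli
    rw [← h.mul_cBlock, ← mul_assoc (Φ _), ← mul_assoc, h.zeroProj_rho_mul_left hij, zero_mul]
  have h1 : Φ (rho i j) * cBlock Φ p k l = cBlock Φ p k l := by
    by_cases hlj : l = j
    · subst hlj
      exact h.tw_mul_cBlock hkl hij 0 1
    · exact h.tw_mul_of_ne hij hli hlj (h.mul_cBlock k l) 0 1
  rw [h1]
  simpa using h.zeroProj_mul_cBlock k l 1

theorem zeroProj_lam_mul_cBlock (h : IsSmallRep Φ p) {i j k l : Fin n} (hij : i ≠ j)
    (hkl : k ≠ l) : zeroProj p * (Φ (lam i j) * cBlock Φ p k l) = 0 := by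
  by_cases hli : l = i
  · subst hli
    rw [← h.mul_cBlock, ← mul_assoc (Φ _), ← mul_assoc, h.lam_mul_left hij,
      h.zeroProj_rho_mul_left hij, zero_mul]
  have h1 : Φ (lam i j) * cBlock Φ p k l = cBlock Φ p k l := by
    by_cases hlj : l = j
    · subst hlj
      exact h.tw_mul_cBlock hkl hij 1 0
    · exact h.tw_mul_of_ne hij hli hlj (h.mul_cBlock k l) 1 0
  rw [h1]
  simpa using h.zeroProj_mul_cBlock k l 1

theorem zeroProj_rho_mul_aBlock (h : IsSmallRep Φ p) {i j : Fin n} (hij : i ≠ j) (k l : Fin n) :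
    zeroProj p * (Φ (rho i j) * aBlock Φ p k l) = aBlock Φ p i j * aBlock Φ p k l := by
  rw [h.rho_mul_aBlock hij, mul_add, h.zeroProj_mul_cBlock, zero_add, ← mul_assoc,
    h.zeroProj_mul_aBlock]

theorem aBlock_mul_aBlock (h : IsSmallRep Φ p) {i j k l : Fin n} (hij : i ≠ j) (hkl : k ≠ l) :
    zeroProj p * (Φ (rho i j) * (Φ (rho k l) * zeroProj p)) =
      aBlock Φ p i j * aBlock Φ p k l := by
  rw [h.rho_mul_zeroProj hkl, mul_add, mul_add, h.zeroProj_rho_mul_cBlock hij hkl, zero_add,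
    h.zeroProj_rho_mul_aBlock hij]

theorem aBlock_mul_self (h : IsSmallRep Φ p) {i j : Fin n} (hij : i ≠ j) :
    aBlock Φ p i j * aBlock Φ p i j = zeroProj p := by
  have h1 := congrArg (fun X => zeroProj p * X) (mul_inv_cancel_left Φ (rho i j) (zeroProj p))
  simp only [h.rho_inv_mul_zeroProj hij, mul_add, mul_neg, h.zeroProj_rho_mul_cBlock hij hij,
    neg_zero, zero_add, h.zeroProj_rho_mul_aBlock hij, h.zeroProj_idem] at h1
  exact h1

theorem aBlock_comm (h : IsSmallRep Φ p) {i j k l : Fin n} (hij : i ≠ j) (hkl : k ≠ l)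
    (hik : i ≠ k) (hil : i ≠ l) (hkj : k ≠ j) :
    aBlock Φ p i j * aBlock Φ p k l = aBlock Φ p k l * aBlock Φ p i j := by
  rw [← h.aBlock_mul_aBlock hij hkl, ← h.aBlock_mul_aBlock hkl hij, ← mul_assoc (Φ _),
    ← mul_assoc (Φ (rho k l)), ← map_mul, ← map_mul, _root_.tw_comm hij hkl hik hil hkj]

theorem aBlock_comm_same (h : IsSmallRep Φ p) {i j k : Fin n} (hij : i ≠ j) (hik : i ≠ k) :
    aBlock Φ p i j * aBlock Φ p i k = aBlock Φ p i k * aBlock Φ p i j := by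
  have h1 := congrArg (fun g => zeroProj p * (Φ g * zeroProj p)) (rho_comm_lam hij hik 1 1)
  simp only [map_mul, mul_assoc] at h1
  rw [h.lam_mul_zeroProj hik, mul_add, mul_add, mul_neg, mul_neg,
    h.zeroProj_rho_mul_cBlock hij hik, neg_zero, zero_add, h.zeroProj_rho_mul_aBlock hij,
    h.rho_mul_zeroProj hij, mul_add, mul_add, h.zeroProj_lam_mul_cBlock hik hij, zero_add] at h1
  rw [h1]
  conv_lhs => rw [← h.zeroProj_mul_aBlock i j]
  rw [← mul_assoc (Φ _), h.lam_mul_zeroProj hik, add_mul, mul_add, neg_mul, mul_neg,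
    h.zeroProj_mul_cBlock, neg_zero, zero_add, ← mul_assoc,
    h.zeroProj_mul_aBlock]

theorem aBlock_relation (h : IsSmallRep Φ p) {i j k : Fin n} (hij : i ≠ j) (hjk : j ≠ k)
    (hik : i ≠ k) : aBlock Φ p i j * aBlock Φ p j k =
      aBlock Φ p j k * (aBlock Φ p i j * aBlock Φ p i k) := by
  have h1 := congrArg (fun g => zeroProj p * (Φ g * zeroProj p)) (rho_mul_rho hij hjk hik)
  simp only [map_mul, mul_assoc] at h1
  have h2 : Φ (rho i j) * cBlock Φ p i k = cBlock Φ p i k :=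
    h.tw_mul_of_ne hij hik.symm hjk.symm (h.mul_cBlock i k) 0 1
  rw [h.aBlock_mul_aBlock hij hjk, h.rho_inv_mul_zeroProj hik, mul_add, mul_neg, h2, mul_add,
    mul_neg, mul_add, mul_neg, h.zeroProj_rho_mul_cBlock hjk hik, neg_zero, zero_add,
    h.rho_mul_aBlock hij, mul_add, mul_add, ← mul_assoc (Φ (rho j k)),
    ← mul_assoc (zeroProj p) (Φ (rho j k) * cBlock Φ p i j),
    h.zeroProj_rho_mul_cBlock hjk hij, zero_mul, zero_add] at h1
  rw [h1, ← mul_assoc (Φ _), ← mul_assoc, h.zeroProj_rho_mul_aBlock hjk, mul_assoc]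

theorem choose_two_le_two_pow {n : ℕ} (hn : 6 ≤ n) : n.choose 2 ≤ 2 ^ (n - 2) := by
  induction n, hn using Nat.le_induction with
  | base => decide
  | succ k hk ih =>
    have h1 : (k + 1).choose 2 = k + k.choose 2 := by
      rw [Nat.choose_succ_succ' k 1, Nat.choose_one_right]
    have h2 : 2 ^ (k + 1 - 2) = 2 * 2 ^ (k - 2) := by
      rw [← pow_succ']; congr 1; omega
    have h3 : k ≤ 2 ^ (k - 2) := by
      have := Nat.choose_two_right k
      have : 2 * k ≤ k * (k - 1) := by rw [mul_comm]; exact Nat.mul_le_mul_left k (by omega)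
      omega
    omega

theorem aBlock_eq (h : IsSmallRep Φ p) {i j : Fin n} (hij : i ≠ j) :
    aBlock Φ p i j = zeroProj p := by
  classical
  by_contra hne
  obtain ⟨v, hv⟩ : ∃ v, (zeroProj p - aBlock Φ p i j) *ᵥ v ≠ 0 := by
    by_contra! hv
    exact hne (matrix_ext_mulVec fun x => by
      have := hv x
      rw [sub_mulVec, sub_eq_zero] at this
      exact this.symm)
  let T : Fin n → (Fin m → ℚ) →ₗ[ℚ] (Fin m → ℚ) := fun k => (aBlock Φ p i k).mulVecLin
  have hTT : ∀ k l x, T k (T l x) = (aBlock Φ p i k * aBlock Φ p i l) *ᵥ x := fun k l x => by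
    simp [T, mulVec_mulVec]
  let W : Submodule ℚ (Fin m → ℚ) :=
    LinearMap.ker ((zeroProj p).mulVecLin - LinearMap.id) ⊓ LinearMap.ker (T j + LinearMap.id)
  have hW : ∀ x, x ∈ W ↔ zeroProj p *ᵥ x = x ∧ T j x = -x := fun x => by
    simp [W, Submodule.mem_inf, LinearMap.mem_ker, sub_eq_zero, add_eq_zero_iff_eq_neg]
  have hcomm : ∀ k l x, k ≠ i → l ≠ i → T k (T l x) = T l (T k x) := fun k l x hk hl => by
    rw [hTT, hTT, h.aBlock_comm_same hk.symm hl.symm]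
  obtain ⟨y, hyW, hy0, hy⟩ := exists_joint_eigenvector T W (Finset.univ.erase i)
    (fun k hk x hx => by
      rw [hW] at hx ⊢
      refine ⟨?_, ?_⟩
      · simp only [T, mulVecLin_apply, mulVec_mulVec, h.zeroProj_mul_aBlock]
      · rw [hcomm j k x hij.symm (Finset.ne_of_mem_erase hk), hx.2, map_neg])
    (fun k hk l hl x _ => hcomm k l x (Finset.ne_of_mem_erase hk) (Finset.ne_of_mem_erase hl))
    (fun k hk x hx => by
      rw [hTT, h.aBlock_mul_self (Finset.ne_of_mem_erase hk).symm, ((hW x).1 hx).1])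
    ((zeroProj p - aBlock Φ p i j) *ᵥ v) ((hW _).2 ⟨by
      rw [mulVec_mulVec, mul_sub, h.zeroProj_idem, h.zeroProj_mul_aBlock], by
      simp only [T, mulVecLin_apply]
      rw [mulVec_mulVec, mul_sub, h.aBlock_mul_zeroProj, h.aBlock_mul_self hij, ← neg_mulVec,
        neg_sub]⟩) hv
  have hχ : ∀ k, ∃ c : ℚ, c * c = 1 ∧ (k ≠ i → T k y = c • y) := fun k => by
    by_cases hk : k = i
    · exact ⟨1, by norm_num, fun hk' => absurd hk hk'⟩
    · rcases hy k (Finset.mem_erase.2 ⟨hk, Finset.mem_univ _⟩) with h1 | h1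
      · exact ⟨1, by norm_num, fun _ => by rw [h1, one_smul]⟩
      · exact ⟨-1, by norm_num, fun _ => by rw [h1, neg_smul, one_smul]⟩
  choose χ hχ1 hχ using hχ
  let J : Finset (Fin n) := (Finset.univ.erase i).erase j
  have key : ∀ D : Finset (Fin n), D ⊆ J → ∃ y, y ∈ W ∧ y ≠ 0 ∧
      ∀ k, k ≠ i → T k y = ((if k ∈ D then -1 else 1) * χ k) • y := by
    intro D
    induction D using Finset.induction_on with
    | empty => intro _; exact ⟨y, hyW, hy0, fun k hk => by simpa using hχ k hk⟩
    | insert l D hl ih =>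
      intro hD
      obtain ⟨z, hzW, hz0, hz⟩ := ih ((Finset.subset_insert l D).trans hD)
      have hlJ := hD (Finset.mem_insert_self l D)
      have hlj : l ≠ j := Finset.ne_of_mem_erase hlJ
      have hli : l ≠ i := Finset.ne_of_mem_erase (Finset.mem_of_mem_erase hlJ)
      rw [hW] at hzW
      have hTB : ∀ k, T k (aBlock Φ p l j *ᵥ z) = (aBlock Φ p i k * aBlock Φ p l j) *ᵥ z :=
        fun k => by simp [T, mulVec_mulVec]
      have hBT : ∀ k, k ≠ i → k ≠ l → T k (aBlock Φ p l j *ᵥ z) = aBlock Φ p l j *ᵥ (T k z) :=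
        fun k hki hkl => by
          rw [hTB, ← h.aBlock_comm hlj hki.symm hli hkl.symm hij, ← mulVec_mulVec]; rfl
      refine ⟨aBlock Φ p l j *ᵥ z, (hW _).2 ⟨?_, ?_⟩, ?_, fun k hki => ?_⟩
      · rw [mulVec_mulVec, h.zeroProj_mul_aBlock]
      · rw [hBT j hij.symm hlj.symm, hzW.2, mulVec_neg]
      · intro h0
        apply hz0
        rw [← hzW.1, ← h.aBlock_mul_self hlj, ← mulVec_mulVec, h0, mulVec_zero]
      · by_cases hkl : k = l
        · subst hkl
          rw [hTB, h.aBlock_relation hki.symm hlj hij, ← mulVec_mulVec, ← mulVec_mulVec]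
          change aBlock Φ p k j *ᵥ (T k (T j z)) = _
          rw [hzW.2, map_neg, hz k hki, mulVec_neg, mulVec_smul]
          simp [hl]
        · rw [hBT k hki hkl, hz k hki, mulVec_smul]
          simp [hkl]
  choose! w hwW hw0 hw using key
  have hind := linearIndependent_of_distinct_characters (X := {D // D ∈ J.powerset}) T
    {k | k ≠ i} (fun D => w D.1) (fun D k => (if k ∈ D.1 then -1 else 1) * χ k)
    (fun D => hw0 _ (Finset.mem_powerset.1 D.2))
    (fun D k hk => hw _ (Finset.mem_powerset.1 D.2) k hk)
    (fun D E hDE => Subtype.ext (Finset.ext fun k => by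
      by_cases hki : k = i
      · subst hki
        have : k ∉ J := fun hk => Finset.ne_of_mem_erase (Finset.mem_of_mem_erase hk) rfl
        exact ⟨fun hk => absurd (Finset.mem_powerset.1 D.2 hk) this,
          fun hk => absurd (Finset.mem_powerset.1 E.2 hk) this⟩
      · have h1 := hDE k hki
        have h2 := hχ1 k
        have h3 : χ k ≠ 0 := fun h0 => by rw [h0] at h2; norm_num at h2
        have h4 := mul_right_cancel₀ h3 h1
        by_cases hkD : k ∈ D.1 <;> by_cases hkE : k ∈ E.1 <;>
          simp only [hkD, hkE, if_true, if_false] at h4 ⊢ <;> norm_num at h4))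
  have hcard := card_le_of_linearIndependent _ hind
  rw [Fintype.card_coe, Finset.card_powerset, Finset.card_erase_of_mem
    (Finset.mem_erase.2 ⟨hij.symm, Finset.mem_univ _⟩),
    Finset.card_erase_of_mem (Finset.mem_univ _), Finset.card_univ, Fintype.card_fin] at hcard
  have := choose_two_le_two_pow h.six_le
  have := h.dim_lt
  rw [Nat.sub_sub, one_add_one_eq_two] at hcard
  omega

end IsSmallRep

end ZeroBlocks

section BlockForm

open Matrix

variable {n m : ℕ}

namespace IsSmallRep

variable {Φ : MulAut (FG n) →* Matrix (Fin m) (Fin m) ℚ} {p : Fin n → Matrix (Fin m) (Fin m) ℚ}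

theorem rho_mul_zeroProj_eq (h : IsSmallRep Φ p) {i j : Fin n} (hij : i ≠ j) :
    Φ (rho i j) * zeroProj p = cBlock Φ p i j + zeroProj p := by
  rw [h.rho_mul_zeroProj hij, h.aBlock_eq hij]

theorem rho_mul_of_left (h : IsSmallRep Φ p) {i j : Fin n} (hij : i ≠ j)
    {X : Matrix (Fin m) (Fin m) ℚ} (hX : p i * X = X) :
    Φ (rho i j) * X = X + upBlock Φ p i j * X := by
  conv_lhs => rw [← hX]
  rw [← mul_assoc, h.rho_mul_left hij, add_mul, hX]

theorem lam_mul_of_left (h : IsSmallRep Φ p) {i j : Fin n} (hij : i ≠ j)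
    {X : Matrix (Fin m) (Fin m) ℚ} (hX : p i * X = X) :
    Φ (lam i j) * X = X + upBlock Φ p i j * X := by
  conv_lhs => rw [← hX]
  rw [← mul_assoc, h.lam_mul_left hij, h.rho_mul_left hij, add_mul, hX]

theorem upBlock_mul_cBlock (h : IsSmallRep Φ p) {i j k : Fin n} (hij : i ≠ j) (hjk : j ≠ k)
    (hik : i ≠ k) : upBlock Φ p j k * cBlock Φ p i j = cBlock Φ p i k := by
  have h1 := congrArg (fun g => Φ g * zeroProj p) (rho_mul_rho hij hjk hik)
  simp only [map_mul, mul_assoc] at h1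
  rw [h.rho_mul_zeroProj_eq hjk, mul_add, h.rho_mul_zeroProj_eq hij,
    h.tw_mul_of_ne hij hik.symm hjk.symm (h.mul_cBlock j k) 0 1, h.rho_inv_mul_zeroProj hik,
    h.aBlock_eq hik, mul_add, mul_neg, h.rho_mul_zeroProj_eq hij,
    h.tw_mul_of_ne hij hik.symm hjk.symm (h.mul_cBlock i k) 0 1, mul_add, mul_neg, mul_add,
    h.rho_mul_zeroProj_eq hjk, h.tw_mul_cBlock hik hjk,
    h.rho_mul_of_left hjk (h.mul_cBlock i j)] at h1
  linear_combination (norm := abel) -h1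

theorem pc_mul_zeroProj (h : IsSmallRep Φ p) {i j : Fin n} (hij : i ≠ j) :
    Φ (pc i j) * zeroProj p = zeroProj p + (cBlock Φ p i j + cBlock Φ p i j) := by
  have h1 : pc i j = rho i j * (lam i j)⁻¹ := by
    rw [tw_inv hij, tw_mul hij]; norm_num
  have h2 : Φ (lam i j)⁻¹ * zeroProj p = zeroProj p + cBlock Φ p i j := by
    have h3 : Φ (lam i j) * (zeroProj p + cBlock Φ p i j) = zeroProj p := by
      rw [mul_add, h.lam_mul_zeroProj hij, h.tw_mul_cBlock hij hij, h.aBlock_eq hij]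
      abel
    conv_lhs => rw [← h3]
    rw [inv_mul_cancel_left]
  rw [h1, map_mul, mul_assoc, h2, mul_add, h.rho_mul_zeroProj_eq hij, h.tw_mul_cBlock hij hij]
  abel

theorem sum_cBlock (h : IsSmallRep Φ p) (j : Fin n) :
    ∑ i ∈ Finset.univ.erase j, cBlock Φ p i j = 0 := by
  have key : ∀ L : List (Fin n), j ∉ L → Φ (L.map fun i => pc i j).prod * zeroProj p =
      zeroProj p + ((L.map fun i => cBlock Φ p i j).sum + (L.map fun i => cBlock Φ p i j).sum) ∧
      ∀ k, k ≠ j → Φ (pc k j) * (L.map fun i => cBlock Φ p i j).sum =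
        (L.map fun i => cBlock Φ p i j).sum := by
    intro L
    induction L with
    | nil => intro _; simp
    | cons a L ih =>
      intro hj
      have haj : a ≠ j := fun ha => hj (by simp [ha])
      obtain ⟨h1, h2⟩ := ih fun hj' => hj (List.mem_cons_of_mem _ hj')
      refine ⟨?_, fun k hk => ?_⟩
      · rw [List.map_cons, List.prod_cons, map_mul, mul_assoc, h1, mul_add, mul_add, h2 a haj,
          h.pc_mul_zeroProj haj, List.map_cons, List.sum_cons]
        abel
      · rw [List.map_cons, List.sum_cons, mul_add, h2 k hk, h.tw_mul_cBlock haj hk]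
  have h1 := (key (Finset.univ.erase j).toList (by simp)).1
  rw [prod_pc_eq_conj _ (by simp) (Finset.nodup_toList _) (fun k hk => by simp [hk]), h.inner,
    one_mul, Finset.sum_map_toList] at h1
  exact matrix_two_cancel (by rw [add_zero]; exact (left_eq_add.1 h1))

theorem cBlock_eq_zero (h : IsSmallRep Φ p) {i j : Fin n} (hij : i ≠ j) : cBlock Φ p i j = 0 := by
  have key : ∀ k j, j ≠ k → upBlock Φ p j k * cBlock Φ p k j = cBlock Φ p j k := fun k j hjk => by
    have h1 := congrArg (fun X => upBlock Φ p j k * X) (h.sum_cBlock j)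
    have h2 := h.sum_cBlock k
    rw [← Finset.add_sum_erase _ _ (Finset.mem_erase.2 ⟨hjk, Finset.mem_univ j⟩)] at h2
    simp only [mul_zero, Finset.mul_sum] at h1
    rw [← Finset.add_sum_erase _ _ (Finset.mem_erase.2 ⟨hjk.symm, Finset.mem_univ k⟩),
      Finset.erase_right_comm, Finset.sum_congr rfl (fun i hi => h.upBlock_mul_cBlock
        (i := i) (Finset.ne_of_mem_erase hi) hjk
        (Finset.ne_of_mem_erase (Finset.mem_of_mem_erase hi)))] at h1
    linear_combination (norm := abel) h1 - h2
  have hconst : ∀ l, l ≠ j → l ≠ i → cBlock Φ p l j = cBlock Φ p i j := fun l hlj hli => by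
    rw [← key j i hij, ← h.upBlock_mul_cBlock hlj.symm hli hij.symm, ← mul_assoc,
      h.upBlock_mul_upBlock hli hij hlj, key j l hlj]
  have h1 := h.sum_cBlock j
  rw [Finset.sum_congr rfl (g := fun _ => cBlock Φ p i j) (fun l hl => by
    by_cases hli : l = i
    · rw [hli]
    · exact hconst l (Finset.ne_of_mem_erase hl) hli), Finset.sum_const,
    Finset.card_erase_of_mem (Finset.mem_univ _), Finset.card_univ, Fintype.card_fin] at h1
  have := h.six_le
  ext a b
  have h2 := congrArg (fun M : Matrix (Fin m) (Fin m) ℚ => M a b) h1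
  simp only [Matrix.smul_apply, nsmul_eq_mul, Matrix.zero_apply, mul_eq_zero, Nat.cast_eq_zero]
    at h2 ⊢
  exact h2.resolve_left (by omega)

theorem tw_mul_zeroProj (h : IsSmallRep Φ p) {i j : Fin n} (hij : i ≠ j) (s t : ℤ) :
    Φ (tw i j s t) * zeroProj p = zeroProj p :=
  tw_mem_fixer_of_mem hij
    (mem_fixer.2 (by rw [h.rho_mul_zeroProj_eq hij, h.cBlock_eq_zero hij, zero_add]))
    (mem_fixer.2 (by rw [h.lam_mul_zeroProj hij, h.cBlock_eq_zero hij, h.aBlock_eq hij, neg_zero,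
      zero_add])) s t

theorem zeroProj_mul_tw (h : IsSmallRep Φ p) {i j : Fin n} (hij : i ≠ j) (s t : ℤ) :
    zeroProj p * Φ (tw i j s t) = zeroProj p := by
  have h1 := congrArg transpose (h.dual.tw_mul_zeroProj hij (-s) (-t))
  rw [transpose_mul, zeroProj_dual, transpose_transpose, transpose_dual, tw_inv hij] at h1
  simpa using h1

theorem rho_mul_right_aux (h : IsSmallRep Φ p) {i j : Fin n} (hij : i ≠ j) :
    Φ (rho i j) * p j = downBlock Φ p i j + p j * (Φ (rho i j) * p j) := by
  have h2 := eq_sum_blocks (p := p) hij (X := Φ (rho i j) * p j) (fun k hki hkj => by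
    rw [h.mul_tw_mul_of_ne hij hki hkj, h.weight.orth _ _ hkj])
  rw [← mul_assoc (zeroProj p), h.zeroProj_mul_tw hij, h.zeroProj_mul, add_zero] at h2
  conv_lhs => rw [h2]
  rw [downBlock, mul_assoc]

theorem rho_inv_mul_right_aux (h : IsSmallRep Φ p) {i j : Fin n} (hij : i ≠ j) :
    Φ (rho i j)⁻¹ * p j = p j * (Φ (rho i j) * p j) - downBlock Φ p i j := by
  obtain ⟨l, -, -, hli, hlj, -⟩ := exists_two_ne h.five_le i j j
  have h1 : Φ (eps j) * (Φ (eps l) * downBlock Φ p i j) = downBlock Φ p i j := by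
    rw [← h.mul_downBlock, ← mul_assoc (Φ (eps l)), ← mul_assoc (Φ (eps j)),
      h.eps_mul_fix hij.symm hli]
  have h2 : Φ (eps j) * (Φ (eps l) * (p j * (Φ (rho i j) * p j))) =
      -(p j * (Φ (rho i j) * p j)) := by
    rw [← mul_assoc (Φ (eps l)), ← mul_assoc (Φ (eps j)), h.eps_mul_neg_left hlj.symm, neg_mul]
  rw [rho_inv_eq Φ hij hli hlj, h.eps_mul_neg_right hlj, mul_neg]
  conv_lhs => rw [h.rho_mul_right_aux hij, mul_neg, mul_neg, mul_add, mul_add, h1, h2]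
  abel

theorem upBlock_mul_downBlock (h : IsSmallRep Φ p) {i j k : Fin n} (hij : i ≠ j) (hik : i ≠ k) :
    upBlock Φ p i k * downBlock Φ p i j = 0 := by
  have key : ∀ k, k ≠ i → k ≠ j → upBlock Φ p i k * downBlock Φ p i j = 0 := fun k hki hkj => by
    have h1 := congrArg (fun g => Φ g * p j) (rho_comm_lam hij hki.symm 1 1)
    simp only [map_mul, mul_assoc] at h1
    rw [h.tw_mul_of_ne hki.symm hij.symm hkj.symm (h.weight.idem j), h.rho_mul_right_aux hij,
      mul_add, h.lam_mul_of_left hki.symm (h.mul_downBlock i j),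
      h.tw_mul_of_ne hki.symm hij.symm hkj.symm (h.idem_mul j _)] at h1
    linear_combination (norm := abel) -h1
  by_cases hkj : k = j
  · subst hkj
    obtain ⟨l, -, -, hli, hlk, -⟩ := exists_two_ne h.five_le i k k
    rw [← h.upBlock_mul_upBlock hli.symm hlk hik, mul_assoc, key l hli hlk, mul_zero]
  · exact key k hik.symm hkj

theorem sBlock_mul_self (h : IsSmallRep Φ p) {i j : Fin n} (hij : i ≠ j) :
    p j * (Φ (rho i j) * (p j * (Φ (rho i j) * p j))) = p j := by
  have h1 := congrArg (fun X => p j * X) (mul_inv_cancel_left Φ (rho i j) (p j))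
  rw [h.rho_inv_mul_right_aux hij, mul_sub, h.rho_mul_of_left hij (h.mul_downBlock i j),
    h.upBlock_mul_downBlock hij hij, add_zero, mul_sub, ← h.mul_downBlock i j,
    h.orth_mul hij.symm, sub_zero, h.weight.idem] at h1
  exact h1

theorem mul_rho_mul_right (h : IsSmallRep Φ p) {i j : Fin n} (hji : j ≠ i) :
    p i * (Φ (rho j i) * p i) = p i := by
  obtain ⟨k, -, -, hkj, hki, -⟩ := exists_two_ne h.five_le j i i
  have h1 := congrArg (fun g => p i * (Φ g * p i)) (rho_mul_rho hkj.symm hki hji)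
  simp only [map_mul, mul_assoc] at h1
  rw [h.mul_tw_mul_of_ne hkj.symm hji.symm hki.symm, h.rho_inv_mul_right_aux hji, mul_sub,
    h.tw_mul_of_ne hkj.symm hji.symm hki.symm (h.idem_mul i _),
    h.rho_mul_of_left hkj.symm (h.mul_downBlock j i), h.upBlock_mul_downBlock hji hkj.symm,
    add_zero, mul_sub, h.tw_mul_of_ne hki hkj.symm hji (h.mul_downBlock j i), mul_sub,
    ← h.mul_downBlock j i, h.orth_mul hji.symm, sub_zero] at h1
  have h2 := congrArg (fun X => p i * (Φ (rho k i) * X)) h1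
  rw [h.sBlock_mul_self hki] at h2
  have h3 := congrArg (fun X => X * (Φ (rho j i) * p i)) (h.sBlock_mul_self hki)
  simp only [mul_assoc] at h3
  rw [h3] at h2
  exact h2.symm

theorem rho_mul_right (h : IsSmallRep Φ p) {i j : Fin n} (hij : i ≠ j) :
    Φ (rho i j) * p j = p j + downBlock Φ p i j := by
  rw [h.rho_mul_right_aux hij, h.mul_rho_mul_right hij, add_comm]

theorem matrix_ext_proj {X Y : Matrix (Fin m) (Fin m) ℚ}
    (h0 : X * zeroProj p = Y * zeroProj p) (hp : ∀ k, X * p k = Y * p k) : X = Y := by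
  have h1 : (1 : Matrix (Fin m) (Fin m) ℚ) = zeroProj p + ∑ k, p k := by simp [zeroProj]
  rw [← mul_one X, ← mul_one Y, h1, mul_add, mul_add, h0, Finset.mul_sum, Finset.mul_sum]
  simp only [hp]

theorem upBlock_mul_of_ne (h : IsSmallRep Φ p) {i j k : Fin n} (hki : k ≠ i)
    {X : Matrix (Fin m) (Fin m) ℚ} (hX : p k * X = X) : upBlock Φ p i j * X = 0 := by
  rw [← hX, ← h.upBlock_mul, mul_assoc, h.orth_mul hki.symm, mul_zero]

/-- A transvection is the identity plus its two off-diagonal blocks. -/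
theorem rho_eq (h : IsSmallRep Φ p) {i j : Fin n} (hij : i ≠ j) :
    Φ (rho i j) = 1 + upBlock Φ p i j + downBlock Φ p i j := by
  refine matrix_ext_proj (p := p) ?_ fun k => ?_
  · rw [h.tw_mul_zeroProj hij, add_mul, add_mul, one_mul, ← h.upBlock_mul, ← h.downBlock_mul,
      mul_assoc, mul_assoc, h.mul_zeroProj, h.mul_zeroProj, mul_zero, mul_zero, add_zero, add_zero]
  · rw [add_mul, add_mul, one_mul]
    by_cases hki : k = i
    · subst hki
      rw [h.rho_mul_left hij, h.upBlock_mul, h.downBlock_mul_of_ne hij (h.weight.idem k), add_zero]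
    · rw [h.upBlock_mul_of_ne hki (h.weight.idem k), add_zero]
      by_cases hkj : k = j
      · subst hkj
        rw [h.rho_mul_right hij, h.downBlock_mul]
      · rw [h.downBlock_mul_of_ne hkj (h.weight.idem k), add_zero, h.rho_mul_of_ne hij hki hkj]

theorem downBlock_mul_upBlock (h : IsSmallRep Φ p) {i j k : Fin n} (hij : i ≠ j) (hkj : k ≠ j) :
    downBlock Φ p k j * upBlock Φ p i j = 0 := by
  rw [upBlock, mul_assoc, ← mul_assoc, h.downBlock_mul, h.downBlock_mul_tw hkj hij,
    h.downBlock_mul_of_ne hij (h.weight.idem i)]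

theorem downBlock_mul_three (h : IsSmallRep Φ p) {i j k : Fin n} (hik : i ≠ k) (hjk : j ≠ k) :
    downBlock Φ p j k * (downBlock Φ p k i * downBlock Φ p i k) = downBlock Φ p j k := by
  have key : ∀ j, j ≠ i → j ≠ k →
      downBlock Φ p j k * (downBlock Φ p k i * downBlock Φ p i k) = downBlock Φ p j k :=
    fun j hji hjk => by
      rw [← mul_assoc, h.downBlock_mul_downBlock hjk hik.symm hji, neg_mul,
        h.downBlock_mul_downBlock hji hik hjk, neg_neg]
  by_cases hji : j = i
  · subst hji
    obtain ⟨l, -, -, hlj, hlk, -⟩ := exists_two_ne h.five_le j k k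
    have h1 := h.downBlock_mul_downBlock hlj.symm hlk hjk
    rw [← neg_neg (downBlock Φ p j k * _), ← neg_mul, ← h1, mul_assoc, key l hlj hlk, h1, neg_neg]
  · exact key j hji hjk

theorem proj_eq (h : IsSmallRep Φ p) {i j k : Fin n} (hik : i ≠ k) (hjk : j ≠ k) :
    upBlock Φ p j k * upBlock Φ p k j + downBlock Φ p k i * downBlock Φ p i k = p k := by
  have h1 := (h.tw_mul_of_downBlock_eq_zero
    (X := p k - downBlock Φ p k i * downBlock Φ p i k) (k := k)
    (by rw [mul_sub, h.weight.idem, ← mul_assoc, h.mul_downBlock])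
    (fun l hlk => by rw [mul_sub, h.downBlock_mul, h.downBlock_mul_three hik hlk, sub_self]) hjk).2
  rw [mul_sub, ← mul_assoc (upBlock Φ p k j), h.upBlock_mul_downBlock hik.symm hjk.symm, zero_mul,
    sub_zero, h.upBlock_mul] at h1
  rw [h1, sub_add_cancel]

end IsSmallRep

end BlockForm

section IntegralBlocks

open Matrix

variable {n m : ℕ}

/-- A rational matrix with integral entries. -/
def IsIntegralMatrix (X : Matrix (Fin m) (Fin m) ℚ) : Prop :=
  X ∈ ((Int.castRingHom ℚ).mapMatrix : Matrix (Fin m) (Fin m) ℤ →+* _).range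

/-- The matrix units splitting a small representation, indexed by the two types of weight
vectors (`true` for the standard one and `false` for its dual). -/
structure IsUnitSystem {S : Type*} [Ring S] (X Y : Bool → Fin n → S) (q : Bool → S) (z : S) :
    Prop where
  mul_same : ∀ b k, Y b k * X b k = q b
  mul_of_ne : ∀ b c j k, (b, j) ≠ (c, k) → Y b j * X c k = 0
  mul_idem : ∀ b k, X b k * q b = X b k
  idem_mul : ∀ b k, q b * Y b k = Y b k
  idem : ∀ b, q b * q b = q b
  zero_idem : z * z = z
  zero_mul : ∀ b k, z * X b k = 0
  mul_zero : ∀ b k, Y b k * z = 0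
  sum : ∑ b, ∑ k, X b k * Y b k + z = 1

namespace IsSmallRep

variable {Φ : MulAut (FG n) →* Matrix (Fin m) (Fin m) ℚ} {p : Fin n → Matrix (Fin m) (Fin m) ℚ}

theorem upBlock_eq (h : IsSmallRep Φ p) {i j k : Fin n} (hij : i ≠ j) (hjk : j ≠ k) (hik : i ≠ k) :
    upBlock Φ p i k = (Φ (rho j k) - 1) * (Φ (rho i j) - 1) := by
  rw [h.rho_eq hij, h.rho_eq hjk, add_assoc, add_assoc, add_sub_cancel_left, add_sub_cancel_left,
    add_mul, mul_add, mul_add, h.upBlock_mul_upBlock hij hjk hik,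
    h.upBlock_mul_of_ne hij (h.mul_downBlock i j), h.downBlock_mul_of_ne hjk (h.mul_upBlock i j),
    h.downBlock_mul_of_ne hik (h.mul_downBlock i j)]
  simp

theorem downBlock_eq (h : IsSmallRep Φ p) {i j k : Fin n} (hij : i ≠ j) (hjk : j ≠ k)
    (hik : i ≠ k) : downBlock Φ p i k = -((Φ (rho i j) - 1) * (Φ (rho j k) - 1)) := by
  rw [h.rho_eq hij, h.rho_eq hjk, add_assoc, add_assoc, add_sub_cancel_left, add_sub_cancel_left,
    add_mul, mul_add, mul_add, h.downBlock_mul_downBlock hij hjk hik,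
    h.upBlock_mul_of_ne hik.symm (h.mul_upBlock j k),
    h.upBlock_mul_of_ne hij.symm (h.mul_downBlock j k),
    h.downBlock_mul_of_ne hjk.symm (h.mul_upBlock j k)]
  simp

theorem isIntegralMatrix_upBlock (h : IsSmallRep Φ p) (hΦ : ∀ g, IsIntegralMatrix (Φ g))
    {i k : Fin n} (hik : i ≠ k) : IsIntegralMatrix (upBlock Φ p i k) := by
  obtain ⟨j, -, -, hji, hjk, -⟩ := exists_two_ne h.five_le i k k
  rw [h.upBlock_eq hji.symm hjk hik]
  exact mul_mem (sub_mem (hΦ _) (one_mem _)) (sub_mem (hΦ _) (one_mem _))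

theorem isIntegralMatrix_downBlock (h : IsSmallRep Φ p) (hΦ : ∀ g, IsIntegralMatrix (Φ g))
    {i k : Fin n} (hik : i ≠ k) : IsIntegralMatrix (downBlock Φ p i k) := by
  obtain ⟨j, -, -, hji, hjk, -⟩ := exists_two_ne h.five_le i k k
  rw [h.downBlock_eq hji.symm hjk hik]
  exact neg_mem (mul_mem (sub_mem (hΦ _) (one_mem _)) (sub_mem (hΦ _) (one_mem _)))

theorem upBlock_mul_upBlock_eq (h : IsSmallRep Φ p) {i j k : Fin n} (hik : i ≠ k) (hjk : j ≠ k) :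
    upBlock Φ p i k * upBlock Φ p k i = upBlock Φ p j k * upBlock Φ p k j :=
  add_right_cancel ((h.proj_eq hik hik).trans (h.proj_eq hik hjk).symm)

theorem downBlock_mul_downBlock_eq (h : IsSmallRep Φ p) {i j k : Fin n} (hik : i ≠ k)
    (hjk : j ≠ k) :
    downBlock Φ p k i * downBlock Φ p i k = downBlock Φ p k j * downBlock Φ p j k :=
  add_left_cancel ((h.proj_eq hik hik).trans (h.proj_eq hjk hik).symm)

theorem upBlock_mul_idem (h : IsSmallRep Φ p) {o a j : Fin n} (hao : a ≠ o) (hjo : j ≠ o) :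
    upBlock Φ p o j * (upBlock Φ p a o * upBlock Φ p o a) = upBlock Φ p o j := by
  rw [eq_sub_of_add_eq (h.proj_eq hao hao), mul_sub, h.upBlock_mul, ← mul_assoc,
    h.upBlock_mul_downBlock hao.symm hjo.symm, zero_mul, sub_zero]

theorem idem_mul_upBlock (h : IsSmallRep Φ p) {o a j : Fin n} (hao : a ≠ o) (hjo : j ≠ o) :
    upBlock Φ p a o * upBlock Φ p o a * upBlock Φ p j o = upBlock Φ p j o := by
  rw [eq_sub_of_add_eq (h.proj_eq hao hao), sub_mul, h.mul_upBlock, mul_assoc,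
    h.downBlock_mul_upBlock hjo hao, mul_zero, sub_zero]

theorem downBlock_mul_idem (h : IsSmallRep Φ p) {o a j : Fin n} (hao : a ≠ o) (hjo : j ≠ o) :
    downBlock Φ p j o * (downBlock Φ p o a * downBlock Φ p a o) = downBlock Φ p j o := by
  rw [eq_sub_of_add_eq' (h.proj_eq hao hao), mul_sub, h.downBlock_mul, ← mul_assoc,
    h.downBlock_mul_upBlock hao hjo, zero_mul, sub_zero]

theorem idem_mul_downBlock (h : IsSmallRep Φ p) {o a j : Fin n} (hao : a ≠ o) (hjo : j ≠ o) :
    downBlock Φ p o a * downBlock Φ p a o * downBlock Φ p o j = downBlock Φ p o j := by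
  rw [eq_sub_of_add_eq' (h.proj_eq hao hao), sub_mul, h.mul_downBlock, mul_assoc,
    h.upBlock_mul_downBlock hjo.symm hao.symm, mul_zero, sub_zero]

theorem exists_isUnitSystem (h : IsSmallRep Φ p) (hΦ : ∀ g, IsIntegralMatrix (Φ g)) :
    ∃ X Y q, IsUnitSystem X Y q (zeroProj p) ∧
      (∀ b k, IsIntegralMatrix (X b k) ∧ IsIntegralMatrix (Y b k) ∧ IsIntegralMatrix (q b)) ∧
      (∀ b k, p k * X b k = X b k) ∧
      ∀ i j, i ≠ j → Φ (rho i j) = 1 + X true j * Y true i - X false i * Y false j := by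
  have hn := h.six_le
  let o : Fin n := ⟨0, by omega⟩
  let a : Fin n := ⟨1, by omega⟩
  have hao : a ≠ o := by simp [a, o]
  let u := upBlock Φ p a o * upBlock Φ p o a
  let d := downBlock Φ p o a * downBlock Φ p a o
  have hu : ∀ j, j ≠ o → upBlock Φ p j o * upBlock Φ p o j = u := fun j hj =>
    h.upBlock_mul_upBlock_eq hj hao
  have hd : ∀ j, j ≠ o → downBlock Φ p o j * downBlock Φ p j o = d := fun j hj =>
    h.downBlock_mul_downBlock_eq hj hao
  have hXu : ∀ j, j ≠ o → upBlock Φ p o j * u = upBlock Φ p o j := fun j => h.upBlock_mul_idem hao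
  have hYu : ∀ j, j ≠ o → u * upBlock Φ p j o = upBlock Φ p j o := fun j => h.idem_mul_upBlock hao
  have hXd : ∀ j, j ≠ o → downBlock Φ p j o * d = downBlock Φ p j o :=
    fun j => h.downBlock_mul_idem hao
  have hYd : ∀ j, j ≠ o → d * downBlock Φ p o j = downBlock Φ p o j :=
    fun j => h.idem_mul_downBlock hao
  have huu : u * u = u := by
    change upBlock Φ p a o * upBlock Φ p o a * u = u
    rw [mul_assoc, hXu a hao]
  have hdd : d * d = d := by
    change downBlock Φ p o a * downBlock Φ p a o * d = d
    rw [mul_assoc, hXd a hao]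
  have hud : u + d = p o := h.proj_eq hao hao
  have hpu : p o * u = u := by rw [← mul_assoc, h.mul_upBlock]
  have hup : u * p o = u := by
    change upBlock Φ p a o * upBlock Φ p o a * p o = _
    rw [mul_assoc, h.upBlock_mul]
  have hpd : p o * d = d := by rw [← mul_assoc, h.mul_downBlock]
  have hdp : d * p o = d := by
    change downBlock Φ p o a * downBlock Φ p a o * p o = _
    rw [mul_assoc, h.downBlock_mul]
  have hiu : IsIntegralMatrix u := mul_mem (h.isIntegralMatrix_upBlock hΦ hao)
    (h.isIntegralMatrix_upBlock hΦ hao.symm)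
  have hid : IsIntegralMatrix d := mul_mem (h.isIntegralMatrix_downBlock hΦ hao.symm)
    (h.isIntegralMatrix_downBlock hΦ hao)
  let q : Bool → Matrix (Fin m) (Fin m) ℚ := fun b => if b then u else d
  let X : Bool → Fin n → Matrix (Fin m) (Fin m) ℚ := fun b k =>
    if k = o then q b else if b then upBlock Φ p o k else -downBlock Φ p k o
  let Y : Bool → Fin n → Matrix (Fin m) (Fin m) ℚ := fun b k =>
    if k = o then q b else if b then upBlock Φ p k o else -downBlock Φ p o k
  have hq : ∀ b, q b * q b = q b := by
    intro b; cases b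
    · exact hdd
    · exact huu
  have hpX : ∀ b k, p k * X b k = X b k := by
    intro b k
    by_cases hk : k = o
    · cases b <;> simp [X, q, hk, hpu, hpd]
    · cases b <;> simp [X, hk, h.mul_upBlock, h.mul_downBlock]
  have hYp : ∀ b k, Y b k * p k = Y b k := by
    intro b k
    by_cases hk : k = o
    · cases b <;> simp [Y, q, hk, hup, hdp]
    · cases b <;> simp [Y, hk, h.upBlock_mul, h.downBlock_mul]
  have hXq : ∀ b k, X b k * q b = X b k := by
    intro b k
    by_cases hk : k = o
    · simp [X, hk, hq]
    · cases b
      · simp [X, q, hk, hXd k hk]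
      · simp [X, q, hk, hXu k hk]
  have hqY : ∀ b k, q b * Y b k = Y b k := by
    intro b k
    by_cases hk : k = o
    · simp [Y, hk, hq]
    · cases b
      · simp [Y, q, hk, hYd k hk]
      · simp [Y, q, hk, hYu k hk]
  have hud0 : u * d = 0 := by
    have h1 : u * p o = u := hup
    rw [← hud, mul_add, huu] at h1
    exact left_eq_add.1 h1.symm
  have hdu0 : d * u = 0 := by
    have h1 : p o * u = u := hpu
    rw [← hud, add_mul, huu] at h1
    exact left_eq_add.1 h1.symm
  refine ⟨X, Y, q, ⟨?_, ?_, hXq, hqY, hq, h.zeroProj_idem, ?_, ?_, ?_⟩, ?_, hpX, ?_⟩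
  · intro b k
    by_cases hk : k = o
    · simp [X, Y, hk, hq]
    · cases b
      · simp [X, Y, q, hk, hd k hk]
      · simp [X, Y, q, hk, hu k hk]
  · intro b c j k hne
    by_cases hjk : j = k
    · subst hjk
      have hbc : b ≠ c := fun hbc => hne (by rw [hbc])
      by_cases hj : j = o
      · cases b <;> cases c <;> simp [X, Y, q, hj, hud0, hdu0] at hbc ⊢
      · cases b <;> cases c <;> simp [X, Y, hj] at hbc ⊢
        · exact h.downBlock_mul_upBlock (Ne.symm hj) (Ne.symm hj)
        · exact h.upBlock_mul_downBlock hj hj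
    · rw [← hYp, ← hpX, mul_assoc, h.orth_mul hjk, mul_zero]
  · intro b k
    rw [← hpX, h.zeroProj_mul_mul]
  · intro b k
    rw [← hYp, mul_assoc, h.mul_zeroProj, mul_zero]
  · have h1 : ∀ k, X true k * Y true k + X false k * Y false k = p k := fun k => by
      by_cases hk : k = o
      · simp [X, Y, q, hk, huu, hdd, hud]
      · simpa [X, Y, hk] using h.proj_eq (Ne.symm hk) (Ne.symm hk)
    rw [Fintype.sum_bool, ← Finset.sum_add_distrib, Finset.sum_congr rfl fun k _ => h1 k]
    simp [zeroProj]
  · intro b k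
    have h3 : IsIntegralMatrix (q b) := by cases b <;> assumption
    refine ⟨?_, ?_, h3⟩
    · by_cases hk : k = o
      · simpa [X, hk] using h3
      · cases b
        · have h4 : IsIntegralMatrix (-downBlock Φ p k o) :=
            neg_mem (h.isIntegralMatrix_downBlock hΦ hk)
          simpa [X, hk] using h4
        · simpa [X, hk] using h.isIntegralMatrix_upBlock hΦ (Ne.symm hk)
    · by_cases hk : k = o
      · simpa [Y, hk] using h3
      · cases b
        · have h4 : IsIntegralMatrix (-downBlock Φ p o k) :=
            neg_mem (h.isIntegralMatrix_downBlock hΦ (Ne.symm hk))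
          simpa [Y, hk] using h4
        · simpa [Y, hk] using h.isIntegralMatrix_upBlock hΦ hk
  · intro i j hij
    have h1 : X true j * Y true i = upBlock Φ p i j := by
      by_cases hi : i = o
      · have hj : j ≠ o := fun hj => hij (hi.trans hj.symm)
        simp [X, Y, q, hi, hj, hXu j hj]
      · by_cases hj : j = o
        · simp [X, Y, q, hi, hj, hYu i hi]
        · simpa [X, Y, hi, hj] using h.upBlock_mul_upBlock hi (Ne.symm hj) hij
    have h2 : X false i * Y false j = -downBlock Φ p i j := by
      by_cases hi : i = o
      · have hj : j ≠ o := fun hj => hij (hi.trans hj.symm)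
        simp [X, Y, q, hi, hj, hYd j hj]
      · by_cases hj : j = o
        · simp [X, Y, q, hi, hj, hXd i hi]
        · simpa [X, Y, hi, hj] using h.downBlock_mul_downBlock hi (Ne.symm hj) hij
    rw [h.rho_eq hij, h1, h2, sub_neg_eq_add]

end IsSmallRep

end IntegralBlocks

/-! ### The action on the abelianization -/

section AbelianizedAction

open FreeGroup (of)
open Matrix

variable {m : ℕ}

/-- The exponent sum of `a_i` as an integer. -/
def expo (i : Fin m) (x : FG m) : ℤ := Multiplicative.toAdd (expSum i x)

theorem expo_mul (i : Fin m) (x y : FG m) : expo i (x * y) = expo i x + expo i y := by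
  simp [expo]

theorem expo_inv (i : Fin m) (x : FG m) : expo i x⁻¹ = -expo i x := by
  simp [expo]

theorem expo_one (i : Fin m) : expo i 1 = 0 := by
  simp [expo]

theorem expo_of (i k : Fin m) : expo i (of k) = if k = i then 1 else 0 := by
  simp [expo, expSum_of]

/-- An additive function on the free group is determined by the exponent sums. -/
theorem additive_eq_sum {A : Type*} [AddCommGroup A] (h : FG m → A)
    (hmul : ∀ x y, h (x * y) = h x + h y) (x : FG m) : h x = ∑ i, expo i x • h (of i) := by
  have h1 : h 1 = 0 := by simpa using hmul 1 1
  induction x using FreeGroup.induction_on with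
  | C1 => simp [h1, expo_one]
  | of k => simp [expo_of]
  | inv_of k _ =>
    have h2 := hmul (of k) (of k)⁻¹
    rw [mul_inv_cancel, h1] at h2
    change h (of k)⁻¹ = ∑ i, expo i (of k)⁻¹ • h (of i)
    simp [expo_inv, expo_of, eq_neg_of_add_eq_zero_right h2.symm]
  | mul x y hx hy => simp only [hmul, expo_mul, add_smul, Finset.sum_add_distrib, ← hx, ← hy]

/-- The matrix of an automorphism on the abelianization. -/
def abMat : MulAut (FG m) →* Matrix (Fin m) (Fin m) ℤ where
  toFun f := Matrix.of fun i j => expo i (f (of j))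
  map_one' := by
    ext i j
    simp [expo_of, Matrix.one_apply, eq_comm]
  map_mul' f g := by
    ext i j
    rw [Matrix.mul_apply]
    have := additive_eq_sum (fun x => expo i (f x)) (fun x y => by rw [map_mul, expo_mul])
      (g (of j))
    simpa [mul_comm] using this

theorem abMat_apply (f : MulAut (FG m)) (i j : Fin m) : abMat f i j = expo i (f (of j)) := rfl

theorem expo_apply (f : MulAut (FG m)) (i : Fin m) (x : FG m) :
    expo i (f x) = ∑ j, abMat f i j * expo j x := by
  rw [additive_eq_sum (fun x => expo i (f x)) (fun x y => by rw [map_mul, expo_mul]) x]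
  simp [abMat_apply, mul_comm]

theorem abMat_conj (u : FG m) : abMat (MulAut.conj u) = 1 := by
  ext i j
  simp [abMat_apply, MulAut.conj_apply, expo_mul, expo_inv, expo_of, Matrix.one_apply, eq_comm]

/-- The matrix of an outer automorphism on the abelianization. -/
def outMat (m : ℕ) : OutFG m →* Matrix (Fin m) (Fin m) ℤ :=
  QuotientGroup.lift (InnFG m) abMat (by
    rintro _ ⟨u, rfl⟩
    exact abMat_conj u)

theorem outMat_toOut (f : MulAut (FG m)) : outMat m (toOut m f) = abMat f := rfl

theorem mem_commutator_of_expo {x : FG m} (h : ∀ i, expo i x = 0) :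
    x ∈ commutator (FG m) := by
  rw [← Abelianization.ker_of, MonoidHom.mem_ker]
  have h1 := additive_eq_sum (fun y : FG m => Additive.ofMul (Abelianization.of y))
    (fun y z => by rw [map_mul, ofMul_mul]) x
  simp only [h, zero_smul, Finset.sum_const_zero] at h1
  exact Additive.ofMul.injective h1

theorem mem_lcsKer_one_of_abMat {f : MulAut (FG m)} (h : abMat f = 1) : f ∈ lcsKer m 1 := by
  intro x
  rw [Subgroup.top_lowerCentralSeries_one]
  refine mem_commutator_of_expo fun i => ?_
  rw [expo_mul, expo_inv, expo_apply, h]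
  simp [Matrix.one_apply]

end AbelianizedAction

/-! ### An integral basis adapted to the weights -/

section AdaptedBasis

open Matrix

variable {n m : ℕ}

theorem exists_split_idempotent (q : Matrix (Fin m) (Fin m) ℤ) (hq : q * q = q) :
    ∃ (r : ℕ) (I : Matrix (Fin m) (Fin r) ℤ) (C : Matrix (Fin r) (Fin m) ℤ),
      C * I = 1 ∧ I * C = q := by
  let N := LinearMap.range (Matrix.toLin' q)
  let b := Module.finBasis ℤ N
  let inc : (Fin (Module.finrank ℤ N) → ℤ) →ₗ[ℤ] (Fin m → ℤ) :=
    N.subtype ∘ₗ b.equivFun.symm.toLinearMap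
  let pr : (Fin m → ℤ) →ₗ[ℤ] (Fin (Module.finrank ℤ N) → ℤ) :=
    b.equivFun.toLinearMap ∘ₗ (Matrix.toLin' q).rangeRestrict
  have hfix : ∀ y : N, (Matrix.toLin' q).rangeRestrict (y : Fin m → ℤ) = y := by
    rintro ⟨_, x, rfl⟩
    ext1
    simp only [LinearMap.codRestrict_apply, LinearMap.rangeRestrict]
    rw [← LinearMap.comp_apply, ← Matrix.toLin'_mul, hq]
  refine ⟨Module.finrank ℤ N, LinearMap.toMatrix' inc, LinearMap.toMatrix' pr, ?_, ?_⟩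
  · rw [← LinearMap.toMatrix'_comp]
    have : pr ∘ₗ inc = LinearMap.id := by
      refine LinearMap.ext fun x => ?_
      change b.equivFun ((Matrix.toLin' q).rangeRestrict (b.equivFun.symm x : N)) = x
      rw [hfix, LinearEquiv.apply_symm_apply]
    rw [this, LinearMap.toMatrix'_id]
  · rw [← LinearMap.toMatrix'_comp]
    have : inc ∘ₗ pr = Matrix.toLin' q := by
      refine LinearMap.ext fun x => ?_
      simp [pr, inc]
    rw [this, LinearMap.toMatrix'_toLin']

theorem IsUnitSystem.of_map {S S' : Type*} [Ring S] [Ring S'] (f : S →+* S')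
    (hf : Function.Injective f) {X Y : Bool → Fin n → S} {q : Bool → S} {z : S}
    (h : IsUnitSystem (fun b k => f (X b k)) (fun b k => f (Y b k)) (fun b => f (q b)) (f z)) :
    IsUnitSystem X Y q z where
  mul_same b k := hf (by simpa using h.mul_same b k)
  mul_of_ne b c j k hne := hf (by simpa using h.mul_of_ne b c j k hne)
  mul_idem b k := hf (by simpa using h.mul_idem b k)
  idem_mul b k := hf (by simpa using h.idem_mul b k)
  idem b := hf (by simpa using h.idem b)
  zero_idem := hf (by simpa using h.zero_idem)
  zero_mul b k := hf (by simpa using h.zero_mul b k)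
  mul_zero b k := hf (by simpa using h.mul_zero b k)
  sum := hf (by simpa using h.sum)

/-- The letters of an adapted basis: `Fin n` copies of `ι` and the weight zero letters `κ`. -/
abbrev Letter (n : ℕ) (ι κ : Type*) := Fin n × ι ⊕ κ

/-- The sign by which inverting `a_k` acts on a letter. -/
def letterSign {ι κ : Type*} (k : Fin n) : Letter n ι κ → ℤ
  | Sum.inl (i, _) => if i = k then -1 else 1
  | Sum.inr _ => 1

/-- The off-diagonal part of the action of a transvection on letters. -/
def shear {ι κ : Type*} [DecidableEq ι] (τ : ι → Bool) (i j : Fin n) :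
    Matrix (Letter n ι κ) (Letter n ι κ) ℤ
  | Sum.inl (k, α), Sum.inl (l, β) =>
    if α = β then
      if τ α then (if k = j ∧ l = i then 1 else 0) else (if k = i ∧ l = j then -1 else 0)
    else 0
  | _, _ => 0

/-- An integral matrix representation of `Aut(F_n)` in a basis adapted to the weights, where
`τ` distinguishes standard letters from dual ones. -/
structure IsAdapted {ι κ : Type*} [Fintype ι] [Fintype κ] [DecidableEq ι] [DecidableEq κ]
    (τ : ι → Bool) (M : MulAut (FG n) →* Matrix (Letter n ι κ) (Letter n ι κ) ℤ) : Prop where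
  map_rho : ∀ i j, i ≠ j → M (rho i j) = 1 + shear τ i j
  map_eps : ∀ i j, i ≠ j → M (eps i * eps j) = diagonal fun d => letterSign i d * letterSign j d

/-- Conjugation by a pair of mutually inverse rectangular matrices. -/
def conjRep {L G : Type*} [Fintype L] [DecidableEq L] [Monoid G]
    (Φ : G →* Matrix (Fin m) (Fin m) ℤ) (P : Matrix L (Fin m) ℤ) (P' : Matrix (Fin m) L ℤ)
    (h : P * P' = 1) (h' : P' * P = 1) : G →* Matrix L L ℤ where
  toFun g := P * Φ g * P'
  map_one' := by rw [map_one, Matrix.mul_one, h]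
  map_mul' g g' := by
    rw [map_mul]
    simp only [Matrix.mul_assoc]
    rw [← Matrix.mul_assoc P' P, h', Matrix.one_mul]

theorem conjRep_apply {L G : Type*} [Fintype L] [DecidableEq L] [Monoid G]
    (Φ : G →* Matrix (Fin m) (Fin m) ℤ) (P : Matrix L (Fin m) ℤ) (P' : Matrix (Fin m) L ℤ)
    (h : P * P' = 1) (h' : P' * P = 1) (g : G) : conjRep Φ P P' h h' g = P * Φ g * P' := rfl

theorem IsUnitSystem.exists_isAdapted {X Y : Bool → Fin n → Matrix (Fin m) (Fin m) ℤ}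
    {q : Bool → Matrix (Fin m) (Fin m) ℤ} {z : Matrix (Fin m) (Fin m) ℤ}
    (h : IsUnitSystem X Y q z) (Φ : MulAut (FG n) →* Matrix (Fin m) (Fin m) ℤ)
    (hρ : ∀ i j, i ≠ j → Φ (rho i j) = 1 + X true j * Y true i - X false i * Y false j)
    (hX : ∀ i j, i ≠ j → ∀ b k, Φ (eps i * eps j) * X b k =
      ((if k = i then -1 else 1) * (if k = j then -1 else 1) : ℤ) • X b k)
    (hz : ∀ i j, i ≠ j → Φ (eps i * eps j) * z = z) :
    ∃ (r : Bool → ℕ) (t : ℕ) (P : Matrix (Letter n (Σ b, Fin (r b)) (Fin t)) (Fin m) ℤ)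
      (P' : Matrix (Fin m) (Letter n (Σ b, Fin (r b)) (Fin t)) ℤ)
      (hP : P * P' = 1) (hP' : P' * P = 1), IsAdapted Sigma.fst (conjRep Φ P P' hP hP') := by
  choose r I C hCI hIC using fun b => exists_split_idempotent (q b) (h.idem b)
  obtain ⟨t, Iz, Cz, hCIz, hICz⟩ := exists_split_idempotent z h.zero_idem
  have hCq : ∀ b, C b * q b = C b := fun b => by
    rw [← hIC, ← Matrix.mul_assoc, hCI, Matrix.one_mul]
  have hqI : ∀ b, q b * I b = I b := fun b => by
    rw [← hIC, Matrix.mul_assoc, hCI, Matrix.mul_one]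
  have hCz : Cz * z = Cz := by rw [← hICz, ← Matrix.mul_assoc, hCIz, Matrix.one_mul]
  have hzI : z * Iz = Iz := by rw [← hICz, Matrix.mul_assoc, hCIz, Matrix.mul_one]
  let P : Matrix (Letter n (Σ b, Fin (r b)) (Fin t)) (Fin m) ℤ := Matrix.of fun d i =>
    match d with
    | Sum.inl (k, ⟨b, α⟩) => (C b * Y b k) α i
    | Sum.inr s => Cz s i
  let P' : Matrix (Fin m) (Letter n (Σ b, Fin (r b)) (Fin t)) ℤ := Matrix.of fun i d =>
    match d with
    | Sum.inl (k, ⟨b, α⟩) => (X b k * I b) i α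
    | Sum.inr s => Iz i s
  have hPP : ∀ (A : Matrix (Fin m) (Fin m) ℤ), (∀ k b α l c β,
      (P * A * P') (Sum.inl (k, ⟨b, α⟩)) (Sum.inl (l, ⟨c, β⟩)) =
        (C b * (Y b k * A * X c l) * I c) α β) ∧ (∀ k b α s,
      (P * A * P') (Sum.inl (k, ⟨b, α⟩)) (Sum.inr s) = (C b * (Y b k * A) * Iz) α s) ∧
      (∀ s l c β, (P * A * P') (Sum.inr s) (Sum.inl (l, ⟨c, β⟩)) = (Cz * (A * X c l) * I c) s β) ∧
      ∀ s s', (P * A * P') (Sum.inr s) (Sum.inr s') = (Cz * A * Iz) s s' := by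
    intro A
    refine ⟨fun k b α l c β => ?_, fun k b α s => ?_, fun s l c β => ?_, fun s s' => ?_⟩
    · have : C b * (Y b k * A * X c l) * I c = C b * Y b k * A * (X c l * I c) := by
        simp only [Matrix.mul_assoc]
      rw [this]; rfl
    · rw [← Matrix.mul_assoc (C b)]; rfl
    · have : Cz * (A * X c l) * I c = Cz * A * (X c l * I c) := by
        simp only [Matrix.mul_assoc]
      rw [this]; rfl
    · rfl
  have hYX : ∀ b k c l, (b, k) ≠ (c, l) → Y b k * X c l = 0 := fun b k c l => h.mul_of_ne b c k l
  have hYz : ∀ b k, Y b k * Iz = 0 := fun b k => by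
    rw [← hzI, ← Matrix.mul_assoc, h.mul_zero, Matrix.zero_mul]
  have hzX : ∀ b k, Cz * X b k = 0 := fun b k => by
    rw [← hCz, Matrix.mul_assoc, h.zero_mul, Matrix.mul_zero]
  have hP : P * P' = 1 := by
    obtain ⟨h1, h2, h3, h4⟩ := hPP 1
    simp only [Matrix.mul_one, Matrix.one_mul] at h1 h2 h3 h4
    ext d e
    rcases d with ⟨k, b, α⟩ | s <;> rcases e with ⟨l, c, β⟩ | s'
    · rw [h1]
      by_cases hbc : (b, k) = (c, l)
      · obtain ⟨rfl, rfl⟩ := Prod.mk.inj hbc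
        rw [h.mul_same, hCq, hCI]
        simp [Matrix.one_apply]
      · rw [hYX _ _ _ _ hbc, Matrix.mul_zero, Matrix.zero_mul, Matrix.one_apply_ne]
        · rfl
        · rintro h5
          simp only [Sum.inl.injEq, Prod.mk.injEq, Sigma.mk.injEq] at h5
          exact hbc (by rw [h5.1, h5.2.1])
    · rw [h2, Matrix.mul_assoc, hYz]
      simp
    · rw [h3, hzX]
      simp
    · rw [h4, hCIz]
      simp [Matrix.one_apply]
  have hP' : P' * P = 1 := by
    rw [← h.sum]
    ext i j
    rw [Matrix.mul_apply, Fintype.sum_sum_type, Fintype.sum_prod_type, Matrix.add_apply,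
      Finset.sum_comm, ← hICz, Matrix.sum_apply, Fintype.sum_sigma]
    congr 1
    refine Finset.sum_congr rfl fun b _ => ?_
    rw [Matrix.sum_apply, Finset.sum_comm]
    refine Finset.sum_congr rfl fun k _ => ?_
    rw [← h.mul_idem b k, ← hIC, ← Matrix.mul_assoc, Matrix.mul_assoc, Matrix.mul_apply]
    rfl
  refine ⟨r, t, P, P', hP, hP', ⟨fun i j hij => ?_, fun i j hij => ?_⟩⟩
  · rw [conjRep_apply, hρ i j hij, add_sub_assoc, Matrix.mul_add, Matrix.add_mul, Matrix.mul_one,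
      hP]
    congr 1
    have hstep : ∀ b k c l {w : ℕ} (d : Matrix (Fin m) (Fin w) ℤ), (b, k) ≠ (c, l) →
        Y b k * (X c l * d) = 0 := fun b k c l _ d hne => by
      rw [← Matrix.mul_assoc, hYX _ _ _ _ hne, Matrix.zero_mul]
    have hsame : ∀ b k {w : ℕ} (d : Matrix (Fin m) (Fin w) ℤ), Y b k * (X b k * d) = q b * d :=
        fun b k _ d => by
      rw [← Matrix.mul_assoc, h.mul_same]
    obtain ⟨h1, h2, h3, h4⟩ := hPP (X true j * Y true i)
    obtain ⟨g1, g2, g3, g4⟩ := hPP (X false i * Y false j)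
    rw [Matrix.mul_sub, Matrix.sub_mul]
    ext d e
    rw [Matrix.sub_apply]
    rcases d with ⟨k, b, α⟩ | s <;> rcases e with ⟨l, c, β⟩ | s'
    · rw [h1, g1]
      simp only [shear, Matrix.mul_assoc]
      by_cases hb : b = c
      · subst hb
        cases b
        · rw [hstep _ _ _ _ _ (by simp), Matrix.mul_zero, Matrix.zero_apply, zero_sub]
          by_cases hk : k = i
          · subst hk
            by_cases hl : l = j
            · subst hl
              rw [hsame, hsame, hqI, hqI, hCI]
              simp [Matrix.one_apply, neg_ite]
            · rw [hstep false j _ _ _ (by simpa using Ne.symm hl)]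
              simp [hl]
          · rw [hstep _ _ _ _ _ (by simpa using hk)]
            simp [hk]
        · rw [hstep true k false _ _ (by simp), Matrix.mul_zero, Matrix.zero_apply, sub_zero]
          by_cases hk : k = j
          · subst hk
            by_cases hl : l = i
            · subst hl
              rw [hsame, hsame, hqI, hqI, hCI]
              simp [Matrix.one_apply]
            · rw [hstep true i _ _ _ (by simpa using Ne.symm hl)]
              simp [hl]
          · rw [hstep _ _ _ _ _ (by simpa using hk)]
            simp [hk]
      · rw [if_neg (by rintro h6; exact hb (congrArg Sigma.fst h6))]
        cases b
        · obtain rfl : c = true := by simpa using Ne.symm hb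
          rw [hstep false k true _ _ (by simp), hstep false j true l _ (by simp)]
          simp
        · obtain rfl : c = false := by simpa using Ne.symm hb
          rw [hstep true k false _ _ (by simp), hstep true i false l _ (by simp)]
          simp
    · rw [h2, g2]
      simp only [Matrix.mul_assoc, hYz, Matrix.mul_zero, shear, sub_self, Matrix.zero_apply]
    · rw [h3, g3]
      simp only [← Matrix.mul_assoc, hzX, Matrix.zero_mul, shear, sub_self, Matrix.zero_apply]
    · rw [h4, g4]
      simp only [← Matrix.mul_assoc, hzX, Matrix.zero_mul, shear, sub_self, Matrix.zero_apply]
  · let D : Matrix (Letter n (Σ b, Fin (r b)) (Fin t)) (Letter n (Σ b, Fin (r b)) (Fin t)) ℤ :=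
      diagonal fun d => letterSign i d * letterSign j d
    have h5 : Φ (eps i * eps j) * P' = P' * D := by
      ext a e
      rw [Matrix.mul_diagonal]
      rcases e with ⟨l, c, β⟩ | s
      · change (Φ (eps i * eps j) * (X c l * I c)) a β = (X c l * I c) a β * _
        rw [← Matrix.mul_assoc, hX i j hij, Matrix.smul_mul, Matrix.smul_apply, smul_eq_mul,
          mul_comm]
        rfl
      · change (Φ (eps i * eps j) * Iz) a s = Iz a s * _
        rw [← hzI, ← Matrix.mul_assoc, hz i j hij]
        simp [letterSign]
    rw [conjRep_apply, Matrix.mul_assoc, h5, ← Matrix.mul_assoc, hP, Matrix.one_mul]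

end AdaptedBasis

section AdaptedExistence

open Matrix

variable {n m : ℕ}

theorem exists_isAdapted (hn : 6 ≤ n) (hm : m < n.choose 2)
    (Φ : MulAut (FG n) →* Matrix (Fin m) (Fin m) ℤ) (hΦ : ∀ u, Φ (MulAut.conj u) = 1) :
    ∃ (r : Bool → ℕ) (t : ℕ) (P : Matrix (Letter n (Σ b, Fin (r b)) (Fin t)) (Fin m) ℤ)
      (P' : Matrix (Fin m) (Letter n (Σ b, Fin (r b)) (Fin t)) ℤ)
      (hP : P * P' = 1) (hP' : P' * P = 1), IsAdapted Sigma.fst (conjRep Φ P P' hP hP') := by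
  let F : Matrix (Fin m) (Fin m) ℤ →+* Matrix (Fin m) (Fin m) ℚ := (Int.castRingHom ℚ).mapMatrix
  have hF : Function.Injective F := fun A B hAB => by
    ext i j
    have h1 := congrArg (fun C : Matrix (Fin m) (Fin m) ℚ => C i j) hAB
    simpa [F] using h1
  let Ψ : MulAut (FG n) →* Matrix (Fin m) (Fin m) ℚ := F.toMonoidHom.comp Φ
  have hΨ : ∀ g, Ψ g = F (Φ g) := fun g => rfl
  obtain ⟨p, h⟩ := exists_isSmallRep hn hm Ψ fun u => by rw [hΨ, hΦ, map_one]
  obtain ⟨X, Y, q, hs, hZ, hpX, hρ⟩ := h.exists_isUnitSystem fun g => ⟨Φ g, rfl⟩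
  choose X' hX' using fun b k => (hZ b k).1
  choose Y' hY' using fun b k => (hZ b k).2.1
  choose q' hq' using fun b => (hZ b ⟨0, by omega⟩).2.2
  obtain rfl : (fun b k => F (X' b k)) = X := by ext1 b; ext1 k; exact hX' b k
  obtain rfl : (fun b k => F (Y' b k)) = Y := by ext1 b; ext1 k; exact hY' b k
  obtain rfl : (fun b => F (q' b)) = q := by ext1 b; exact hq' b
  let z : Matrix (Fin m) (Fin m) ℤ := 1 - ∑ b, ∑ k, X' b k * Y' b k
  have hz : F z = zeroProj p := by
    rw [eq_sub_of_add_eq' hs.sum]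
    simp [z]
  rw [← hz] at hs
  refine (hs.of_map F hF).exists_isAdapted Φ (fun i j hij => hF ?_) (fun i j hij b k => hF ?_)
    fun i j hij => hF ?_
  · simpa [hΨ] using hρ i j hij
  · have h2 : F (Φ (eps i * eps j)) = Ψ (eps i) * Ψ (eps j) := by rw [← map_mul, hΨ]
    rw [map_mul, map_zsmul, h2, ← show p k * F (X' b k) = F (X' b k) from hpX b k,
      ← mul_assoc, mul_assoc (Ψ (eps i))]
    by_cases hi : k = i
    · subst hi
      rw [h.eps_mul_neg_left hij]
      simp [hij]
    · by_cases hj : k = j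
      · subst hj
        rw [h.eps_mul_neg_right hij]
        simp [hi]
      · rw [h.eps_mul_fix (Ne.symm hi) (Ne.symm hj)]
        simp [hi, hj]
  · have h2 : F (Φ (eps i * eps j)) = Ψ (eps i) * Ψ (eps j) := by rw [← map_mul, hΨ]
    rw [map_mul, hz, h2, mul_assoc, h.eps_mul_zeroProj hij]

theorem IsAdapted.rho_eq_one_of_isEmpty {ι κ : Type*} [Fintype ι] [Fintype κ] [DecidableEq ι]
    [DecidableEq κ] [IsEmpty ι] {τ : ι → Bool}
    {M : MulAut (FG n) →* Matrix (Letter n ι κ) (Letter n ι κ) ℤ} (h : IsAdapted τ M)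
    {i j : Fin n} (hij : i ≠ j) : M (rho i j) = 1 := by
  rw [h.map_rho i j hij]
  ext d e
  rcases d with ⟨_, α⟩ | s
  · exact isEmptyElim α
  · simp [shear]

end AdaptedExistence

/-! ### Magnus coefficients up to degree three -/

section Magnus

open FreeGroup (of)
open Matrix

/-- The group of truncated noncommutative power series `1 + a + b + c` with constant term one,
modulo degree four. -/
@[ext] structure TruncatedSeries (L : Type*) where
  /-- the part of degree one -/
  a : L → ℤ
  /-- the part of degree two -/
  b : L → L → ℤ
  /-- the part of degree three -/
  c : L → L → L → ℤ

namespace TruncatedSeries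

variable {L : Type*}

instance : Mul (TruncatedSeries L) := ⟨fun s t =>
  ⟨fun i => s.a i + t.a i, fun i j => s.b i j + t.b i j + s.a i * t.a j,
    fun i j k => s.c i j k + t.c i j k + s.a i * t.b j k + s.b i j * t.a k⟩⟩

instance : One (TruncatedSeries L) := ⟨⟨fun _ => 0, fun _ _ => 0, fun _ _ _ => 0⟩⟩

instance : Inv (TruncatedSeries L) := ⟨fun s =>
  ⟨fun i => -s.a i, fun i j => -s.b i j + s.a i * s.a j,
    fun i j k => -s.c i j k + s.a i * s.b j k + s.b i j * s.a k - s.a i * s.a j * s.a k⟩⟩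

theorem mul_a (s t : TruncatedSeries L) (i) : (s * t).a i = s.a i + t.a i := rfl

theorem mul_b (s t : TruncatedSeries L) (i j) :
    (s * t).b i j = s.b i j + t.b i j + s.a i * t.a j := rfl

theorem mul_c (s t : TruncatedSeries L) (i j k) :
    (s * t).c i j k = s.c i j k + t.c i j k + s.a i * t.b j k + s.b i j * t.a k := rfl

theorem one_a (i) : (1 : TruncatedSeries L).a i = 0 := rfl

theorem one_b (i j) : (1 : TruncatedSeries L).b i j = 0 := rfl

theorem one_c (i j k) : (1 : TruncatedSeries L).c i j k = 0 := rfl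

theorem inv_a (s : TruncatedSeries L) (i) : s⁻¹.a i = -s.a i := rfl

theorem inv_b (s : TruncatedSeries L) (i j) : s⁻¹.b i j = -s.b i j + s.a i * s.a j := rfl

theorem inv_c (s : TruncatedSeries L) (i j k) :
    s⁻¹.c i j k = -s.c i j k + s.a i * s.b j k + s.b i j * s.a k - s.a i * s.a j * s.a k := rfl

instance : Group (TruncatedSeries L) := Group.ofLeftAxioms
  (fun s t w => by
    ext <;> simp only [mul_a, mul_b, mul_c] <;> ring)
  (fun s => by
    ext <;> simp only [mul_a, mul_b, mul_c, one_a, one_b, one_c] <;> ring)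
  (fun s => by
    ext <;> simp only [mul_a, mul_b, mul_c, one_a, one_b, one_c, inv_a, inv_b, inv_c] <;> ring)

end TruncatedSeries

variable {m : ℕ} {L : Type*} [Fintype L] [DecidableEq L]

/-- Coefficients of degree at most three of a Magnus expansion of a free group, with respect to a
basis of the abelianization indexed by `L`. -/
structure IsMagnus (c₁ : FG m → L → ℤ) (c₂ : FG m → Matrix L L ℤ) (c₃ : FG m → L → L → L → ℤ) :
    Prop where
  one_mul : ∀ x y, c₁ (x * y) = c₁ x + c₁ y
  two_mul : ∀ x y, c₂ (x * y) = c₂ x + c₂ y + vecMulVec (c₁ x) (c₁ y)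
  three_mul : ∀ x y a b c, c₃ (x * y) a b c =
    c₃ x a b c + c₃ y a b c + c₁ x a * c₂ y b c + c₂ x a b * c₁ y c
  shuffle : ∀ x a b, c₂ x a b + c₂ x b a = c₁ x a * c₁ x b - if a = b then c₁ x a else 0
  surj : ∀ v, ∃ x, c₁ x = v
  factor : ∀ h : FG m → ℤ, (∀ x y, h (x * y) = h x + h y) →
    ∃ k : L → ℤ, ∀ x, h x = ∑ d, c₁ x d * k d

theorem exists_expo_eq (w : Fin m → ℤ) : ∃ x : FG m, ∀ i, expo i x = w i := by
  refine ⟨((List.finRange m).map fun k => (FreeGroup.of k : FG m) ^ w k).prod, fun i => ?_⟩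
  rw [expo, map_list_prod, List.map_map, toAdd_list_sum, List.map_map, ← Fin.sum_univ_def]
  simp [expSum_of, toAdd_zpow]

theorem exists_isMagnus (P : Matrix L (Fin m) ℤ) (P' : Matrix (Fin m) L ℤ) (hP : P * P' = 1)
    (hP' : P' * P = 1) :
    ∃ (c₁ : FG m → L → ℤ) (c₂ : FG m → Matrix L L ℤ) (c₃ : FG m → L → L → L → ℤ),
      IsMagnus c₁ c₂ c₃ ∧ ∀ f x, c₁ (f x) = (P * abMat f * P') *ᵥ c₁ x := by
  let e := Fintype.equivFin L
  let κ : FG m →* TruncatedSeries L := FreeGroup.lift fun i =>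
    ⟨fun a => P a i, fun a b => if e a < e b then P a i * P b i else
      if a = b then P a i * (P a i - 1) / 2 else 0, fun _ _ _ => 0⟩
  have hκ : ∀ i, κ (of i) = ⟨fun a => P a i, fun a b => if e a < e b then P a i * P b i else
      if a = b then P a i * (P a i - 1) / 2 else 0, fun _ _ _ => 0⟩ := fun i => by simp [κ]
  have h1 : ∀ x y, (κ (x * y)).a = (κ x).a + (κ y).a := fun x y => by
    ext; rw [map_mul, TruncatedSeries.mul_a]; rfl
  have hc1 : ∀ x, (κ x).a = P *ᵥ fun i => expo i x := fun x => by
    rw [additive_eq_sum (fun x => (κ x).a) h1 x]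
    ext d
    simp [hκ, Matrix.mulVec, dotProduct, mul_comm]
  have hexp : ∀ x, (fun i => expo i x) = P' *ᵥ (κ x).a := fun x => by
    rw [hc1, Matrix.mulVec_mulVec, hP', Matrix.one_mulVec]
  refine ⟨fun x => (κ x).a, fun x => Matrix.of (κ x).b, fun x => (κ x).c,
    ⟨h1, fun x y => ?_, fun x y a b c => ?_, fun x => ?_, fun v => ?_, fun h hmul => ?_⟩,
    fun f x => ?_⟩
  · ext a b
    simp only [map_mul, Matrix.of_apply, Matrix.add_apply, TruncatedSeries.mul_b]
    rfl
  · simp only [map_mul, TruncatedSeries.mul_c, Matrix.of_apply]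
  · simp only [Matrix.of_apply]
    induction x using FreeGroup.induction_on with
    | C1 => simp [TruncatedSeries.one_a, TruncatedSeries.one_b]
    | of i =>
      intro a b
      rw [hκ]
      simp only
      by_cases hab : a = b
      · subst hab
        have := Int.ediv_mul_cancel (Int.even_mul_pred_self (P a i)).two_dvd
        simp only [lt_self_iff_false, if_false, if_true]
        linear_combination this
      · rcases lt_or_gt_of_ne (fun h => hab (e.injective h)) with h | h
        · simp [h, h.not_gt, hab, Ne.symm hab]
        · simp [h, h.not_gt, hab, mul_comm]
    | inv_of i hi =>
      intro a b
      have := hi a b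
      change (κ (of i)⁻¹).b a b + (κ (of i)⁻¹).b b a =
        (κ (of i)⁻¹).a a * (κ (of i)⁻¹).a b - if a = b then (κ (of i)⁻¹).a a else 0
      change (κ (of i)).b a b + (κ (of i)).b b a =
        (κ (of i)).a a * (κ (of i)).a b - if a = b then (κ (of i)).a a else 0 at this
      simp only [map_inv, TruncatedSeries.inv_a, TruncatedSeries.inv_b]
      split_ifs at this ⊢ with hab
      · linear_combination -this
      · linear_combination -this
    | mul x y hx hy =>
      intro a b
      have h2 := hx a b
      have h3 := hy a b
      simp only [map_mul, TruncatedSeries.mul_a, TruncatedSeries.mul_b]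
      split_ifs at h2 h3 ⊢ with hab
      · subst hab
        linear_combination h2 + h3
      · linear_combination h2 + h3
  · obtain ⟨x, hx⟩ := exists_expo_eq (P' *ᵥ v)
    refine ⟨x, ?_⟩
    rw [hc1, funext hx, Matrix.mulVec_mulVec, hP, Matrix.one_mulVec]
  · refine ⟨fun d => ∑ i, P' i d * h (of i), fun x => ?_⟩
    rw [additive_eq_sum h hmul x]
    have h2 : ∀ i, expo i x = ∑ d, P' i d * (κ x).a d := fun i => congrFun (hexp x) i
    simp only [h2, smul_eq_mul, Finset.sum_mul, Finset.mul_sum]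
    rw [Finset.sum_comm]
    exact Finset.sum_congr rfl fun d _ => Finset.sum_congr rfl fun i _ => by ring
  · have h2 : (fun i => expo i (f x)) = abMat f *ᵥ fun i => expo i x := by
      ext i
      exact expo_apply f i x
    change (κ (f x)).a = _
    rw [hc1 (f x), h2, hexp, ← Matrix.mulVec_mulVec, ← Matrix.mulVec_mulVec]

end Magnus

/-! ### Action of automorphisms on Magnus coefficients -/

section Jet

open Matrix

variable {m : ℕ} {L : Type*} [Fintype L] [DecidableEq L] {c₁ : FG m → L → ℤ}
  {c₂ : FG m → Matrix L L ℤ} {c₃ : FG m → L → L → L → ℤ}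

/-- The automorphism `f` acts on Magnus coefficients of degree one by `A` and on those of degree
two through `A` with correction term `σ`. -/
structure IsJet (c₁ : FG m → L → ℤ) (c₂ : FG m → Matrix L L ℤ) (f : MulAut (FG m))
    (A : Matrix L L ℤ) (σ : L → Matrix L L ℤ) : Prop where
  one : ∀ x, c₁ (f x) = A *ᵥ c₁ x
  two : ∀ x, c₂ (f x) = A * c₂ x * Aᵀ + ∑ d, c₁ x d • σ d

namespace IsMagnus

theorem one_conj (h : IsMagnus c₁ c₂ c₃) (w y : FG m) : c₁ (MulAut.conj w y) = c₁ y := by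
  have := h.one_mul (MulAut.conj w y) w
  rw [MulAut.conj_apply, inv_mul_cancel_right, h.one_mul w y, add_comm] at this
  exact (add_right_cancel this).symm

theorem two_conj (h : IsMagnus c₁ c₂ c₃) (w y : FG m) (a b : L) :
    c₂ (MulAut.conj w y) a b = c₂ y a b + (c₁ w a * c₁ y b - c₁ y a * c₁ w b) := by
  have h2 := h.two_mul (MulAut.conj w y) w
  rw [h.one_conj, MulAut.conj_apply, inv_mul_cancel_right, h.two_mul w y] at h2
  have := congrArg (fun M : Matrix L L ℤ => M a b) h2
  simp only [Matrix.add_apply, vecMulVec_apply] at this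
  rw [MulAut.conj_apply]
  linear_combination -this

theorem three_conj (h : IsMagnus c₁ c₂ c₃) {w : FG m} (hw : c₁ w = 0) (y : FG m) (a b c : L) :
    c₃ (MulAut.conj w y) a b c = c₃ y a b c + (c₂ w a b * c₁ y c - c₁ y a * c₂ w b c) := by
  have h2 := h.three_mul (MulAut.conj w y) w a b c
  rw [h.one_conj, MulAut.conj_apply, inv_mul_cancel_right, h.three_mul w y, hw] at h2
  simp only [Pi.zero_apply, zero_mul, mul_zero] at h2
  rw [MulAut.conj_apply]
  linear_combination -h2

theorem exists_isJet (h : IsMagnus c₁ c₂ c₃) {f : MulAut (FG m)} {A : Matrix L L ℤ}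
    (hf : ∀ x, c₁ (f x) = A *ᵥ c₁ x) : ∃ σ, IsJet c₁ c₂ f A σ := by
  have hadd : ∀ x y, c₂ (f (x * y)) - A * c₂ (x * y) * Aᵀ =
      (c₂ (f x) - A * c₂ x * Aᵀ) + (c₂ (f y) - A * c₂ y * Aᵀ) := fun x y => by
    rw [map_mul, h.two_mul, h.two_mul, hf, hf, Matrix.mul_add, Matrix.mul_add, Matrix.add_mul,
      Matrix.add_mul, Matrix.mul_vecMulVec, Matrix.vecMulVec_mul, Matrix.vecMul_transpose]
    abel
  have hk := fun a b => h.factor (fun x => (c₂ (f x) - A * c₂ x * Aᵀ) a b) fun x y =>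
    congrArg (fun M : Matrix L L ℤ => M a b) (hadd x y)
  choose k hk using hk
  refine ⟨fun d => Matrix.of fun a b => k a b d, hf, fun x => ?_⟩
  ext a b
  have := hk a b x
  rw [Matrix.sub_apply] at this
  simp only [Matrix.add_apply, Matrix.sum_apply, Matrix.smul_apply, Matrix.of_apply, smul_eq_mul]
  linear_combination this

end IsMagnus

namespace IsJet

variable {f g : MulAut (FG m)} {A B : Matrix L L ℤ} {σ τ : L → Matrix L L ℤ}

theorem mul (hf : IsJet c₁ c₂ f A σ) (hg : IsJet c₁ c₂ g B τ) :
    IsJet c₁ c₂ (f * g) (A * B) (fun d => ∑ d', B d' d • σ d' + A * τ d * Aᵀ) := by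
  refine ⟨fun x => ?_, fun x => ?_⟩
  · rw [MulAut.mul_apply, hf.one, hg.one, Matrix.mulVec_mulVec]
  · rw [MulAut.mul_apply, hf.two, hg.two, hg.one, Matrix.transpose_mul]
    simp only [smul_add, Finset.sum_add_distrib, Matrix.mul_add, Matrix.add_mul,
      Finset.smul_sum, Matrix.mul_sum, Matrix.sum_mul, Matrix.mul_smul, Matrix.smul_mul,
      Matrix.mul_assoc, Matrix.mulVec, dotProduct, Finset.sum_smul, smul_smul]
    rw [Finset.sum_comm (f := fun d d' => (B d d' * c₁ x d') • σ d)]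
    simp only [mul_comm]
    abel

theorem eq_of_one (h : IsMagnus c₁ c₂ c₃) (hf : IsJet c₁ c₂ f A σ) (hf' : IsJet c₁ c₂ f A τ) :
    σ = τ := by
  funext d
  obtain ⟨x, hx⟩ := h.surj (Pi.single d 1)
  have h2 := hf.two x
  rw [hf'.two x, hx] at h2
  simpa [Pi.single_apply] using h2.symm

theorem conj_mul (h : IsMagnus c₁ c₂ c₃) (w : FG m) (hf : IsJet c₁ c₂ f A σ) :
    IsJet c₁ c₂ (MulAut.conj w * f) A
      (fun d => Matrix.of fun a b => σ d a b + (c₁ w a * A b d - A a d * c₁ w b)) := by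
  refine ⟨fun x => ?_, fun x => ?_⟩
  · rw [MulAut.mul_apply, h.one_conj, hf.one]
  · ext a b
    rw [MulAut.mul_apply, h.two_conj, hf.one, hf.two]
    simp only [Matrix.add_apply, Matrix.sum_apply, Matrix.smul_apply, Matrix.of_apply,
      smul_eq_mul, Matrix.mulVec, dotProduct, mul_add, mul_sub, Finset.sum_add_distrib,
      Finset.sum_sub_distrib, Finset.mul_sum, Finset.sum_mul]
    rw [add_assoc]
    congr 3
    · exact Finset.sum_congr rfl fun _ _ => by ring
    · exact Finset.sum_congr rfl fun _ _ => by ring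

theorem shuffle (h : IsMagnus c₁ c₂ c₃) (hf : IsJet c₁ c₂ f A σ) (d a b : L) :
    σ d a b + σ d b a = A a d * A b d - if a = b then A a d else 0 := by
  obtain ⟨x, hx⟩ := h.surj (Pi.single d 1)
  have h0 : c₂ x + (c₂ x)ᵀ = 0 := by
    ext p q
    rw [Matrix.add_apply, Matrix.transpose_apply, h.shuffle, hx, Matrix.zero_apply]
    by_cases hpq : p = q
    · subst hpq
      by_cases hp : p = d <;> simp [hp]
    · by_cases hp : p = d
      · simp [hpq, Ne.symm hpq, ← hp]
      · simp [hpq, hp]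
  have h1 : c₂ (f x) + (c₂ (f x))ᵀ = σ d + (σ d)ᵀ := by
    have h2 : c₂ (f x) + (c₂ (f x))ᵀ = A * (c₂ x + (c₂ x)ᵀ) * Aᵀ + (σ d + (σ d)ᵀ) := by
      rw [hf.two, hx]
      simp only [Pi.single_apply, ite_smul, one_smul, zero_smul, Finset.sum_ite_eq',
        Finset.mem_univ, if_true, Matrix.transpose_add, Matrix.transpose_mul,
        Matrix.transpose_transpose, Matrix.mul_add, Matrix.add_mul, Matrix.mul_assoc]
      abel
    rw [h2, h0, Matrix.mul_zero, Matrix.zero_mul, zero_add]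
  have h3 := congrArg (fun M : Matrix L L ℤ => M a b) h1
  simp only [Matrix.add_apply, Matrix.transpose_apply] at h3
  rw [← h3, h.shuffle, hf.one, hx]
  simp

theorem exists_three (h : IsMagnus c₁ c₂ c₃) (hf : IsJet c₁ c₂ f 1 σ) :
    ∃ κ : L → L → L → L → ℤ, ∀ x a b c, c₃ (f x) a b c = c₃ x a b c +
      (∑ p, c₂ x p c * σ p a b + ∑ q, c₂ x a q * σ q b c) + ∑ d, c₁ x d * κ d a b c := by
  have hk := fun a b c => h.factor (fun x => c₃ (f x) a b c - c₃ x a b c -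
    (∑ p, c₂ x p c * σ p a b + ∑ q, c₂ x a q * σ q b c)) fun x y => by
      simp only [map_mul, h.three_mul, h.two_mul, hf.one, hf.two, Matrix.one_mulVec,
        Matrix.one_mul, Matrix.transpose_one, Matrix.mul_one, Matrix.add_apply,
        Matrix.sum_apply, Matrix.smul_apply, smul_eq_mul, vecMulVec_apply, mul_add, add_mul,
        Finset.sum_add_distrib, Finset.mul_sum, Finset.sum_mul]
      have e1 : ∑ p, c₁ x p * c₁ y c * σ p a b = ∑ p, c₁ x p * σ p a b * c₁ y c :=
        Finset.sum_congr rfl fun _ _ => by ring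
      have e2 : ∑ q, c₁ x a * c₁ y q * σ q b c = ∑ q, c₁ x a * (c₁ y q * σ q b c) :=
        Finset.sum_congr rfl fun _ _ => by ring
      rw [e1, e2]
      ring
  choose κ hκ using hk
  exact ⟨fun d a b c => κ a b c d, fun x a b c => by linear_combination hκ a b c x⟩

theorem exists_bracket [Nontrivial L] (h : IsMagnus c₁ c₂ c₃) (hf : IsJet c₁ c₂ f 1 σ)
    (hg : IsJet c₁ c₂ g 1 τ) {w : FG m} (hfg : f * g = MulAut.conj w * (g * f)) :
    ∃ C : L → L → ℤ, ∀ d a b c,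
      (∑ p, τ d p c * σ p a b + ∑ q, τ d a q * σ q b c) -
        (∑ p, σ d p c * τ p a b + ∑ q, σ d a q * τ q b c) =
      (if c = d then C a b else 0) - if a = d then C b c else 0 := by
  have hw : c₁ w = 0 := by
    funext a
    obtain ⟨d, hd⟩ := exists_ne a
    have h1 := hf.mul hg
    rw [hfg] at h1
    have h2 := eq_of_one h h1 ((hg.mul hf).conj_mul h w)
    have h3 := congrArg (fun M : Matrix L L ℤ => M a d) (congrFun h2 d)
    simpa [Matrix.one_apply, hd.symm, Finset.sum_apply, Matrix.sum_apply, ite_smul,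
      add_comm] using h3
  obtain ⟨κ, hκ⟩ := hf.exists_three h
  obtain ⟨κ', hκ'⟩ := hg.exists_three h
  refine ⟨c₂ w, fun d a b c => ?_⟩
  obtain ⟨x, hx⟩ := h.surj (Pi.single d 1)
  have h1 : c₃ (f (g x)) a b c = c₃ (MulAut.conj w (g (f x))) a b c := by
    rw [← MulAut.mul_apply, hfg]
    rfl
  rw [h.three_conj hw, hκ, hκ', hκ', hκ] at h1
  simp only [hg.one, hf.one, hf.two, hg.two, Matrix.one_mulVec, one_mul,
    Matrix.transpose_one, mul_one, Matrix.add_apply, Matrix.sum_apply, Matrix.smul_apply, smul_eq_mul,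
    hx, Pi.single_apply, ite_mul, zero_mul,
    Finset.sum_ite_eq', Finset.mem_univ, if_true, add_mul, Finset.sum_add_distrib,
    mul_ite, mul_zero] at h1
  linear_combination h1

end IsJet

end Jet

/-! ### Johnson cocycles -/

section Johnson

open Matrix

/-- `Jo g σ` says that `σ` describes the action of a lift of `g` on Magnus coefficients of degree
two, the action in degree one being given by `M`. The values of `σ` are unique up to the
contribution of inner automorphisms. -/
structure IsJohnson {n : ℕ} {L R : Type*} [Fintype L] [DecidableEq L] [CommRing R]
    (M : MulAut (FG n) →* Matrix L L R) (Jo : MulAut (FG n) → (L → Matrix L L R) → Prop) :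
    Prop where
  exists_val : ∀ g, ∃ σ, Jo g σ
  mul : ∀ {g h σ τ}, Jo g σ → Jo h τ →
    Jo (g * h) fun d => ∑ d', M h d' d • σ d' + M g * τ d * (M g)ᵀ
  diff : ∀ {g σ σ'}, Jo g σ → Jo g σ' → ∃ u : L → R, ∀ d a b,
    σ' d a b = σ d a b + (u a * M g b d - M g a d * u b)
  shift : ∀ {g σ}, Jo g σ → ∀ u : L → R,
    Jo g fun d => Matrix.of fun a b => σ d a b + (u a * M g b d - M g a d * u b)
  shuffle : ∀ {g σ}, Jo g σ → ∀ d a b,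
    σ d a b + σ d b a = M g a d * M g b d - if a = b then M g a d else 0
  map_conj : ∀ u, M (MulAut.conj u) = 1
  inner : ∀ u, Jo (MulAut.conj u) 0

/-- Lifts of `g` and `h` acting trivially in degree one commute up to an inner automorphism, as
seen on Magnus coefficients of degree three. -/
def HasBracket {n : ℕ} {L R : Type*} [Fintype L] [DecidableEq L] [CommRing R]
    (Jo : MulAut (FG n) → (L → Matrix L L R) → Prop) (g h : MulAut (FG n)) : Prop :=
  ∀ σ τ, Jo g σ → Jo h τ → ∃ C : L → L → R, ∀ d a b c,
    (∑ p, τ d p c * σ p a b + ∑ q, τ d a q * σ q b c) -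
      (∑ p, σ d p c * τ p a b + ∑ q, σ d a q * τ q b c) =
    (if c = d then C a b else 0) - if a = d then C b c else 0

variable {n m : ℕ} {L : Type*} [Fintype L] [DecidableEq L]

theorem exists_isJohnson [Nontrivial L] (ψ : MulAut (FG n) →* OutFG m)
    (hψ : ∀ u, ψ (MulAut.conj u) = 1) (P : Matrix L (Fin m) ℤ) (P' : Matrix (Fin m) L ℤ)
    (hP : P * P' = 1) (hP' : P' * P = 1) :
    ∃ Jo, IsJohnson (conjRep ((outMat m).comp ψ) P P' hP hP') Jo ∧ ∀ g h,
      conjRep ((outMat m).comp ψ) P P' hP hP' g = 1 →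
      conjRep ((outMat m).comp ψ) P P' hP hP' h = 1 → g * h = h * g → HasBracket Jo g h := by
  obtain ⟨c₁, c₂, c₃, hc, h1⟩ := exists_isMagnus P P' hP hP'
  set M := conjRep ((outMat m).comp ψ) P P' hP hP' with hM
  have hlift : ∀ g f, toOut m f = ψ g → P * abMat f * P' = M g := fun g f hf => by
    rw [hM, conjRep_apply, MonoidHom.comp_apply, ← hf, outMat_toOut]
  have hconj : ∀ u, M (MulAut.conj u) = 1 := fun u => by
    rw [hM, conjRep_apply, MonoidHom.comp_apply, hψ, map_one, Matrix.mul_one, hP]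
  refine ⟨fun g σ => ∃ f, toOut m f = ψ g ∧ IsJet c₁ c₂ f (M g) σ, ⟨?_, ?_, ?_, ?_, ?_, hconj,
    ?_⟩, ?_⟩
  · intro g
    obtain ⟨f, hf⟩ := toOut_surjective m (ψ g)
    obtain ⟨σ, hσ⟩ := hc.exists_isJet (f := f) (A := M g) fun x => by rw [h1, hlift g f hf]
    exact ⟨σ, f, hf, hσ⟩
  · rintro g h σ τ ⟨f, hf, hσ⟩ ⟨f', hf', hτ⟩
    refine ⟨f * f', by rw [map_mul, hf, hf', map_mul], ?_⟩
    rw [map_mul M]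
    exact hσ.mul hτ
  · rintro g σ σ' ⟨f, hf, hσ⟩ ⟨f', hf', hσ'⟩
    obtain ⟨w, rfl⟩ := (toOut_eq_iff f' f).1 (hf'.trans hf.symm)
    refine ⟨c₁ w, fun d a b => ?_⟩
    rw [IsJet.eq_of_one hc hσ' (hσ.conj_mul hc w)]
    rfl
  · rintro g σ ⟨f, hf, hσ⟩ u
    obtain ⟨w, rfl⟩ := hc.surj u
    refine ⟨MulAut.conj w * f, ?_, hσ.conj_mul hc w⟩
    rw [map_mul, toOut_conj, one_mul, hf]
  · rintro g σ ⟨f, -, hσ⟩ d a b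
    exact hσ.shuffle hc d a b
  · intro u
    refine ⟨1, by rw [hψ, map_one], fun x => ?_, fun x => ?_⟩
    · rw [hconj, Matrix.one_mulVec, MulAut.one_apply]
    · simp [hconj]
  · rintro g h hg hh hgh σ τ ⟨f, hf, hσ⟩ ⟨f', hf', hτ⟩
    rw [hg] at hσ
    rw [hh] at hτ
    obtain ⟨w, hw⟩ := (toOut_eq_iff (f * f') (f' * f)).1 (by
      rw [map_mul, map_mul, hf, hf', ← map_mul, hgh, map_mul])
    exact hσ.exists_bracket hc hτ hw

variable {R S : Type*} [CommRing R] [CommRing S] {M : MulAut (FG n) →* Matrix L L R}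
  {Jo : MulAut (FG n) → (L → Matrix L L R) → Prop}

theorem HasBracket.map {g h : MulAut (FG n)} (hb : HasBracket Jo g h) (F : R →+* S) :
    HasBracket (fun g σ => ∃ σ₀, Jo g σ₀ ∧ σ = fun d => (σ₀ d).map F) g h := by
  rintro σ τ ⟨σ₀, hσ, rfl⟩ ⟨τ₀, hτ, rfl⟩
  obtain ⟨C, hC⟩ := hb σ₀ τ₀ hσ hτ
  refine ⟨fun a b => F (C a b), fun d a b c => ?_⟩
  have := congrArg F (hC d a b c)
  simpa [apply_ite F] using this

theorem IsJohnson.map (h : IsJohnson M Jo) (F : R →+* S) (hF : Function.Surjective F) :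
    IsJohnson (F.mapMatrix.toMonoidHom.comp M)
      fun g σ => ∃ σ₀, Jo g σ₀ ∧ σ = fun d => (σ₀ d).map F where
  exists_val g := by
    obtain ⟨σ, hσ⟩ := h.exists_val g
    exact ⟨_, σ, hσ, rfl⟩
  mul := by
    rintro g g' σ τ ⟨σ₀, hσ, rfl⟩ ⟨τ₀, hτ, rfl⟩
    refine ⟨_, h.mul hσ hτ, ?_⟩
    funext d
    ext a b
    simp [Matrix.sum_apply, Matrix.mul_apply]
  diff := by
    rintro g σ σ' ⟨σ₀, hσ, rfl⟩ ⟨σ₀', hσ', rfl⟩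
    obtain ⟨u, hu⟩ := h.diff hσ hσ'
    refine ⟨fun a => F (u a), fun d a b => ?_⟩
    simp [hu]
  shift := by
    rintro g σ ⟨σ₀, hσ, rfl⟩ u
    choose v hv using fun a => hF (u a)
    refine ⟨_, h.shift hσ v, ?_⟩
    funext d
    ext a b
    simp [hv]
  shuffle := by
    rintro g σ ⟨σ₀, hσ, rfl⟩ d a b
    have := congrArg F (h.shuffle hσ d a b)
    simpa [apply_ite F] using this
  map_conj u := by
    rw [MonoidHom.comp_apply, h.map_conj, map_one]
  inner u := ⟨0, h.inner u, by funext d; ext; simp⟩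

end Johnson

/-! ### Normal form of the cocycle on partial conjugations -/

section Normalisation

open Matrix

variable {n : ℕ}

namespace IsJohnson

section General

variable {L R : Type*} [Fintype L] [DecidableEq L] [CommRing R]
  {M : MulAut (FG n) →* Matrix L L R} {Jo : MulAut (FG n) → (L → Matrix L L R) → Prop}
  {g g' w : MulAut (FG n)} {σ σ' : L → Matrix L L R}

theorem mul_of_eq_one (h : IsJohnson M Jo) (hg : M g = 1) (hg' : M g' = 1) (hσ : Jo g σ)
    (hσ' : Jo g' σ') : Jo (g * g') (σ + σ') := by
  have := h.mul hσ hσ'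
  convert this using 1
  funext d
  simp [hg, hg', Matrix.one_apply, ite_smul]

theorem inv_of_eq_one (h : IsJohnson M Jo) (hg : M g = 1) (hσ : Jo g σ) : Jo g⁻¹ (-σ) := by
  have hg' : M g⁻¹ = 1 := by
    have h1 := map_mul M g g⁻¹
    rwa [mul_inv_cancel, map_one, hg, Matrix.one_mul, eq_comm] at h1
  obtain ⟨τ, hτ⟩ := h.exists_val g⁻¹
  have h1 := h.mul_of_eq_one hg hg' hσ hτ
  rw [mul_inv_cancel] at h1
  have h0 : Jo 1 0 := by simpa using h.inner 1
  obtain ⟨u, hu⟩ := h.diff h1 h0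
  convert h.shift hτ u using 1
  funext d
  ext a b
  have := hu d a b
  rw [map_one] at this
  simp only [Pi.add_apply, Pi.zero_apply, Matrix.add_apply, Matrix.zero_apply] at this
  simp only [Pi.neg_apply, Matrix.neg_apply, Matrix.of_apply, hg']
  linear_combination this

theorem zpow_of_eq_one (h : IsJohnson M Jo) (hg : M g = 1) (hσ : Jo g σ) {z : ℤ}
    (hz : z = 1 ∨ z = -1) : Jo (g ^ z) (fun d => z • σ d) := by
  rcases hz with rfl | rfl
  · simpa using hσ
  · have := h.inv_of_eq_one hg hσ
    rw [_root_.zpow_neg_one]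
    convert this using 1
    funext d
    simp

theorem semiconj (h : IsJohnson M Jo) (hw : w * g = g' * w) (hg : M g = 1) (hg' : M g' = 1)
    (hσ : Jo g σ) (hσ' : Jo g' σ') : ∃ u : L → R, ∀ d a b,
      (M w * σ d * (M w)ᵀ) a b =
        ∑ d', M w d' d * σ' d' a b + (u a * M w b d - M w a d * u b) := by
  obtain ⟨s, hs⟩ := h.exists_val w
  have h1 := h.mul hσ' hs
  have h2 := h.mul hs hσ
  rw [hw] at h2
  obtain ⟨u, hu⟩ := h.diff h1 h2
  refine ⟨u, fun d a b => ?_⟩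
  have := hu d a b
  simp only [map_mul, hg, hg', Matrix.add_apply, Matrix.sum_apply,
    Matrix.smul_apply, smul_eq_mul, Matrix.one_apply, ite_mul, one_mul, zero_mul,
    Finset.sum_ite_eq', Finset.mem_univ, if_true, Matrix.transpose_one, Matrix.mul_one] at this
  linear_combination this

end General

end IsJohnson

theorem eps_mul_pc {i j : Fin n} (hij : i ≠ j) (k : Fin n) :
    eps k * pc i j = pc i j ^ (if k = j then -1 else 1 : ℤ) * eps k := by
  by_cases hkj : k = j
  · subst hkj
    rw [if_pos rfl, _root_.zpow_neg_one, tw_inv hij, eps_tw_right hij]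
  · rw [if_neg hkj, zpow_one]
    by_cases hki : k = i
    · subst hki
      rw [eps_tw_left hij, neg_neg]
    · exact eps_tw_of_ne hij hki hkj _ _

theorem eps_eps_mul_pc {i j : Fin n} (hij : i ≠ j) (k l : Fin n) :
    eps k * eps l * pc i j = pc i j ^ ((if k = j then -1 else 1) * (if l = j then -1 else 1) : ℤ) *
      (eps k * eps l) := by
  have h1 : SemiconjBy (eps k) (pc i j) (pc i j ^ (if k = j then -1 else 1 : ℤ)) :=
    eps_mul_pc hij k
  rw [mul_assoc, eps_mul_pc hij l, ← mul_assoc,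
    (h1.zpow_right (if l = j then -1 else 1 : ℤ)).eq, ← _root_.zpow_mul, mul_assoc]

theorem letterSign_eq {ι κ : Type*} (k : Fin n) (a : Letter n ι κ) :
    letterSign k a = 1 ∨ letterSign k a = -1 := by
  rcases a with ⟨i, α⟩ | t
  · by_cases h : i = k <;> simp [letterSign, h]
  · simp [letterSign]

section Adapted

variable {ι κ : Type*} [Fintype ι] [Fintype κ] [DecidableEq ι] [DecidableEq κ] {τ : ι → Bool}
  {M : MulAut (FG n) →* Matrix (Letter n ι κ) (Letter n ι κ) ℤ}

theorem IsAdapted.map_lam (h : IsAdapted τ M) {i j : Fin n} (hij : i ≠ j) :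
    M (lam i j) = M (rho i j) := by
  have h1 := congrArg M (eps_eps_rho hij)
  rw [map_mul, map_mul M (lam i j)] at h1
  have h2 : M (eps i * eps j) * M (eps i * eps j) = 1 := by
    rw [← map_mul, ← map_one M]
    congr 1
    rw [← mul_assoc, mul_assoc (eps i), ← eps_comm i j, ← mul_assoc, eps_mul_self, one_mul,
      eps_mul_self]
  have h3 : M (eps i * eps j) * M (rho i j) = M (rho i j) * M (eps i * eps j) := by
    rw [h.map_eps i j hij, h.map_rho i j hij, Matrix.mul_add, Matrix.add_mul, Matrix.mul_one,
      Matrix.one_mul]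
    congr 1
    ext a b
    rw [Matrix.diagonal_mul, Matrix.mul_diagonal]
    rcases a with ⟨k, α⟩ | t <;> rcases b with ⟨l, β⟩ | t' <;> simp only [shear, mul_zero, zero_mul]
    split_ifs with h1 h2 h3 h4
    · simp [letterSign, h3.1, h3.2, hij, hij.symm]
    · simp
    · simp [letterSign, h4.1, h4.2, hij, hij.symm]
    · simp
    · simp
  rw [h3] at h1
  rw [← Matrix.mul_one (M (lam i j)), ← h2, ← Matrix.mul_assoc, ← h1, Matrix.mul_assoc, h2,
    Matrix.mul_one]

theorem IsAdapted.map_pc (h : IsAdapted τ M) {i j : Fin n} (hij : i ≠ j) : M (pc i j) = 1 := by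
  have h1 : lam i j * pc i j = rho i j := by
    rw [tw_mul hij]
    norm_num
  have h2 : (lam i j)⁻¹ * lam i j = 1 := inv_mul_cancel _
  have h3 : M (lam i j) * M (pc i j) = M (lam i j) := by rw [← map_mul, h1, h.map_lam hij]
  have h4 := congrArg (M (lam i j)⁻¹ * ·) h3
  simpa [← Matrix.mul_assoc, ← map_mul] using h4

variable {Jo : MulAut (FG n) → (Letter n ι κ → Matrix (Letter n ι κ) (Letter n ι κ) ℤ) → Prop}

theorem IsJohnson.exists_pc [Nontrivial (Letter n ι κ)] (h : IsJohnson M Jo) (hM : IsAdapted τ M)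
    {i j : Fin n} (hij : i ≠ j) : ∃ σ, Jo (pc i j) σ ∧ ∀ k l, k ≠ l → ∀ d a b,
      letterSign k a * letterSign l a * (letterSign k b * letterSign l b) * σ d a b =
        ((if k = j then -1 else 1) * (if l = j then -1 else 1) : ℤ) *
          (letterSign k d * letterSign l d) * σ d a b := by
  set η : Fin n → Fin n → ℤ := fun k l => (if k = j then -1 else 1) * (if l = j then -1 else 1)
    with hη
  set e : Fin n → Fin n → Letter n ι κ → ℤ := fun k l a => letterSign k a * letterSign l a with he
  have hη1 : ∀ k l, η k l = 1 ∨ η k l = -1 := fun k l => by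
    simp only [hη]; split_ifs <;> simp
  have he1 : ∀ k l a, e k l a = 1 ∨ e k l a = -1 := fun k l a => by
    simp only [he]
    rcases letterSign_eq k a with h1 | h1 <;> rcases letterSign_eq l a with h2 | h2 <;>
      simp [h1, h2]
  have hsq : ∀ k l a, e k l a * e k l a = 1 := fun k l a => by
    rcases he1 k l a with h1 | h1 <;> simp [h1]
  have key : ∀ σ, Jo (pc i j) σ → ∀ k l, k ≠ l → ∃ u : Letter n ι κ → ℤ, ∀ d a b,
      e k l a * e k l b * σ d a b = η k l * e k l d * σ d a b +
        e k l d * ((if b = d then u a else 0) - if a = d then u b else 0) := by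
    intro σ hσ k l hkl
    have h1 : eps k * eps l * pc i j = pc i j ^ η k l * (eps k * eps l) := eps_eps_mul_pc hij k l
    have h0 := hM.map_eps k l hkl
    change M (eps k * eps l) = diagonal (e k l) at h0
    clear_value η e
    obtain ⟨u, hu⟩ := h.semiconj h1 (hM.map_pc hij)
      (by rcases hη1 k l with h2 | h2 <;> rw [h2]
          · rw [zpow_one, hM.map_pc hij]
          · have h3 := map_mul M (pc i j) (pc i j)⁻¹
            rwa [mul_inv_cancel, map_one, hM.map_pc hij, Matrix.one_mul, eq_comm,
              ← _root_.zpow_neg_one] at h3)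
      hσ (h.zpow_of_eq_one (hM.map_pc hij) hσ (hη1 k l))
    refine ⟨u, fun d a b => ?_⟩
    have h2 := hu d a b
    rw [h0, Matrix.diagonal_transpose, Matrix.mul_diagonal,
      Matrix.diagonal_mul] at h2
    simp only [Matrix.diagonal_apply, ite_mul, zero_mul, Finset.sum_ite_eq', Finset.mem_univ,
      if_true, mul_ite, mul_zero, Matrix.smul_apply, smul_eq_mul] at h2
    by_cases hb : b = d <;> by_cases ha : a = d
    all_goals
      simp only [hb, ha, if_true, if_false] at h2 ⊢
      linear_combination h2
  have key2 : ∀ σ, Jo (pc i j) σ → ∀ k l, k ≠ l → ∃ u : Letter n ι κ → ℤ, (∀ d a b,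
      e k l a * e k l b * σ d a b = η k l * e k l d * σ d a b +
        e k l d * ((if b = d then u a else 0) - if a = d then u b else 0)) ∧
      ∀ d a, a ≠ d → e k l a * σ d a d = η k l * σ d a d + u a := by
    intro σ hσ k l hkl
    obtain ⟨u, hu⟩ := key σ hσ k l hkl
    refine ⟨u, hu, fun d a had => ?_⟩
    have h1 := hu d a d
    rw [if_pos rfl, if_neg had] at h1
    linear_combination e k l d * h1 -
      (e k l a * σ d a d - η k l * σ d a d - u a) * hsq k l d
  obtain ⟨σ, hσ⟩ := h.exists_val (pc i j)
  choose d₀ hd₀ using fun a : Letter n ι κ => exists_ne a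
  let w : Letter n ι κ → ℤ := open Classical in
    fun a => if ∃ k l, k ≠ l ∧ e k l a ≠ η k l then -σ (d₀ a) a (d₀ a) else 0
  refine ⟨_, h.shift hσ w, fun k l hkl d a b => ?_⟩
  obtain ⟨u, hu, hu1⟩ := key2 _ (h.shift hσ w) k l hkl
  have hu0 : ∀ a, u a = 0 := by
    intro a
    by_cases hP : ∃ k l, k ≠ l ∧ e k l a ≠ η k l
    · obtain ⟨k', l', hkl', hne⟩ := hP
      obtain ⟨v, -, hv⟩ := key2 σ hσ k' l' hkl'
      have h1 := hu1 (d₀ a) a (hd₀ a).symm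
      rw [Matrix.of_apply, hM.map_pc hij, Matrix.one_apply_eq, Matrix.one_apply_ne (hd₀ a).symm]
        at h1
      have h2 : w a = -σ (d₀ a) a (d₀ a) := if_pos ⟨k', l', hkl', hne⟩
      rw [h2] at h1
      linear_combination -h1
    · have h1 := hu1 (d₀ a) a (hd₀ a).symm
      have h2 : e k l a = η k l := by
        by_contra hne
        exact hP ⟨k, l, hkl, hne⟩
      rw [h2] at h1
      linear_combination -h1
  have := hu d a b
  simp only [hu0, ite_self, sub_zero, mul_zero, add_zero] at this
  exact this

end Adapted

end Normalisation

/-! ### Reduction modulo two -/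

section ModTwo

open Matrix

variable {n : ℕ} {ι κ : Type*}

theorem exists_letterSign_eq_one (a : Letter n ι κ) (j : Fin n) :
    ∃ k : Fin n, ∀ l, l ≠ k → letterSign l a = 1 := by
  rcases a with ⟨i, α⟩ | t
  · exact ⟨i, fun l hl => by simp [letterSign, hl.symm]⟩
  · exact ⟨j, fun l _ => rfl⟩

/-- If all products of two signs agree on `a`, `b`, `d` and `j`, each index occurs an even number
of times among these. -/
theorem letterSign_mul_eq_one (hn : 6 ≤ n) {j : Fin n} {a b d : Letter n ι κ}
    (h : ∀ k l, k ≠ l → letterSign k a * letterSign l a * (letterSign k b * letterSign l b) =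
      ((if k = j then -1 else 1) * (if l = j then -1 else 1) : ℤ) *
        (letterSign k d * letterSign l d)) (k : Fin n) :
    letterSign k a * letterSign k b = (if k = j then -1 else 1) * letterSign k d := by
  obtain ⟨ka, ha⟩ := exists_letterSign_eq_one a j
  obtain ⟨kb, hb⟩ := exists_letterSign_eq_one b j
  obtain ⟨kd, hd⟩ := exists_letterSign_eq_one d j
  obtain ⟨l, -, hl⟩ := Finset.exists_mem_notMem_of_card_lt_card
    (s := {ka, kb, kd, j, k}) (t := (Finset.univ : Finset (Fin n)))
    (lt_of_le_of_lt Finset.card_le_five (by rw [Finset.card_fin]; omega))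
  simp only [Finset.mem_insert, Finset.mem_singleton, not_or] at hl
  have := h k l (Ne.symm hl.2.2.2.2)
  rw [ha l hl.1, hb l hl.2.1, hd l hl.2.2.1, if_neg hl.2.2.2.1] at this
  simpa using this

variable [Fintype ι] [Fintype κ] [DecidableEq ι] [DecidableEq κ] {τ : ι → Bool}

/-- The reduction modulo two of an adapted representation, with its Johnson cocycle. -/
structure IsModTwo (τ : ι → Bool)
    (M : MulAut (FG n) →* Matrix (Letter n ι κ) (Letter n ι κ) (ZMod 2))
    (Jo : MulAut (FG n) → (Letter n ι κ → Matrix (Letter n ι κ) (Letter n ι κ) (ZMod 2)) → Prop) :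
    Prop where
  johnson : IsJohnson M Jo
  map_rho : ∀ i j, i ≠ j → M (rho i j) = 1 + (shear τ i j).map (Int.castRingHom (ZMod 2))
  map_lam : ∀ i j, i ≠ j → M (lam i j) = M (rho i j)
  map_eps : ∀ i j, i ≠ j → M (eps i * eps j) = 1
  map_pc : ∀ i j, i ≠ j → M (pc i j) = 1
  eps_diag : ∀ i j, i ≠ j → ∀ s, Jo (eps i * eps j) s → ∀ d a, s d a a =
    if a = d ∧ letterSign i d * letterSign j d = -1 then 1 else 0
  exists_pc : ∀ i j, i ≠ j → ∃ σ, Jo (pc i j) σ ∧ ∀ d a b, σ d a b ≠ 0 → ∀ k,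
    letterSign k a * letterSign k b = (if k = j then -1 else 1) * letterSign k d
  bracket : ∀ i j k l, i ≠ j → k ≠ l → i ≠ k → i ≠ l → k ≠ j →
    HasBracket Jo (pc i j) (pc k l)

theorem IsAdapted.isModTwo [Nontrivial (Letter n ι κ)] (hn : 6 ≤ n)
    {M : MulAut (FG n) →* Matrix (Letter n ι κ) (Letter n ι κ) ℤ}
    {Jo : MulAut (FG n) → (Letter n ι κ → Matrix (Letter n ι κ) (Letter n ι κ) ℤ) → Prop}
    (hM : IsAdapted τ M) (h : IsJohnson M Jo)
    (hb : ∀ g h, M g = 1 → M h = 1 → g * h = h * g → HasBracket Jo g h) :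
    IsModTwo τ ((Int.castRingHom (ZMod 2)).mapMatrix.toMonoidHom.comp M)
      fun g σ => ∃ σ₀, Jo g σ₀ ∧ σ = fun d => (σ₀ d).map (Int.castRingHom (ZMod 2)) where
  johnson := h.map _ (ZMod.ringHom_surjective _)
  map_rho i j hij := by
    rw [MonoidHom.comp_apply, hM.map_rho i j hij]
    change (Int.castRingHom (ZMod 2)).mapMatrix (1 + _) = _
    rw [map_add, map_one]
    rfl
  map_lam i j hij := by
    rw [MonoidHom.comp_apply, hM.map_lam hij, MonoidHom.comp_apply]
  map_eps i j hij := by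
    rw [MonoidHom.comp_apply, hM.map_eps i j hij]
    ext a b
    change ((diagonal (fun d => letterSign i d * letterSign j d) a b : ℤ) : ZMod 2) = _
    by_cases hab : a = b
    · subst hab
      rcases letterSign_eq i a with h1 | h1 <;> rcases letterSign_eq j a with h2 | h2 <;>
        simp [h1, h2]
    · simp [hab]
  map_pc i j hij := by
    rw [MonoidHom.comp_apply, hM.map_pc hij, map_one]
  eps_diag i j hij := by
    rintro s ⟨s₀, hs, rfl⟩ d a
    have h1 := h.shuffle hs d a a
    rw [hM.map_eps i j hij, if_pos rfl] at h1
    by_cases had : a = d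
    · subst had
      rw [Matrix.diagonal_apply_eq] at h1
      simp only [true_and, Matrix.map_apply, eq_intCast]
      rcases letterSign_eq i a with h2 | h2 <;> rcases letterSign_eq j a with h3 | h3 <;>
        rw [h2, h3] at h1 ⊢
      · simp [show s₀ a a a = 0 by omega]
      · simp [show s₀ a a a = 1 by omega]
      · simp [show s₀ a a a = 1 by omega]
      · simp [show s₀ a a a = 0 by omega]
    · rw [Matrix.diagonal_apply_ne _ had] at h1
      simp [had, show s₀ d a a = 0 by omega]
  exists_pc i j hij := by
    obtain ⟨σ, hσ, hpar⟩ := h.exists_pc hM hij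
    refine ⟨_, ⟨σ, hσ, rfl⟩, fun d a b hne => letterSign_mul_eq_one hn fun k l hkl => ?_⟩
    have h0 : σ d a b ≠ 0 := fun h0 => hne (by rw [Matrix.map_apply, h0, map_zero])
    exact mul_right_cancel₀ h0 (hpar k l hkl d a b)
  bracket i j k l hij hkl hik hil hkj :=
    (hb _ _ (hM.map_pc hij) (hM.map_pc hkl) (tw_comm hij hkl hik hil hkj _ _ _ _)).map _

end ModTwo

/-! ### Consequences of commutation relations -/

section ModTwoRelations

open Matrix

variable {n : ℕ} {ι κ : Type*} [Fintype ι] [Fintype κ] [DecidableEq ι] [DecidableEq κ]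
  {τ : ι → Bool} {M : MulAut (FG n) →* Matrix (Letter n ι κ) (Letter n ι κ) (ZMod 2)}
  {Jo : MulAut (FG n) → (Letter n ι κ → Matrix (Letter n ι κ) (Letter n ι κ) (ZMod 2)) → Prop}

/-- The transvection adding the `j`-th letter to the `i`-th one on letters of type `b`. -/
def transv (b : Bool) (i j : Fin n) : MulAut (FG n) := if b then rho i j else rho j i

theorem transv_comm_eps {b : Bool} {i j k l : Fin n} (hij : i ≠ j) (hki : k ≠ i) (hkj : k ≠ j)
    (hli : l ≠ i) (hlj : l ≠ j) :
    transv b i j * (eps k * eps l) = eps k * eps l * transv b i j := by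
  cases b
  · rw [transv, if_neg Bool.false_ne_true, mul_assoc, eps_tw_of_ne hij.symm hlj hli, ← mul_assoc, ← mul_assoc,
      eps_tw_of_ne hij.symm hkj hki]
  · rw [transv, if_pos rfl, mul_assoc, eps_tw_of_ne hij hli hlj, ← mul_assoc, ← mul_assoc,
      eps_tw_of_ne hij hki hkj]

theorem exists_five_ne (hn : 6 ≤ n) : ∃ i₁ i₂ i₃ i₄ i₅ : Fin n, i₁ ≠ i₂ ∧ i₁ ≠ i₃ ∧ i₁ ≠ i₄ ∧
    i₁ ≠ i₅ ∧ i₂ ≠ i₃ ∧ i₂ ≠ i₄ ∧ i₂ ≠ i₅ ∧ i₃ ≠ i₄ ∧ i₃ ≠ i₅ ∧ i₄ ≠ i₅ := by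
  refine ⟨⟨0, by omega⟩, ⟨1, by omega⟩, ⟨2, by omega⟩, ⟨3, by omega⟩, ⟨4, by omega⟩, ?_⟩
  simp

namespace IsModTwo

theorem map_transv (h : IsModTwo τ M Jo) {b : Bool} {i j : Fin n} (hij : i ≠ j) {α : ι}
    (hα : τ α = b) (k : Fin n) (c : Letter n ι κ) :
    (M (transv b i j) (Sum.inl (k, α)) c = (if c = Sum.inl (k, α) then 1 else 0) +
      if k = j then (if c = Sum.inl (i, α) then 1 else 0) else 0) ∧
    (M (transv b i j) c (Sum.inl (k, α)) = (if c = Sum.inl (k, α) then 1 else 0) +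
      if k = i then (if c = Sum.inl (j, α) then 1 else 0) else 0) := by
  cases b
  · rw [transv, if_neg Bool.false_ne_true, h.map_rho j i hij.symm]
    rcases c with ⟨l, β⟩ | t
    · by_cases hαβ : α = β
      · subst hαβ
        constructor <;> simp [shear, Matrix.one_apply, hα] <;> grind
      · simp [shear, hαβ, Ne.symm hαβ]
    · simp [shear]
  · rw [transv, if_pos rfl, h.map_rho i j hij]
    rcases c with ⟨l, β⟩ | t
    · by_cases hαβ : α = β
      · subst hαβ
        constructor <;> simp [shear, Matrix.one_apply, hα] <;> grind
      · simp [shear, hαβ, Ne.symm hαβ]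
    · simp [shear]

theorem semiconj_transv (h : IsModTwo τ M Jo) {b : Bool} {i j : Fin n} (hij : i ≠ j)
    {g g' : MulAut (FG n)} (hw : transv b i j * g = g' * transv b i j) (hg : M g = 1)
    (hg' : M g' = 1) {σ σ' : Letter n ι κ → Matrix (Letter n ι κ) (Letter n ι κ) (ZMod 2)}
    (hσ : Jo g σ) (hσ' : Jo g' σ') :
    ∃ u : Letter n ι κ → ZMod 2, ∀ k p q δ α β, τ δ = b → τ α = b → τ β = b →
      σ (.inl (k, δ)) (.inl (p, α)) (.inl (q, β)) +
        (if q = j then σ (.inl (k, δ)) (.inl (p, α)) (.inl (i, β)) else 0) +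
        ((if p = j then σ (.inl (k, δ)) (.inl (i, α)) (.inl (q, β)) else 0) +
        if p = j then (if q = j then σ (.inl (k, δ)) (.inl (i, α)) (.inl (i, β)) else 0) else 0) =
      σ' (.inl (k, δ)) (.inl (p, α)) (.inl (q, β)) +
        (if k = i then σ' (.inl (j, δ)) (.inl (p, α)) (.inl (q, β)) else 0) +
        u (.inl (p, α)) * ((if q = k ∧ β = δ then 1 else 0) +
          if k = i ∧ q = j ∧ β = δ then 1 else 0) +
        u (.inl (q, β)) * ((if p = k ∧ α = δ then 1 else 0) +
          if k = i ∧ p = j ∧ α = δ then 1 else 0) := by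
  obtain ⟨u, hu⟩ := h.johnson.semiconj hw hg hg' hσ hσ'
  refine ⟨u, fun k p q δ α β hδ hα hβ => ?_⟩
  have h1 := hu (.inl (k, δ)) (.inl (p, α)) (.inl (q, β))
  have hr := fun k c => (h.map_transv hij hα k c).1
  have hr' := fun k c => (h.map_transv hij hβ k c).1
  have hc := fun k c => (h.map_transv hij hδ k c).2
  rw [hc k (.inl (p, α)), hc k (.inl (q, β))] at h1
  simp only [Matrix.mul_apply, Matrix.transpose_apply, hr, hr', hc, add_mul, mul_add,
    Finset.sum_add_distrib, ite_mul, mul_ite, one_mul, mul_one, zero_mul, mul_zero,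
    Finset.sum_ite_eq', Finset.mem_univ, if_true] at h1
  by_cases hp : p = j <;> by_cases hq : q = j <;> by_cases hk : k = i
  all_goals
    simp [hp, hq, hk] at h1 ⊢
    grind

theorem eps_symm (h : IsModTwo τ M Jo) {i j : Fin n} (hij : i ≠ j)
    {s : Letter n ι κ → Matrix (Letter n ι κ) (Letter n ι κ) (ZMod 2)} (hs : Jo (eps i * eps j) s)
    (d a b : Letter n ι κ) : s d a b = s d b a := by
  have h1 := h.johnson.shuffle hs d a b
  rw [h.map_eps i j hij] at h1
  by_cases hab : a = b
  · rw [hab]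
  · by_cases ha : a = d <;> by_cases hb : b = d <;>
      simp [Matrix.one_apply, hab, ha, hb] at h1 <;> grind

theorem eps_entry_eq (h : IsModTwo τ M Jo) {b : Bool} {i₁ i₂ i₃ i₄ i₅ : Fin n}
    (h12 : i₁ ≠ i₂) (h13 : i₁ ≠ i₃) (h14 : i₁ ≠ i₄) (h15 : i₁ ≠ i₅) (h23 : i₂ ≠ i₃)
    (h24 : i₂ ≠ i₄) (h25 : i₂ ≠ i₅) (h34 : i₃ ≠ i₄) (h35 : i₃ ≠ i₅) (h45 : i₄ ≠ i₅)
    {s : Letter n ι κ → Matrix (Letter n ι κ) (Letter n ι κ) (ZMod 2)}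
    (hs : Jo (eps i₁ * eps i₂) s) {δ α β : ι} (hδ : τ δ = b) (hα : τ α = b) (hβ : τ β = b) :
    s (.inl (i₂, δ)) (.inl (i₂, α)) (.inl (i₁, β)) =
      s (.inl (i₄, δ)) (.inl (i₄, α)) (.inl (i₁, β)) := by
  obtain ⟨s₂₃, hs23⟩ := h.johnson.exists_val (eps i₂ * eps i₃)
  obtain ⟨s₁₃, hs13⟩ := h.johnson.exists_val (eps i₁ * eps i₃)
  have e23 : s₂₃ (.inl (i₂, δ)) (.inl (i₂, α)) (.inl (i₁, β)) =
      s₂₃ (.inl (i₄, δ)) (.inl (i₄, α)) (.inl (i₁, β)) := by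
    obtain ⟨u, hu⟩ := h.semiconj_transv (b := b) h15
      (transv_comm_eps h15 h12.symm h25 h13.symm h35)
      (h.map_eps _ _ h23) (h.map_eps _ _ h23) hs23 hs23
    have h2 := hu i₂ i₂ i₅ δ α β hδ hα hβ
    have h4 := hu i₄ i₄ i₅ δ α β hδ hα hβ
    simp [h12.symm, h25, h25.symm, h14.symm, h45, h45.symm] at h2 h4
    rw [h2, h4]
  have e13 : s₁₃ (.inl (i₂, δ)) (.inl (i₂, α)) (.inl (i₁, β)) =
      s₁₃ (.inl (i₄, δ)) (.inl (i₄, α)) (.inl (i₁, β)) := by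
    obtain ⟨u, hu⟩ := h.semiconj_transv (b := b) h24
      (transv_comm_eps h24 h12 h14 h23.symm h34)
      (h.map_eps _ _ h13) (h.map_eps _ _ h13) hs13 hs13
    have h2 := hu i₂ i₄ i₁ δ α β hδ hα hβ
    have h4 := hu i₃ i₃ i₁ δ δ β hδ hδ hβ
    simp [h12, h14, h24.symm, h34, h13, h23.symm] at h2 h4
    simp only [h4, ite_self] at h2
    grind
  have hm := h.johnson.mul_of_eq_one (h.map_eps _ _ h12) (h.map_eps _ _ h23) hs hs23
  rw [mul_assoc, ← mul_assoc (eps i₂), eps_mul_self, one_mul] at hm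
  obtain ⟨u, hu⟩ := h.johnson.diff hm hs13
  have h2 := hu (.inl (i₂, δ)) (.inl (i₂, α)) (.inl (i₁, β))
  have h4 := hu (.inl (i₄, δ)) (.inl (i₄, α)) (.inl (i₁, β))
  rw [h.map_eps _ _ h13] at h2 h4
  simp [Matrix.one_apply, h12, h14, e13, e23] at h2 h4
  grind

theorem rho_mul_eps_eps {i j : Fin n} (hij : i ≠ j) :
    rho i j * (eps i * eps j) = pc i j * (eps i * eps j) * rho i j := by
  rw [mul_assoc (pc i j), eps_eps_rho hij, ← mul_assoc (pc i j), tw_mul hij]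
  norm_num

/-- There are no dual letters. -/
theorem type_eq_true (h : IsModTwo τ M Jo) (hn : 6 ≤ n) (α : ι) : τ α = true := by
  by_contra hne
  have hα : τ α = false := by simpa using hne
  obtain ⟨i₁, i₂, i₃, i₄, i₅, h12, h13, h14, h15, h23, h24, h25, h34, h35, h45⟩ :=
    exists_five_ne hn
  obtain ⟨σ, hσ, hpar⟩ := h.exists_pc i₁ i₂ h12
  obtain ⟨s, hs⟩ := h.johnson.exists_val (eps i₁ * eps i₂)
  have hdiag := h.eps_diag i₁ i₂ h12 s hs
  have hw : transv false i₂ i₁ * (eps i₁ * eps i₂) =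
      pc i₁ i₂ * (eps i₁ * eps i₂) * transv false i₂ i₁ := rho_mul_eps_eps h12
  obtain ⟨u, hu⟩ := h.semiconj_transv h12.symm hw (h.map_eps _ _ h12)
    (by rw [map_mul, h.map_pc _ _ h12, h.map_eps _ _ h12, one_mul]) hs
    (h.johnson.mul_of_eq_one (h.map_pc _ _ h12) (h.map_eps _ _ h12) hσ hs)
  have z1 : σ (.inl (i₂, α)) (.inl (i₁, α)) (.inl (i₂, α)) = 0 := by
    by_contra h0
    have := hpar _ _ _ h0 i₁
    simp [letterSign, h12, h12.symm] at this
  have z2 : σ (.inl (i₃, α)) (.inl (i₁, α)) (.inl (i₃, α)) = 0 := by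
    by_contra h0
    have := hpar _ _ _ h0 i₁
    simp [letterSign, h12, h13.symm] at this
  have e1 := hu i₂ i₁ i₂ α α α hα hα hα
  have e2 := hu i₁ i₁ i₂ α α α hα hα hα
  have e3 := hu i₃ i₁ i₃ α α α hα hα hα
  have d1 := hdiag (.inl (i₂, α)) (.inl (i₂, α))
  have d2 := hdiag (.inl (i₁, α)) (.inl (i₂, α))
  have e4 := h.eps_entry_eq (i₁ := i₂) (i₂ := i₁) (i₃ := i₄) (i₄ := i₃) (i₅ := i₅) h12.symm h24
    h23 h25 h14 h13 h15 h34.symm h45 h35 (s := s) (by rwa [eps_comm]) hα hα hα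
  have e5 := h.eps_symm h12 hs (.inl (i₃, α)) (.inl (i₂, α)) (.inl (i₃, α))
  have e6 := h.eps_symm h12 hs (.inl (i₁, α)) (.inl (i₁, α)) (.inl (i₂, α))
  simp [letterSign, h12, h12.symm, h13, h13.symm, h23.symm, z1, z2] at e1 e2 e3 d1 d2
  grind

theorem entry_add_symm (h : IsModTwo τ M Jo) (hτ : ∀ α, τ α = true) {i₁ i₂ i₃ i₄ i₅ : Fin n}
    (h12 : i₁ ≠ i₂) (h13 : i₁ ≠ i₃) (h14 : i₁ ≠ i₄) (h15 : i₁ ≠ i₅) (h23 : i₂ ≠ i₃)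
    (h24 : i₂ ≠ i₄) (h25 : i₂ ≠ i₅) (h34 : i₃ ≠ i₄) (h35 : i₃ ≠ i₅) (h45 : i₄ ≠ i₅)
    {σ : Letter n ι κ → Matrix (Letter n ι κ) (Letter n ι κ) (ZMod 2)}
    (hσ : Jo (pc i₁ i₂) σ) (hpar : ∀ d a b, σ d a b ≠ 0 → ∀ k,
      letterSign k a * letterSign k b = (if k = i₂ then -1 else 1) * letterSign k d)
    (δ α β : ι) :
    σ (.inl (i₁, δ)) (.inl (i₂, α)) (.inl (i₁, β)) + σ (.inl (i₄, δ)) (.inl (i₂, α)) (.inl (i₄, β))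
      = σ (.inl (i₁, δ)) (.inl (i₂, β)) (.inl (i₁, α)) +
        σ (.inl (i₄, δ)) (.inl (i₂, β)) (.inl (i₄, α)) ∧
    σ (.inl (i₁, δ)) (.inl (i₂, α)) (.inl (i₁, α)) + σ (.inl (i₄, δ)) (.inl (i₂, α)) (.inl (i₄, α))
      = if α = δ then 1 else 0 := by
  obtain ⟨s, hs⟩ := h.johnson.exists_val (eps i₁ * eps i₂)
  have hdiag := h.eps_diag i₁ i₂ h12 s hs
  have hw : transv true i₁ i₂ * (eps i₁ * eps i₂) =
      pc i₁ i₂ * (eps i₁ * eps i₂) * transv true i₁ i₂ := rho_mul_eps_eps h12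
  obtain ⟨u, hu⟩ := h.semiconj_transv h12 hw (h.map_eps _ _ h12)
    (by rw [map_mul, h.map_pc _ _ h12, h.map_eps _ _ h12, one_mul]) hs
    (h.johnson.mul_of_eq_one (h.map_pc _ _ h12) (h.map_eps _ _ h12) hσ hs)
  have key : ∀ α β, σ (.inl (i₁, δ)) (.inl (i₂, α)) (.inl (i₁, β)) +
      σ (.inl (i₄, δ)) (.inl (i₂, α)) (.inl (i₄, β)) =
      s (.inl (i₄, δ)) (.inl (i₄, α)) (.inl (i₁, β)) +
      s (.inl (i₄, δ)) (.inl (i₄, β)) (.inl (i₁, α)) +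
      s (.inl (i₁, δ)) (.inl (i₁, α)) (.inl (i₁, β)) +
      s (.inl (i₂, δ)) (.inl (i₁, α)) (.inl (i₁, β)) := by
    intro α β
    have z : σ (.inl (i₂, δ)) (.inl (i₂, α)) (.inl (i₁, β)) = 0 := by
      by_contra h0
      have := hpar _ _ _ h0 i₁
      simp [letterSign, h12, h12.symm] at this
    have e1 := hu i₁ i₂ i₁ δ α β (hτ _) (hτ _) (hτ _)
    have e2 := hu i₂ i₂ i₁ δ α β (hτ _) (hτ _) (hτ _)
    have e3 := hu i₄ i₂ i₄ δ α β (hτ _) (hτ _) (hτ _)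
    have e4 := h.eps_entry_eq h12 h13 h14 h15 h23 h24 h25 h34 h35 h45 hs (hτ δ) (hτ α) (hτ β)
    have e5 := h.eps_symm h12 hs (.inl (i₄, δ)) (.inl (i₁, α)) (.inl (i₄, β))
    simp [h12, h12.symm, h14.symm, h24, h24.symm, z] at e1 e2 e3
    grind
  refine ⟨?_, ?_⟩
  · have e6 := h.eps_symm h12 hs (.inl (i₁, δ)) (.inl (i₁, α)) (.inl (i₁, β))
    have e7 := h.eps_symm h12 hs (.inl (i₂, δ)) (.inl (i₁, α)) (.inl (i₁, β))
    rw [key, key, e6, e7]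
    ring
  · have e8 := hdiag (.inl (i₁, δ)) (.inl (i₁, α))
    have e9 := hdiag (.inl (i₂, δ)) (.inl (i₁, α))
    rw [key, e8, e9]
    simp [letterSign, h12, CharTwo.add_self_eq_zero]

end IsModTwo

end ModTwoRelations

/-! ### Consequences of symmetry -/

section ModTwoSymmetry

open Matrix

variable {n : ℕ} {ι κ : Type*}

/-- The action of a transposition of indices on letters. -/
def swapLetter (i j : Fin n) : Letter n ι κ → Letter n ι κ :=
  Sum.map (Prod.map (Equiv.swap i j) id) id

@[simp]
theorem swapLetter_inl (i j k : Fin n) (α : ι) :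
    swapLetter (κ := κ) i j (.inl (k, α)) = .inl (Equiv.swap i j k, α) := rfl

@[simp]
theorem swapLetter_inr (i j : Fin n) (t : κ) : swapLetter (ι := ι) i j (.inr t) = .inr t := rfl

@[simp]
theorem swapLetter_swapLetter (i j : Fin n) (d : Letter n ι κ) :
    swapLetter i j (swapLetter i j d) = d := by
  rcases d with ⟨k, α⟩ | t <;> simp

theorem eq_swapLetter_comm (i j : Fin n) (a d : Letter n ι κ) :
    a = swapLetter i j d ↔ swapLetter i j a = d := by
  constructor
  · rintro rfl; simp
  · rintro rfl; simp

@[simp]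
theorem swapLetter_self (i : Fin n) (d : Letter n ι κ) : swapLetter i i d = d := by
  rcases d with ⟨k, α⟩ | t <;> simp

theorem wt_mul_pc {i j k l : Fin n} (hij : i ≠ j) (hkl : k ≠ l) (hlj : l ≠ j) :
    wt i j * pc k l = pc (Equiv.swap i j k) (Equiv.swap i j l) * wt i j := by
  have h1 : wt i j = eps i * pm (Equiv.swap i j) := by
    rw [pm_swap_eq hij, ← mul_assoc, eps_mul_self, one_mul]
  rw [h1, mul_assoc, pm_tw hkl, ← mul_assoc, eps_mul_pc ((Equiv.swap i j).injective.ne hkl),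
    if_neg, zpow_one, mul_assoc]
  exact fun he => hlj ((Equiv.swap i j).injective (by rw [← he, Equiv.swap_apply_right]))

variable [Fintype ι] [Fintype κ] [DecidableEq ι] [DecidableEq κ]
  {τ : ι → Bool} {M : MulAut (FG n) →* Matrix (Letter n ι κ) (Letter n ι κ) (ZMod 2)}
  {Jo : MulAut (FG n) → (Letter n ι κ → Matrix (Letter n ι κ) (Letter n ι κ) (ZMod 2)) → Prop}

namespace IsModTwo

theorem mul_map_rho_apply (h : IsModTwo τ M Jo) (hτ : ∀ α, τ α = true) {i j : Fin n} (hij : i ≠ j)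
    (X : Matrix (Letter n ι κ) (Letter n ι κ) (ZMod 2)) (c : Letter n ι κ) :
    (∀ k α, (X * M (rho i j)) c (.inl (k, α)) = X c (.inl (k, α)) +
      if k = i then X c (.inl (j, α)) else 0) ∧
    ∀ t, (X * M (rho i j)) c (.inr t) = X c (.inr t) := by
  refine ⟨fun k α => ?_, fun t => ?_⟩
  · have h1 := fun c => (h.map_transv hij (hτ α) k c).2
    simp only [transv, if_true] at h1
    simp only [Matrix.mul_apply, h1]
    by_cases hk : k = i <;> simp only [hk, if_true, if_false, mul_add,
      mul_ite, mul_one, mul_zero, Finset.sum_add_distrib, Finset.sum_ite_eq', Finset.mem_univ,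
      Finset.sum_const_zero]
  · have h1 : ∀ c, M (rho i j) c (.inr t) = if c = .inr t then 1 else 0 := by
      intro c
      rw [h.map_rho i j hij]
      rcases c with c | c <;> simp [shear, Matrix.one_apply]
    simp only [Matrix.mul_apply, h1, mul_ite, mul_one, mul_zero, Finset.sum_ite_eq',
      Finset.mem_univ, if_true]

theorem map_wt (h : IsModTwo τ M Jo) (hτ : ∀ α, τ α = true) {i j : Fin n} (hij : i ≠ j)
    (c d : Letter n ι κ) : M (wt i j) c d = if c = swapLetter i j d then 1 else 0 := by
  have hm := fun X => h.mul_map_rho_apply hτ hij X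
  have hm' := fun X => h.mul_map_rho_apply hτ hij.symm X
  have hinv : M (tw j i (-1) 0) = M (rho j i) := by
    have h1 : M (rho j i) * M (rho j i) = 1 := by
      rw [← one_mul (M (rho j i) * M (rho j i)), ← mul_assoc]
      ext c d
      rcases d with ⟨k, α⟩ | t
      · rw [(hm' _ _).1, (hm' _ _).1, (hm' _ _).1]
        by_cases hk : k = j <;> simp [hk, hij]
        grind
      · rw [(hm' _ _).2, (hm' _ _).2]
    have h2 : tw j i (-1) 0 = (lam j i)⁻¹ := by rw [tw_inv hij.symm]; simp
    calc M (tw j i (-1) 0) = M (tw j i (-1) 0) * (M (lam j i) * M (lam j i)) := by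
          rw [h.map_lam _ _ hij.symm, h1, mul_one]
      _ = M (rho j i) := by
          rw [← mul_assoc, ← map_mul, h2, inv_mul_cancel, map_one, one_mul, h.map_lam _ _ hij.symm]
  rw [wt, map_mul, map_mul, hinv, h.map_lam _ _ hij, ← one_mul (M (rho i j) * _), ← mul_assoc]
  rcases d with ⟨k, α⟩ | t
  · rw [(hm _ _).1, (hm' _ _).1, (hm' _ _).1, (hm _ _).1, (hm _ _).1, (hm _ _).1]
    by_cases hk : k = i
    · subst hk
      simp [hij, hij.symm, Matrix.one_apply]
      grind
    · by_cases hk' : k = j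
      · subst hk'
        simp [hij.symm, Matrix.one_apply]
        grind
      · simp [hk, hk', Matrix.one_apply, Equiv.swap_apply_of_ne_of_ne hk hk']
  · rw [(hm _ _).2, (hm' _ _).2, (hm _ _).2, swapLetter_inr, Matrix.one_apply]

theorem semiconj_wt (h : IsModTwo τ M Jo) (hτ : ∀ α, τ α = true) {i j : Fin n} (hij : i ≠ j)
    {g g' : MulAut (FG n)} (hw : wt i j * g = g' * wt i j) (hg : M g = 1)
    (hg' : M g' = 1) {σ σ' : Letter n ι κ → Matrix (Letter n ι κ) (Letter n ι κ) (ZMod 2)}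
    (hσ : Jo g σ) (hσ' : Jo g' σ') :
    ∃ u : Letter n ι κ → ZMod 2, ∀ d a b,
      σ (swapLetter i j d) (swapLetter i j a) (swapLetter i j b) = σ' d a b +
        ((if b = d then u a else 0) - if a = d then u b else 0) := by
  obtain ⟨u, hu⟩ := h.johnson.semiconj hw hg hg' hσ hσ'
  refine ⟨u, fun d a b => ?_⟩
  have := hu (swapLetter i j d) a b
  simpa only [Matrix.mul_apply, Matrix.transpose_apply, h.map_wt hτ hij, eq_swapLetter_comm,
    swapLetter_swapLetter, ite_mul, mul_ite, one_mul, mul_one, zero_mul, mul_zero,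
    Finset.sum_ite_eq, Finset.sum_ite_eq', Finset.mem_univ, if_true,
    (Function.LeftInverse.injective (swapLetter_swapLetter i j)).eq_iff] using this

theorem jo_wt (h : IsModTwo τ M Jo) (hτ : ∀ α, τ α = true) {i j k l : Fin n} (hij : i ≠ j)
    (hkl : k ≠ l) (hlj : l ≠ j)
    {σ : Letter n ι κ → Matrix (Letter n ι κ) (Letter n ι κ) (ZMod 2)} (hσ : Jo (pc k l) σ) :
    Jo (pc (Equiv.swap i j k) (Equiv.swap i j l)) fun d => Matrix.of fun a b =>
      σ (swapLetter i j d) (swapLetter i j a) (swapLetter i j b) := by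
  have hne := (Equiv.swap i j).injective.ne hkl
  obtain ⟨σ', hσ'⟩ := h.johnson.exists_val (pc (Equiv.swap i j k) (Equiv.swap i j l))
  obtain ⟨u, hu⟩ := h.semiconj_wt hτ hij (wt_mul_pc hij hkl hlj) (h.map_pc _ _ hkl)
    (h.map_pc _ _ hne) hσ hσ'
  convert h.johnson.shift hσ' u using 5 with d a b
  rw [hu, h.map_pc _ _ hne]
  simp [Matrix.one_apply]

theorem entry_eq (h : IsModTwo τ M Jo) (hτ : ∀ α, τ α = true) {i j p q : Fin n} (hij : i ≠ j)
    (hpi : p ≠ i) (hpj : p ≠ j) (hqi : q ≠ i) (hqj : q ≠ j)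
    {σ : Letter n ι κ → Matrix (Letter n ι κ) (Letter n ι κ) (ZMod 2)} (hσ : Jo (pc i j) σ)
    (δ α β : ι) :
    σ (.inl (p, δ)) (.inl (j, α)) (.inl (p, β)) = σ (.inl (q, δ)) (.inl (j, α)) (.inl (q, β)) := by
  by_cases hpq : p = q
  · rw [hpq]
  have hw := wt_mul_pc hpq hij hqj.symm
  rw [Equiv.swap_apply_of_ne_of_ne hpi.symm hqi.symm,
    Equiv.swap_apply_of_ne_of_ne hpj.symm hqj.symm] at hw
  obtain ⟨u, hu⟩ := h.semiconj_wt hτ hpq hw (h.map_pc _ _ hij) (h.map_pc _ _ hij) hσ hσ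
  have h1 := hu (.inl (i, δ)) (.inl (j, α)) (.inl (i, δ))
  have h2 := hu (.inl (q, δ)) (.inl (j, α)) (.inl (q, β))
  simp [Equiv.swap_apply_of_ne_of_ne hpi.symm hqi.symm,
    Equiv.swap_apply_of_ne_of_ne hpj.symm hqj.symm, hij.symm, hqj.symm] at h1 h2
  simpa [h1] using h2

theorem exists_sum_eq (h : IsModTwo τ M Jo) (hτ : ∀ α, τ α = true) {i j p : Fin n} (hij : i ≠ j)
    (hpi : p ≠ i) (hpj : p ≠ j)
    {σ : Letter n ι κ → Matrix (Letter n ι κ) (Letter n ι κ) (ZMod 2)} (hσ : Jo (pc i j) σ) :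
    ∃ v : ι → ZMod 2, (∀ δ α β, σ (.inl (i, δ)) (.inl (j, α)) (.inl (i, β)) +
        (n : ZMod 2) * σ (.inl (p, δ)) (.inl (j, α)) (.inl (p, β)) = if β = δ then v α else 0) ∧
      ∀ t α t', ((n : ZMod 2) + 1) * σ (.inr t) (.inl (j, α)) (.inr t') =
        if t' = t then v α else 0 := by
  have hk : ∀ k, k ≠ j → Jo (pc k j) fun d => Matrix.of fun a b =>
      σ (swapLetter i k d) (swapLetter i k a) (swapLetter i k b) := by
    intro k hkj
    by_cases hik : i = k
    · subst hik
      simp only [swapLetter_self]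
      exact hσ
    · simpa [Equiv.swap_apply_of_ne_of_ne hij.symm hkj.symm] using
        h.jo_wt hτ hik hij hkj.symm hσ
  have hprod : ∀ L : List (Fin n), (∀ k ∈ L, k ≠ j) →
      M (L.map fun k => pc k j).prod = 1 ∧
      Jo (L.map fun k => pc k j).prod (L.map fun k => (fun d => Matrix.of fun a b =>
        σ (swapLetter i k d) (swapLetter i k a) (swapLetter i k b))).sum := by
    intro L
    induction L with
    | nil =>
      intro _
      refine ⟨by simp, ?_⟩
      have := h.johnson.inner 1
      simpa using this
    | cons k L ih =>
      intro hL
      obtain ⟨ih1, ih2⟩ := ih fun l hl => hL l (List.mem_cons_of_mem _ hl)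
      have hkj := hL k List.mem_cons_self
      refine ⟨by simp [h.map_pc _ _ hkj, ih1], ?_⟩
      simpa using h.johnson.mul_of_eq_one (h.map_pc _ _ hkj) ih1 (hk k hkj) ih2
  obtain ⟨-, hJ⟩ := hprod (Finset.univ.erase j).toList (by simp)
  rw [prod_pc_eq_conj _ (by simp) (Finset.nodup_toList _) (by simp)] at hJ
  obtain ⟨u, hu⟩ := h.johnson.diff (h.johnson.inner _) hJ
  rw [Finset.sum_map_toList] at hu
  simp only [h.johnson.map_conj] at hu
  have hcard : ((Finset.univ.erase j).card : ZMod 2) = n + 1 := by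
    rw [Finset.card_erase_of_mem (Finset.mem_univ j), Finset.card_fin,
      Nat.cast_sub (by have := j.2; omega)]
    simp [sub_eq_add_neg]
  refine ⟨fun α => u (.inl (j, α)), fun δ α β => ?_, fun t α t' => ?_⟩
  · have h1 := hu (.inl (i, δ)) (.inl (j, α)) (.inl (i, β))
    have h2 : ∀ k ∈ (Finset.univ.erase j).erase i, (Matrix.of fun a b =>
        σ (swapLetter i k (.inl (i, δ))) (swapLetter i k a) (swapLetter i k b))
          (.inl (j, α)) (.inl (i, β)) = σ (.inl (p, δ)) (.inl (j, α)) (.inl (p, β)) := by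
      intro k hk
      simp only [Finset.mem_erase, Finset.mem_univ, and_true] at hk
      simpa [Equiv.swap_apply_of_ne_of_ne hij.symm hk.2.symm] using
        h.entry_eq hτ hij hk.1 hk.2 hpi hpj hσ δ α β
    rw [Finset.sum_apply, Matrix.sum_apply, ← Finset.add_sum_erase _ _
      (Finset.mem_erase.2 ⟨hij, Finset.mem_univ i⟩), Finset.sum_congr rfl h2, Finset.sum_const,
      nsmul_eq_mul, Finset.card_erase_of_mem (by simp [hij]), Nat.cast_sub, hcard] at h1
    · simp [Matrix.one_apply, hij.symm] at h1
      rw [h1]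
    · exact Finset.card_pos.2 ⟨i, by simp [hij]⟩
  · have h1 := hu (.inr t) (.inl (j, α)) (.inr t')
    have h2 : ∀ k ∈ Finset.univ.erase j, (Matrix.of fun a b =>
        σ (swapLetter i k (.inr t)) (swapLetter i k a) (swapLetter i k b))
          (.inl (j, α)) (.inr t') = σ (.inr t) (.inl (j, α)) (.inr t') := by
      intro k hk
      simp only [Finset.mem_erase, Finset.mem_univ, and_true] at hk
      simp [Equiv.swap_apply_of_ne_of_ne hij.symm hk.symm]
    rw [Finset.sum_apply, Matrix.sum_apply, Finset.sum_congr rfl h2, Finset.sum_const,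
      nsmul_eq_mul, hcard] at h1
    simpa [Matrix.one_apply] using h1

end IsModTwo

end ModTwoSymmetry

/-! ### The commutation of distant partial conjugations -/

section ModTwoBracket

open Matrix

variable {n : ℕ} {ι κ : Type*}

theorem letterSign_inl (k i : Fin n) (α : ι) :
    letterSign k (.inl (i, α) : Letter n ι κ) = if i = k then -1 else 1 := rfl

theorem exists_eq_inl_of_letterSign {k : Fin n} {a : Letter n ι κ} (h : letterSign k a = -1) :
    ∃ α, a = .inl (k, α) := by
  rcases a with ⟨i, α⟩ | t
  · by_cases hik : i = k
    · exact ⟨α, by rw [hik]⟩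
    · simp [letterSign, hik] at h
  · simp [letterSign] at h

theorem swapLetter_of_letterSign {i j : Fin n} {a : Letter n ι κ} (hi : letterSign i a = 1)
    (hj : letterSign j a = 1) : swapLetter i j a = a := by
  rcases a with ⟨k, α⟩ | t
  · have hki : k ≠ i := by rintro rfl; simp [letterSign] at hi
    have hkj : k ≠ j := by rintro rfl; simp [letterSign] at hj
    rw [swapLetter_inl, Equiv.swap_apply_of_ne_of_ne hki hkj]
  · rfl

variable [Fintype ι] [Fintype κ]

theorem sum_letter_eq {k : Fin n} (f : Letter n ι κ → ZMod 2)
    (h : ∀ a, f a ≠ 0 → ∃ α, a = .inl (k, α)) : ∑ a, f a = ∑ α, f (.inl (k, α)) := by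
  rw [Fintype.sum_sum_type, Fintype.sum_prod_type, Finset.sum_eq_single k]
  · rw [Finset.sum_eq_zero (s := Finset.univ (α := κ)), add_zero]
    intro t _
    by_contra h0
    simpa using h _ h0
  · intro i _ hik
    refine Finset.sum_eq_zero fun α _ => ?_
    by_contra h0
    exact absurd (h _ h0) (by simp [hik])
  · simp

variable [DecidableEq ι] [DecidableEq κ]
  {τ : ι → Bool} {M : MulAut (FG n) →* Matrix (Letter n ι κ) (Letter n ι κ) (ZMod 2)}
  {Jo : MulAut (FG n) → (Letter n ι κ → Matrix (Letter n ι κ) (Letter n ι κ) (ZMod 2)) → Prop}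

namespace IsModTwo

theorem exists_bracket (h : IsModTwo τ M Jo) (hτ : ∀ α, τ α = true) {i₁ i₂ i₃ i₄ : Fin n}
    (h12 : i₁ ≠ i₂) (h13 : i₁ ≠ i₃) (h14 : i₁ ≠ i₄) (h23 : i₂ ≠ i₃)
    (h24 : i₂ ≠ i₄) (h34 : i₃ ≠ i₄)
    {σ : Letter n ι κ → Matrix (Letter n ι κ) (Letter n ι κ) (ZMod 2)}
    (hσ : Jo (pc i₁ i₂) σ) (hpar : ∀ d a b, σ d a b ≠ 0 → ∀ k,
      letterSign k a * letterSign k b = (if k = i₂ then -1 else 1) * letterSign k d) :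
    ∃ U : ι → ι → ZMod 2, ∀ c d α γ,
      (letterSign i₁ c = 1 ∧ letterSign i₂ c = 1 ∧ letterSign i₃ c = 1 ∧ letterSign i₄ c = 1) →
      (letterSign i₁ d = 1 ∧ letterSign i₂ d = 1 ∧ letterSign i₃ d = 1 ∧ letterSign i₄ d = 1) →
      ∑ ε, σ d (.inl (i₂, ε)) c * σ (.inl (i₄, ε)) (.inl (i₂, α)) (.inl (i₄, γ)) +
        ∑ ε, σ d (.inl (i₂, ε)) c * σ (.inl (i₄, ε)) (.inl (i₂, γ)) (.inl (i₄, α)) +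
        ∑ q, σ d (.inl (i₂, α)) q * σ q (.inl (i₂, γ)) c = if c = d then U α γ else 0 := by
  have hσ₁ := h.jo_wt hτ h13 h12 h23 hσ
  rw [Equiv.swap_apply_left, Equiv.swap_apply_of_ne_of_ne h12.symm h23] at hσ₁
  have hσ₂ := h.jo_wt hτ h24 h23.symm h24 hσ₁
  rw [Equiv.swap_apply_left, Equiv.swap_apply_of_ne_of_ne h23.symm h34] at hσ₂
  obtain ⟨C, hC⟩ := h.bracket i₁ i₂ i₃ i₄ h12 h34 h13 h14 h23.symm _ _ hσ hσ₂
  refine ⟨fun α γ => C (.inl (i₂, α)) (.inl (i₄, γ)), fun c d α γ hc hd => ?_⟩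
  have hfix : ∀ a : Letter n ι κ, letterSign i₁ a = 1 ∧ letterSign i₂ a = 1 ∧
      letterSign i₃ a = 1 ∧ letterSign i₄ a = 1 →
      swapLetter i₁ i₃ (swapLetter i₂ i₄ a) = a := fun a ha => by
    rw [swapLetter_of_letterSign ha.2.1 ha.2.2.2, swapLetter_of_letterSign ha.1 ha.2.2.1]
  have hπ2 : ∀ α : ι, swapLetter i₁ i₃ (swapLetter i₂ i₄ (.inl (i₂, α) : Letter n ι κ)) =
      .inl (i₄, α) := fun α => by
    simp [Equiv.swap_apply_of_ne_of_ne h14.symm h34.symm]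
  have hπ4 : ∀ α : ι, swapLetter i₁ i₃ (swapLetter i₂ i₄ (.inl (i₄, α) : Letter n ι κ)) =
      .inl (i₂, α) := fun α => by
    simp [Equiv.swap_apply_of_ne_of_ne h12.symm h23]
  have key := hC d (.inl (i₂, α)) (.inl (i₄, γ)) c
  simp only [Matrix.of_apply, hfix d hd, hfix c hc, hπ2, hπ4] at key
  have hne : (.inl (i₂, α) : Letter n ι κ) ≠ d := by
    rintro rfl
    simp [letterSign] at hd
  rw [sum_letter_eq (k := i₄) (fun p => σ d _ c * σ p (.inl (i₂, α)) (.inl (i₄, γ))),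
    sum_letter_eq (k := i₂) (fun p => σ d p c * _),
    Finset.sum_eq_zero (f := fun q => σ d _ _ * σ q (.inl (i₄, γ)) c), if_neg hne, add_zero,
    sub_zero] at key
  · have e3 : ∀ ε, σ (.inl (i₄, ε)) (.inl (i₄, α)) (.inl (i₂, γ)) =
        σ (.inl (i₄, ε)) (.inl (i₂, γ)) (.inl (i₄, α)) := by
      intro ε
      have := h.johnson.shuffle hσ (.inl (i₄, ε)) (.inl (i₄, α)) (.inl (i₂, γ))
      rw [h.map_pc _ _ h12] at this
      simp [Matrix.one_apply, h24, h24.symm] at this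
      grind
    have e4 : ∀ q, σ d (.inl (i₂, α)) q *
        σ (swapLetter i₁ i₃ (swapLetter i₂ i₄ q)) (.inl (i₂, γ)) c =
        σ d (.inl (i₂, α)) q * σ q (.inl (i₂, γ)) c := by
      intro q
      have hq : ∀ q, σ q (.inl (i₂, γ)) c ≠ 0 → letterSign i₁ q = 1 ∧ letterSign i₂ q = 1 ∧
          letterSign i₃ q = 1 ∧ letterSign i₄ q = 1 := by
        intro q h0
        have p1 := hpar _ _ _ h0 i₁
        have p2 := hpar _ _ _ h0 i₂
        have p3 := hpar _ _ _ h0 i₃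
        have p4 := hpar _ _ _ h0 i₄
        rw [hc.1] at p1
        rw [hc.2.1] at p2
        rw [hc.2.2.1] at p3
        rw [hc.2.2.2] at p4
        simp only [letterSign_inl, h12, h12.symm, h23, h23.symm, h24, h24.symm, if_true, if_false,
          one_mul, mul_one] at p1 p2 p3 p4
        exact ⟨p1.symm, by linarith, p3.symm, p4.symm⟩
      by_cases h0 : σ (swapLetter i₁ i₃ (swapLetter i₂ i₄ q)) (.inl (i₂, γ)) c = 0
      · by_cases h1 : σ q (.inl (i₂, γ)) c = 0
        · rw [h0, h1]
        · rw [hfix q (hq q h1)]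
      · have hs := hq _ h0
        have e1 := swapLetter_of_letterSign hs.1 hs.2.2.1
        have e2 := swapLetter_of_letterSign hs.2.1 hs.2.2.2
        rw [swapLetter_swapLetter] at e1
        rw [← e1, swapLetter_swapLetter] at e2
        rw [← e1, ← e2]
    simp only [hπ2, hπ4, e3, e4] at key
    rw [← key]
    grind
  · intro q _
    refine mul_eq_zero_of_right _ ?_
    by_contra h0
    have p2 := hpar _ _ _ h0 i₂
    have p4 := hpar _ _ _ h0 i₄
    rw [hc.2.1] at p2
    rw [hc.2.2.2] at p4
    simp only [letterSign_inl, h24.symm, if_true, if_false, one_mul, mul_one] at p2 p4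
    obtain ⟨ε, rfl⟩ := exists_eq_inl_of_letterSign p4.symm
    simp [letterSign, h24.symm] at p2
  · intro p hp
    have p4 := hpar _ _ _ (right_ne_zero_of_mul hp) i₄
    simp only [letterSign_inl, h24, h24.symm, if_true, if_false, one_mul, mul_one] at p4
    obtain ⟨ε, hε⟩ := exists_eq_inl_of_letterSign p4.symm
    refine ⟨ε, ?_⟩
    rw [← eq_swapLetter_comm, ← eq_swapLetter_comm] at hε
    rw [hε]
    simp [Equiv.swap_apply_of_ne_of_ne h14.symm h34.symm]
  · intro p hp
    have p4 := hpar _ _ _ (right_ne_zero_of_mul hp) i₄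
    simp only [letterSign_inl, h24, h24.symm, if_true, if_false, one_mul] at p4
    exact exists_eq_inl_of_letterSign p4.symm

end IsModTwo

end ModTwoBracket

/-! ### Multiplicity one -/

section MultiplicityOne

open Matrix

/-- A family of operators with `L α e_γ = L γ e_α` and `L α e_α = e_α` whose pairwise products
are scalar has at most one member. -/
theorem subsingleton_of_mul_eq_scalar {ι : Type*} [Fintype ι] [DecidableEq ι]
    {L : ι → Matrix ι ι (ZMod 2)} {U : ι → ι → ZMod 2}
    (hsymm : ∀ δ α β, L α δ β = L β δ α) (hdiag : ∀ δ α, L α δ α = if α = δ then 1 else 0)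
    (hmul : ∀ α γ, L α * L γ = U α γ • (1 : Matrix ι ι (ZMod 2))) : Subsingleton ι := by
  have hcol : ∀ α γ δ, L α δ γ = if γ = δ then U α γ else 0 := by
    intro α γ δ
    have h1 := congrFun (congrFun (hmul α γ) δ) γ
    simpa [Matrix.mul_apply, hdiag, Matrix.one_apply, eq_comm] using h1
  refine ⟨fun α γ => ?_⟩
  by_contra hne
  have h1 : ∀ α, U α α = 1 := fun α => by simpa [hdiag] using (hcol α α α).symm
  have h2 := hsymm γ α γ
  rw [hcol, hcol, if_pos rfl, if_neg hne] at h2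
  have h3 : L α * L α * L γ = 0 := by rw [mul_assoc, hmul α γ, h2]; simp
  rw [hmul, h1, one_smul, one_mul] at h3
  have h4 := hdiag γ γ
  simp [h3] at h4

theorem subsingleton_and_isEmpty_of_sum_eq {ι κ : Type*} [Fintype ι] [Fintype κ] [DecidableEq ι]
    [DecidableEq κ] [hι : Nonempty ι] (n : ℕ) {N N' : ι → ι → ι → ZMod 2}
    {NT : κ → ι → κ → ZMod 2} {v : ι → ZMod 2} {U : ι → ι → ZMod 2}
    (hsymm : ∀ δ α β, N' δ α β + N δ α β = N' δ β α + N δ β α)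
    (hdiag : ∀ δ α, N' δ α α + N δ α α = if α = δ then 1 else 0)
    (hv : ∀ δ α β, N' δ α β + (n : ZMod 2) * N δ α β = if β = δ then v α else 0)
    (hvT : ∀ t α t', ((n : ZMod 2) + 1) * NT t α t' = if t' = t then v α else 0)
    (hU : ∀ δ α γ β, ∑ ε, N δ ε β * N ε α γ + ∑ ε, N δ ε β * N ε γ α + ∑ ε, N δ α ε * N ε γ β =
      if β = δ then U α γ else 0)
    (hUT : ∀ t α γ t', ∑ ε, NT t ε t' * N ε α γ + ∑ ε, NT t ε t' * N ε γ α +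
      ∑ s, NT t α s * NT s γ t' = if t' = t then U α γ else 0) :
    Subsingleton ι ∧ IsEmpty κ := by
  obtain ⟨α₀⟩ := hι
  rcases Nat.even_or_odd n with he | ho
  · have hn : (n : ZMod 2) = 0 := (ZMod.natCast_eq_zero_iff_even).2 he
    simp only [hn, zero_mul, add_zero, zero_add, one_mul] at hv hvT
    set L : ι → Matrix ι ι (ZMod 2) := fun α => Matrix.of fun δ β => N' δ α β + N δ α β with hL
    have hNL : ∀ δ α β, N δ α β = L α δ β + if β = δ then v α else 0 := by
      intro δ α β
      rw [← hv, hL]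
      simp only [Matrix.of_apply]
      grind
    have hLs : ∀ δ α β, L α δ β = L β δ α := hsymm
    have hLd : ∀ δ α, L α δ α = if α = δ then 1 else 0 := hdiag
    clear_value L
    have hNN : ∀ ε α γ, N ε α γ + N ε γ α = (if γ = ε then v α else 0) + if α = ε then v γ else 0 := by
      intro ε α γ
      rw [hNL, hNL, hLs ε α γ]
      grind
    have hmul : ∀ α γ, L α * L γ = (U α γ + v α * v γ) • (1 : Matrix ι ι (ZMod 2)) := by
      intro α γ
      ext δ β
      have h1 := hU δ α γ β
      rw [← Finset.sum_add_distrib] at h1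
      simp only [← mul_add, hNN] at h1
      simp only [hNL, mul_add, add_mul, mul_ite, ite_mul, mul_zero, zero_mul,
        Finset.sum_add_distrib, Finset.sum_ite_eq, Finset.sum_ite_eq', Finset.mem_univ,
        if_true] at h1
      rw [Matrix.mul_apply, Matrix.smul_apply, Matrix.one_apply]
      by_cases hβ : β = δ
      · subst hβ
        simp at h1 ⊢
        grind
      · simp [hβ, Ne.symm hβ] at h1 ⊢
        grind
    refine ⟨subsingleton_of_mul_eq_scalar hLs hLd hmul, ⟨fun t => ?_⟩⟩
    have h1 := hUT t α₀ α₀ t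
    rw [← Finset.sum_add_distrib] at h1
    simp only [← mul_add, hNN] at h1
    simp only [hvT, mul_add, mul_ite, ite_mul, mul_zero, zero_mul,
      Finset.sum_add_distrib, Finset.sum_ite_eq, Finset.mem_univ,
      if_true] at h1
    have h2 := congrFun (congrFun (hmul α₀ α₀) α₀) α₀
    simp [Matrix.mul_apply, hLd] at h2
    grind
  · have hn : (n : ZMod 2) = 1 := (ZMod.natCast_eq_one_iff_odd).2 ho
    simp only [hn, one_mul] at hv hvT
    have hv1 : ∀ α, v α = 1 := fun α => by simpa [hdiag] using (hv α α α).symm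
    refine ⟨⟨fun α β => ?_⟩, ⟨fun t => ?_⟩⟩
    · by_contra hne
      have h1 := hsymm β α β
      rw [hv, hv, hv1, if_pos rfl, if_neg hne] at h1
      exact one_ne_zero h1
    · have h1 := hvT t α₀ t
      rw [hv1, if_pos rfl, show (1 + 1 : ZMod 2) = 0 from rfl, zero_mul] at h1
      exact zero_ne_one h1

variable {n : ℕ} {ι κ : Type*} [Fintype ι] [Fintype κ] [DecidableEq ι] [DecidableEq κ]
  {τ : ι → Bool} {M : MulAut (FG n) →* Matrix (Letter n ι κ) (Letter n ι κ) (ZMod 2)}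
  {Jo : MulAut (FG n) → (Letter n ι κ → Matrix (Letter n ι κ) (Letter n ι κ) (ZMod 2)) → Prop}

namespace IsModTwo

theorem subsingleton_and_isEmpty (h : IsModTwo τ M Jo) (hn : 6 ≤ n) [hι : Nonempty ι] :
    Subsingleton ι ∧ IsEmpty κ := by
  have hτ := h.type_eq_true hn
  obtain ⟨i₁, i₂, i₃, i₄, i₅, h12, h13, h14, h15, h23, h24, h25, h34, h35, h45⟩ :=
    exists_five_ne hn
  obtain ⟨σ, hσ, hpar⟩ := h.exists_pc i₁ i₂ h12
  have hS := fun δ α β => h.entry_add_symm hτ h12 h13 h14 h15 h23 h24 h25 h34 h35 h45 hσ hpar δ α β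
  obtain ⟨v, hv, hvT⟩ := h.exists_sum_eq hτ h12 h14.symm h24.symm hσ
  obtain ⟨U, hU⟩ := h.exists_bracket hτ h12 h13 h14 h23 h24 h34 hσ hpar
  have hN := fun δ α β => h.entry_eq hτ h12 h15.symm h25.symm h14.symm h24.symm hσ δ α β
  have hUι : ∀ δ α γ β,
      ∑ ε, σ (.inl (i₄, δ)) (.inl (i₂, ε)) (.inl (i₄, β)) *
        σ (.inl (i₄, ε)) (.inl (i₂, α)) (.inl (i₄, γ)) +
      ∑ ε, σ (.inl (i₄, δ)) (.inl (i₂, ε)) (.inl (i₄, β)) *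
        σ (.inl (i₄, ε)) (.inl (i₂, γ)) (.inl (i₄, α)) +
      ∑ ε, σ (.inl (i₄, δ)) (.inl (i₂, α)) (.inl (i₄, ε)) *
        σ (.inl (i₄, ε)) (.inl (i₂, γ)) (.inl (i₄, β)) = if β = δ then U α γ else 0 := by
    intro δ α γ β
    have h1 := hU (.inl (i₅, β)) (.inl (i₅, δ)) α γ
      (by simp [letterSign, h15.symm, h25.symm, h35.symm, h45.symm])
      (by simp [letterSign, h15.symm, h25.symm, h35.symm, h45.symm])
    rw [sum_letter_eq (k := i₅) (fun q => _ * σ q _ _)] at h1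
    · simpa [hN] using h1
    · intro q hq
      have p5 := hpar _ _ _ (right_ne_zero_of_mul hq) i₅
      simp only [letterSign_inl, h25, h25.symm, if_true, if_false, one_mul] at p5
      exact exists_eq_inl_of_letterSign p5.symm
  have hUκ : ∀ t α γ t',
      ∑ ε, σ (.inr t) (.inl (i₂, ε)) (.inr t') *
        σ (.inl (i₄, ε)) (.inl (i₂, α)) (.inl (i₄, γ)) +
      ∑ ε, σ (.inr t) (.inl (i₂, ε)) (.inr t') *
        σ (.inl (i₄, ε)) (.inl (i₂, γ)) (.inl (i₄, α)) +
      ∑ s, σ (.inr t) (.inl (i₂, α)) (.inr s) *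
        σ (.inr s) (.inl (i₂, γ)) (.inr t') = if t' = t then U α γ else 0 := by
    intro t α γ t'
    have h1 := hU (.inr t') (.inr t) α γ (by simp [letterSign]) (by simp [letterSign])
    rw [Fintype.sum_sum_type, Finset.sum_eq_zero (s := Finset.univ (α := Fin n × ι)),
      zero_add] at h1
    · simpa using h1
    · rintro ⟨k, ε⟩ -
      by_contra h0
      have pk := hpar _ _ _ (right_ne_zero_of_mul h0) k
      by_cases hk : k = i₂
      · simp [letterSign, hk] at pk
      · simp [letterSign, hk, Ne.symm hk] at pk
  exact subsingleton_and_isEmpty_of_sum_eq n (fun δ α β => (hS δ α β).1)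
    (fun δ α => (hS δ α α).2) hv hvT hUι hUκ

end IsModTwo

end MultiplicityOne

theorem map_rho_eq_one_of_choose {n m : ℕ} (hn : 6 ≤ n) (hnm : n ≠ m) (hm : m < n.choose 2)
    (ψ : MulAut (FG n) →* OutFG m) (hψ : ∀ u, ψ (MulAut.conj u) = 1) {i k : Fin n} (hik : i ≠ k) :
    ψ (rho i k) = 1 := by
  obtain ⟨r, t, P, P', hP, hP', hM⟩ := exists_isAdapted hn hm ((outMat m).comp ψ)
    (fun u => by rw [MonoidHom.comp_apply, hψ, map_one])
  rcases isEmpty_or_nonempty (Σ b, Fin (r b)) with hι | hι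
  · refine map_rho_eq_one (by omega) ψ (fun i j hij => ?_) hik
    obtain ⟨f, hf⟩ := toOut_surjective m (ψ (rho i j))
    refine ⟨f, hf, mem_lcsKer_one_of_abMat ?_⟩
    have h1 := hM.rho_eq_one_of_isEmpty hij
    rw [conjRep_apply, MonoidHom.comp_apply, ← hf, outMat_toOut] at h1
    calc abMat f = P' * (P * abMat f * P') * P := by
          simp only [← Matrix.mul_assoc, hP', Matrix.one_mul]
          rw [Matrix.mul_assoc, hP', Matrix.mul_one]
      _ = 1 := by rw [h1, Matrix.mul_one, hP']
  · exfalso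
    obtain ⟨α⟩ := hι
    have : Nontrivial (Letter n (Σ b, Fin (r b)) (Fin t)) :=
      ⟨.inl (⟨0, by omega⟩, α), .inl (⟨1, by omega⟩, α), by simp⟩
    obtain ⟨Jo, hJ, hb⟩ := exists_isJohnson ψ hψ P P' hP hP'
    have : Nonempty (Σ b, Fin (r b)) := ⟨α⟩
    obtain ⟨hs, he⟩ := (hM.isModTwo hn hJ hb).subsingleton_and_isEmpty hn
    have hcard := Matrix.square_of_invertible P P' hP hP'
    rw [Fintype.card_sum, Fintype.card_prod, Fintype.card_eq_one_iff.2 ⟨α, fun β => hs.elim β α⟩,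
      Fintype.card_eq_zero (α := Fin t), Fintype.card_fin, Fintype.card_fin, mul_one,
      add_zero] at hcard
    exact hnm hcard

/-- If `n ≠ m`, `n ≥ 6` and `m < n(n-1)/2`, then the image of any
homomorphism `Out(F_n) → Out(F_m)` has at most two elements. -/
theorem outFG_hom_image_le_two (n m : ℕ) (hn : 6 ≤ n) (hnm : n ≠ m)
    (hm : m < n * (n - 1) / 2) (φ : OutFG n →* OutFG m) :
    ∃ a b : OutFG m, ∀ g : OutFG n, φ g = a ∨ φ g = b := by
  have hψ : ∀ u, (φ.comp (toOut n)) (MulAut.conj u) = 1 := fun u => by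
    rw [MonoidHom.comp_apply, toOut_conj, map_one]
  refine ⟨1, φ (toOut n (eps ⟨0, by omega⟩)), fun g => ?_⟩
  obtain ⟨f, rfl⟩ := toOut_surjective n g
  exact map_eq_one_or_of_map_rho (φ.comp (toOut n)) (fun i j hij =>
    map_rho_eq_one_of_choose hn hnm (by rwa [Nat.choose_two_right]) _ hψ hij) _ f
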